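/- arXiv:1912.08250 — 3 statements merged into one kernel-verified Lean document; each statement's English description precedes it below -/
import Mathlib

section
/- Let (θ_n)_{n≥−1} be arbitrary real numbers and for l ∈ {−1,0,1} let Λ_l = {e^{(1+n)/2} e^{iθ_n} : n ≥ l}. Then: (i) for every p with 4 < p < ∞, the set Λ_{−1} is a complete interpolating sequence for F^p_φ; (ii) for every p with 4/3 < p < 4, the set Λ_0 is a complete interpolating sequence for F^p_φ; (iii) for every p with 1 ≤ p < 4/3, the set Λ_1 is a complete interpolating sequence for F^p_φ. -/
open MeasureTheory Complex
open scoped ENNReal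

noncomputable section

/-- `log⁺ t = max (log t) 0`. -/
def logPlus (t : ℝ) : ℝ := max (Real.log t) 0

/-- The weight `φ(z) = α (log⁺ |z|)²`. -/
def phi (α : ℝ) (z : ℂ) : ℝ := α * (logPlus ‖z‖) ^ 2

/-- `‖f‖_{p,φ}^p = ∫_ℂ |f(z) e^{-φ(z)}|^p dm(z)` as an extended nonnegative real. -/
def fockNormP (α p : ℝ) (f : ℂ → ℂ) : ℝ≥0∞ :=
  ∫⁻ z : ℂ, ENNReal.ofReal ((‖f z‖ * Real.exp (-(phi α z))) ^ p)

/-- Membership in the Fock space `F^p_φ`: entire and finite norm. -/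
def MemFock (α p : ℝ) (f : ℂ → ℂ) : Prop :=
  Differentiable ℂ f ∧ fockNormP α p f < ⊤

/-- The discrete norm `‖f‖_{p,φ,Λ}^p = Σ_{λ∈Λ} (1+|λ|)² |f(λ)|^p e^{-pφ(λ)}`. -/
def discNormP (α p : ℝ) (Λ : Set ℂ) (f : ℂ → ℂ) : ℝ≥0∞ :=
  ∑' lam : Λ, ENNReal.ofReal
    ((1 + ‖(lam : ℂ)‖) ^ 2 * ‖f (lam : ℂ)‖ ^ p *
      Real.exp (-(p * phi α (lam : ℂ))))

/-- `Λ` is sampling for `F^p_φ`. -/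
def Sampling (α p : ℝ) (Λ : Set ℂ) : Prop :=
  ∃ C : ℝ, 1 ≤ C ∧ ∀ f : ℂ → ℂ, MemFock α p f →
    (ENNReal.ofReal C)⁻¹ * fockNormP α p f ≤ discNormP α p Λ f ∧
    discNormP α p Λ f ≤ ENNReal.ofReal C * fockNormP α p f

/-- `Λ` is interpolating for `F^p_φ`. -/
def Interpolating (α p : ℝ) (Λ : Set ℂ) : Prop :=
  ∀ v : ℂ → ℂ,
    (∑' lam : Λ, ENNReal.ofReal
      ((1 + ‖(lam : ℂ)‖) ^ 2 * ‖v (lam : ℂ)‖ ^ p *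
        Real.exp (-(p * phi α (lam : ℂ))))) < ⊤ →
    ∃ f : ℂ → ℂ, MemFock α p f ∧ ∀ lam ∈ Λ, f lam = v lam

/-- `Λ` is a complete interpolating sequence for `F^p_φ`. -/
def CompleteInterpolating (α p : ℝ) (Λ : Set ℂ) : Prop :=
  Sampling α p Λ ∧ Interpolating α p Λ

/-- `ρ(z) = |z| / √(2α)`. -/
def rhoF (α : ℝ) (z : ℂ) : ℝ := ‖z‖ / Real.sqrt (2 * α)

/-- `d_ρ(z,w) = |z-w| / (1 + min(ρ(z), ρ(w)))`. -/
def dRho (α : ℝ) (z w : ℂ) : ℝ :=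
  ‖z - w‖ / (1 + min (rhoF α z) (rhoF α w))

/-- `Λ` is `d_ρ`-separated. -/
def DRhoSeparated (α : ℝ) (Λ : Set ℂ) : Prop :=
  ∃ ε : ℝ, 0 < ε ∧ ∀ l ∈ Λ, ∀ l' ∈ Λ, l ≠ l' → ε ≤ dRho α l l'

/-- The average `(1/N) Σ_{k=n}^{n+N-1} δ_k`. -/
def avgD (δ : ℕ → ℝ) (N n : ℕ) : ℝ := (1 / (N : ℝ)) * ∑ k ∈ Finset.range N, δ (n + k)
/-- The point `λ_n = e^{(1+n)/2} e^{iθ_n}`. -/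
def lamPt (θ : ℤ → ℝ) (n : ℤ) : ℂ :=
  (Real.exp ((1 + (n : ℝ)) / 2) : ℂ) * Complex.exp ((θ n : ℂ) * Complex.I)

/-- The set `Λ_l = {λ_n : n ≥ l}`. -/
def LamSet (θ : ℤ → ℝ) (l : ℤ) : Set ℂ := {w : ℂ | ∃ n : ℤ, l ≤ n ∧ w = lamPt θ n}


/-- exponentially decaying kernel -/
def EK (δ : ℝ) (i j : ℕ) : ℝ := Real.exp (-(δ * |(i : ℝ) - j|))

lemma EK_pos (δ : ℝ) (i j : ℕ) : 0 < EK δ i j := Real.exp_pos _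

lemma EK_symm (δ : ℝ) (i j : ℕ) : EK δ i j = EK δ j i := by
  unfold EK; rw [abs_sub_comm]

lemma EK_le_one {δ : ℝ} (hδ : 0 ≤ δ) (i j : ℕ) : EK δ i j ≤ 1 := by
  unfold EK
  rw [Real.exp_le_one_iff]
  have := mul_nonneg hδ (abs_nonneg ((i : ℝ) - j))
  linarith

lemma geo_summable {δ : ℝ} (hδ : 0 < δ) : Summable (fun n : ℕ => Real.exp (-(δ * n))) := by
  have h : (fun n : ℕ => Real.exp (-(δ * n))) = fun n : ℕ => (Real.exp (-δ)) ^ n := by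
    funext n
    rw [← Real.exp_nat_mul]; congr 1; ring
  rw [h]
  exact summable_geometric_of_lt_one (Real.exp_pos _).le (by rw [Real.exp_lt_one_iff]; linarith)

lemma EK_int_summable {δ : ℝ} (hδ : 0 < δ) :
    Summable (fun n : ℤ => Real.exp (-(δ * |(n : ℝ)|))) := by
  apply Summable.of_nat_of_neg
  · simpa using geo_summable hδ
  · simpa using geo_summable hδ

/-- Row sums of the kernel are uniformly bounded. -/
lemma EK_tsum_le {δ : ℝ} (hδ : 0 < δ) :
    ∃ A : ℝ≥0∞, A ≠ ⊤ ∧ ∀ i, ∑' j, ENNReal.ofReal (EK δ i j) ≤ A := by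
  refine ⟨∑' n : ℤ, ENNReal.ofReal (Real.exp (-(δ * |(n : ℝ)|))), ?_, ?_⟩
  · exact (EK_int_summable hδ).tsum_ofReal_ne_top
  · intro i
    have hinj : Function.Injective (fun j : ℕ => (i : ℤ) - j) := by
      intro a b h; simp at h; exact h
    have := ENNReal.tsum_comp_le_tsum_of_injective hinj
      (fun n : ℤ => ENNReal.ofReal (Real.exp (-(δ * |(n : ℝ)|))))
    refine le_trans (le_of_eq ?_) this
    congr 1; funext j; simp [EK]

lemma jensen_tsum {p : ℝ} (hp : 1 ≤ p) (t w : ℕ → ℝ≥0∞) :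
    (∑' j, t j * w j) ^ p ≤ (∑' j, t j) ^ (p - 1) * ∑' j, t j * w j ^ p := by
  have hp0 : 0 < p := by linarith
  have h1 : ∑' j, t j * w j ≤ (∑' j, t j) ^ (1 - p⁻¹) * (∑' j, t j * w j ^ p) ^ p⁻¹ := by
    rw [ENNReal.tsum_eq_iSup_sum]
    refine iSup_le fun s => ?_
    refine (ENNReal.inner_le_weight_mul_Lp_of_nonneg s hp t w).trans ?_
    have : 0 ≤ 1 - p⁻¹ := by
      have := inv_le_one_of_one_le₀ hp; linarith
    gcongr
    · exact ENNReal.sum_le_tsum s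
    · exact ENNReal.sum_le_tsum s
  calc (∑' j, t j * w j) ^ p ≤ ((∑' j, t j) ^ (1 - p⁻¹) * (∑' j, t j * w j ^ p) ^ p⁻¹) ^ p := by
        gcongr
    _ = _ := by
        rw [ENNReal.mul_rpow_of_nonneg _ _ hp0.le, ← ENNReal.rpow_mul, ← ENNReal.rpow_mul,
          inv_mul_cancel₀ hp0.ne', ENNReal.rpow_one]
        congr 2
        field_simp

lemma schur_EK {p δ : ℝ} (hp : 1 ≤ p) (hδ : 0 < δ) :
    ∃ C : ℝ≥0∞, C ≠ ⊤ ∧ ∀ w : ℕ → ℝ≥0∞,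
      ∑' i, (∑' j, ENNReal.ofReal (EK δ i j) * w j) ^ p ≤ C * ∑' j, w j ^ p := by
  obtain ⟨A, hA, hrow⟩ := EK_tsum_le hδ
  refine ⟨A ^ (p - 1) * A, ENNReal.mul_ne_top (ENNReal.rpow_ne_top_of_nonneg (by linarith) hA) hA,
    fun w => ?_⟩
  calc ∑' i, (∑' j, ENNReal.ofReal (EK δ i j) * w j) ^ p
      ≤ ∑' i, A ^ (p - 1) * ∑' j, ENNReal.ofReal (EK δ i j) * w j ^ p := by
        refine ENNReal.tsum_le_tsum fun i => (jensen_tsum hp _ _).trans ?_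
        have : 0 ≤ p - 1 := by linarith
        gcongr
        exact hrow i
    _ = A ^ (p - 1) * ∑' j, (∑' i, ENNReal.ofReal (EK δ i j)) * w j ^ p := by
        rw [ENNReal.tsum_mul_left, ENNReal.tsum_comm]
        congr 2; funext j; rw [ENNReal.tsum_mul_right]
    _ ≤ A ^ (p - 1) * ∑' j, A * w j ^ p := by
        gcongr with j
        simp_rw [fun i => EK_symm δ i j]
        exact hrow j
    _ = _ := by rw [ENNReal.tsum_mul_left, mul_assoc]

/-- domination form of the Schur test -/
lemma schur_dom {p δ : ℝ} (hp : 1 ≤ p) (hδ : 0 < δ) :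
    ∀ M : ℝ, ∃ C : ℝ≥0∞, C ≠ ⊤ ∧ ∀ w x : ℕ → ℝ≥0∞,
      (∀ i, x i ≤ ∑' j, ENNReal.ofReal (M * EK δ i j) * w j) →
      ∑' i, x i ^ p ≤ C * ∑' j, w j ^ p := by
  intro M
  obtain ⟨C, hC, h⟩ := schur_EK hp hδ
  have hp0 : 0 ≤ p := by linarith
  refine ⟨ENNReal.ofReal M ^ p * C, ENNReal.mul_ne_top
    (ENNReal.rpow_ne_top_of_nonneg hp0 ENNReal.ofReal_ne_top) hC, fun w x hx => ?_⟩
  calc ∑' i, x i ^ p ≤ ∑' i, (ENNReal.ofReal M * ∑' j, ENNReal.ofReal (EK δ i j) * w j) ^ p := by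
        refine ENNReal.tsum_le_tsum fun i => ?_
        refine ENNReal.rpow_le_rpow ((hx i).trans (le_of_eq ?_)) hp0
        rw [← ENNReal.tsum_mul_left]
        congr 1; funext j
        rw [ENNReal.ofReal_mul' (EK_pos _ _ _).le, mul_assoc]
    _ = ENNReal.ofReal M ^ p * ∑' i, (∑' j, ENNReal.ofReal (EK δ i j) * w j) ^ p := by
        rw [← ENNReal.tsum_mul_left]
        congr 1; funext i
        rw [ENNReal.mul_rpow_of_nonneg _ _ hp0]
    _ ≤ _ := by
        rw [mul_assoc]; gcongr; exact h w

lemma EK_summable_right {δ : ℝ} (hδ : 0 < δ) (i : ℕ) : Summable (fun j => EK δ i j) := by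
  have hinj : Function.Injective (fun j : ℕ => (i : ℤ) - j) := by
    intro a b h; simp at h; exact h
  have := (EK_int_summable hδ).comp_injective hinj
  refine this.congr fun j => ?_
  simp [EK]

lemma EK_double {δ : ℝ} (hδ : 0 < δ) (k : ℕ) (w : ℕ → ℝ≥0∞) (B : ℝ≥0∞) (hB : B ≠ ⊤)
    (hw : ∀ j, w j ≤ B) :
    ∑' n, ∑' j, ENNReal.ofReal (EK δ k n) * ENNReal.ofReal (EK δ n j) * w j ≠ ⊤ := by
  obtain ⟨A, hA, hrow⟩ := EK_tsum_le hδ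
  refine ne_top_of_le_ne_top (ENNReal.mul_ne_top hA (ENNReal.mul_ne_top hA hB)) ?_
  calc ∑' n, ∑' j, ENNReal.ofReal (EK δ k n) * ENNReal.ofReal (EK δ n j) * w j
      ≤ ∑' n, ∑' j, ENNReal.ofReal (EK δ k n) * ENNReal.ofReal (EK δ n j) * B := by
        gcongr with n j; exact hw j
    _ = ∑' n, ENNReal.ofReal (EK δ k n) * ((∑' j, ENNReal.ofReal (EK δ n j)) * B) := by
        congr 1; funext n
        rw [ENNReal.tsum_mul_right, ENNReal.tsum_mul_left, mul_assoc]
    _ ≤ ∑' n, ENNReal.ofReal (EK δ k n) * (A * B) := by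
        gcongr with n; exact hrow n
    _ ≤ _ := by
        rw [ENNReal.tsum_mul_right]; gcongr; exact hrow k

/-- Gaussian kernels are dominated by the exponential kernel. -/
lemma gauss_le (x y δ u c : ℝ) (hδ : 0 ≤ δ) (hδ1 : δ ≤ 1) (hu : 0 ≤ u) (hu1 : u ≤ 1)
    (hxy : |x - y| ≤ c) :
    Real.exp (-(x ^ 2) / 4 + |x| + u * x) ≤ Real.exp (9 + c) * Real.exp (-(δ * |y|)) := by
  rw [← Real.exp_add, Real.exp_le_exp]
  have h1 : u * x ≤ |x| := by
    calc u * x ≤ |u * x| := le_abs_self _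
      _ = u * |x| := by rw [abs_mul, abs_of_nonneg hu]
      _ ≤ |x| := by nlinarith [abs_nonneg x]
  have h2 : |y| ≤ |x| + c := by
    have := abs_sub_abs_le_abs_sub y x
    rw [abs_sub_comm] at this; linarith
  have h3 : δ * |y| ≤ |x| + c := by nlinarith [abs_nonneg y]
  have h4 : x ^ 2 = |x| ^ 2 := (sq_abs x).symm
  rw [h4]
  nlinarith [sq_nonneg (|x| - 6)]



/-- coefficient weight -/
def wA (u : ℝ) (k : ℕ) : ℝ := Real.exp ((k : ℝ) ^ 2 / 4 + u * k)
/-- sample weight -/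
def wW (u d : ℝ) (n : ℕ) : ℝ := Real.exp (-((n : ℝ) + d) ^ 2 / 4 + u * (n + d))

lemma wA_pos (u : ℝ) (k : ℕ) : 0 < wA u k := Real.exp_pos _
lemma wW_pos (u d : ℝ) (k : ℕ) : 0 < wW u d k := Real.exp_pos _

lemma rho_bd {δ u d : ℝ} (hδ : 0 ≤ δ) (hδ1 : δ ≤ 1) (hu : 0 ≤ u) (hu1 : u ≤ 1)
    (hd : 0 ≤ d) (hd2 : d ≤ 2) (n j : ℕ) :
    Real.exp (((n : ℝ) + d) / 2) ^ j * wW u d n ≤ Real.exp 11 * EK δ n j * wA u j := by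
  have h := gauss_le ((n : ℝ) + d - j) ((n : ℝ) - j) δ u 2 hδ hδ1 hu hu1 (by
    rw [show (n : ℝ) + d - j - (n - j) = d by ring, abs_of_nonneg hd]; exact hd2)
  have h2 : Real.exp (((n : ℝ) + d) / 2) ^ j * wW u d n =
      Real.exp (-((n : ℝ) + d - j) ^ 2 / 4 + u * ((n : ℝ) + d - j)) * wA u j := by
    unfold wA wW
    rw [← Real.exp_nat_mul, ← Real.exp_add, ← Real.exp_add]
    congr 1; ring
  rw [h2]
  refine mul_le_mul_of_nonneg_right ?_ (wA_pos _ _).le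
  refine le_trans ?_ (h.trans (le_of_eq ?_))
  · rw [Real.exp_le_exp]
    have := abs_nonneg ((n : ℝ) + d - j)
    linarith
  · unfold EK; norm_num

lemma coeff_prod_le (s : Finset ℕ) (c μ : ℕ → ℂ) {r : ℝ} (hr : 0 ≤ r) (K : ℕ) :
    ∑ k ∈ Finset.range K, ‖(∏ j ∈ s, (Polynomial.C (c j) *
      (Polynomial.X - Polynomial.C (μ j)))).coeff k‖ * r ^ k ≤
      ∏ j ∈ s, (‖c j‖ * (r + ‖μ j‖)) := by
  induction s using Finset.induction_on generalizing K with
  | empty =>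
    simp only [Finset.prod_empty, Polynomial.coeff_one]
    rcases Nat.eq_zero_or_pos K with h | h
    · simp [h]
    · rw [Finset.sum_eq_single 0]
      · simp
      · intro b _ hb; simp [hb]
      · intro h0; simp at h0; omega
  | insert a s ha ih =>
    rw [Finset.prod_insert ha, Finset.prod_insert ha]
    set P := ∏ j ∈ s, (Polynomial.C (c j) * (Polynomial.X - Polynomial.C (μ j))) with hP
    set B := ∏ j ∈ s, (‖c j‖ * (r + ‖μ j‖)) with hB
    have hterm : ∀ k, (Polynomial.C (c a) * (Polynomial.X - Polynomial.C (μ a)) * P).coeff k =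
        c a * ((Polynomial.X * P).coeff k - μ a * P.coeff k) := by
      intro k
      rw [mul_assoc, Polynomial.coeff_C_mul, sub_mul, Polynomial.coeff_sub, Polynomial.coeff_C_mul]
    have hX : ∑ k ∈ Finset.range K, ‖(Polynomial.X * P).coeff k‖ * r ^ k ≤ r * B := by
      rcases K with _ | K
      · simp only [Finset.range_zero, Finset.sum_empty]
        have := ih 0
        simp only [Finset.range_zero, Finset.sum_empty] at this
        positivity
      · rw [Finset.sum_range_succ']
        simp only [Polynomial.coeff_X_mul, Polynomial.coeff_X_mul_zero, norm_zero, zero_mul,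
          add_zero]
        calc ∑ k ∈ Finset.range K, ‖P.coeff k‖ * r ^ (k + 1)
            = r * ∑ k ∈ Finset.range K, ‖P.coeff k‖ * r ^ k := by
              rw [Finset.mul_sum]; refine Finset.sum_congr rfl fun k _ => ?_; ring
          _ ≤ r * B := mul_le_mul_of_nonneg_left (ih K) hr
    calc ∑ k ∈ Finset.range K, ‖(Polynomial.C (c a) * (Polynomial.X - Polynomial.C (μ a)) *
          P).coeff k‖ * r ^ k
        ≤ ∑ k ∈ Finset.range K, ‖c a‖ * (‖(Polynomial.X * P).coeff k‖ * r ^ k +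
            ‖μ a‖ * (‖P.coeff k‖ * r ^ k)) := by
          refine Finset.sum_le_sum fun k _ => ?_
          rw [hterm, norm_mul]
          have h1 := norm_sub_le ((Polynomial.X * P).coeff k) (μ a * P.coeff k)
          rw [norm_mul] at h1
          calc ‖c a‖ * ‖(Polynomial.X * P).coeff k - μ a * P.coeff k‖ * r ^ k
              ≤ ‖c a‖ * (‖(Polynomial.X * P).coeff k‖ + ‖μ a‖ * ‖P.coeff k‖) * r ^ k := by
                gcongr
            _ = _ := by ring
      _ = ‖c a‖ * (∑ k ∈ Finset.range K, ‖(Polynomial.X * P).coeff k‖ * r ^ k +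
            ‖μ a‖ * ∑ k ∈ Finset.range K, ‖P.coeff k‖ * r ^ k) := by
          rw [← Finset.mul_sum, Finset.sum_add_distrib, ← Finset.mul_sum]
      _ ≤ ‖c a‖ * (r * B + ‖μ a‖ * B) := by
          gcongr
          exact ih K
      _ = _ := by ring

lemma prod_one_add_le_exp (s : Finset ℕ) (a : ℕ → ℝ) (ha : ∀ i, 0 ≤ a i) :
    ∏ i ∈ s, (1 + a i) ≤ Real.exp (∑ i ∈ s, a i) := by
  rw [Real.exp_sum]
  refine Finset.prod_le_prod (fun i _ => by have := ha i; linarith) fun i _ => ?_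
  have := Real.add_one_le_exp (a i); linarith

/-- `Σ e^{-j/2}` -/
def S0 : ℝ := ∑' j : ℕ, Real.exp (-(1 / 2 * (j : ℝ)))

lemma S0_sum (s : Finset ℕ) : ∑ j ∈ s, Real.exp (-(1 / 2 * (j : ℝ))) ≤ S0 :=
  (geo_summable (by norm_num : (0 : ℝ) < 1 / 2)).sum_le_tsum s (fun _ _ => (Real.exp_pos _).le)

lemma exp_sum_arith (d : ℝ) (k : ℕ) :
    ∏ i ∈ Finset.range k, Real.exp (((i : ℝ) + 1 - d) / 2) =
      Real.exp ((k : ℝ) * (k + 1) / 4 - k * d / 2) := by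
  induction k with
  | zero => simp
  | succ k ih =>
    rw [Finset.prod_range_succ, ih, ← Real.exp_add]; congr 1; push_cast; ring

lemma num_bd {d : ℝ} (hd : 0 ≤ d) : ∃ C : ℝ, 0 < C ∧ ∀ k N : ℕ,
    ∏ j ∈ Finset.range N, (1 + Real.exp (((k : ℝ) - d - j) / 2)) ≤
      C * Real.exp ((k : ℝ) * (k + 1) / 4 - k * d / 2) := by
  have h1 : ∀ k N : ℕ, ∏ j ∈ Finset.range N, (1 + Real.exp (((k : ℝ) - d - j) / 2)) ≤
      Real.exp S0 * ∏ i ∈ Finset.range k, (1 + Real.exp (((i : ℝ) + 1 - d) / 2)) := by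
    intro k
    induction k with
    | zero =>
      intro N
      simp only [Finset.range_zero, Finset.prod_empty, mul_one]
      refine (prod_one_add_le_exp _ _ (fun _ => (Real.exp_pos _).le)).trans ?_
      rw [Real.exp_le_exp]
      refine le_trans (Finset.sum_le_sum fun j _ => ?_) (S0_sum (Finset.range N))
      rw [Real.exp_le_exp]; push_cast; linarith
    | succ k ih =>
      intro N
      rcases N with _ | N
      · simp only [Finset.range_zero, Finset.prod_empty]
        have hS : 1 ≤ Real.exp S0 := by
          rw [Real.one_le_exp_iff]; exact tsum_nonneg fun _ => (Real.exp_pos _).le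
        have hP : 1 ≤ ∏ i ∈ Finset.range (k + 1), (1 + Real.exp (((i : ℝ) + 1 - d) / 2)) :=
          calc (1 : ℝ) = ∏ i ∈ Finset.range (k + 1), (1 : ℝ) := by simp
            _ ≤ _ := Finset.prod_le_prod (fun _ _ => zero_le_one) fun i _ => by
              have := Real.exp_pos (((i : ℝ) + 1 - d) / 2); linarith
        nlinarith
      · rw [Finset.prod_range_succ', Finset.prod_range_succ]
        rw [← mul_assoc]
        have := ih N
        refine mul_le_mul ?_ (le_of_eq ?_) (by positivity) (by positivity)
        · refine le_trans (le_of_eq ?_) this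
          refine Finset.prod_congr rfl fun j _ => ?_
          push_cast; congr 3; ring
        · push_cast; congr 3; ring
  refine ⟨Real.exp S0 * Real.exp (Real.exp (d / 2) * S0), by positivity, fun k N => ?_⟩
  refine (h1 k N).trans ?_
  rw [mul_assoc]
  refine mul_le_mul_of_nonneg_left ?_ (Real.exp_pos _).le
  calc ∏ i ∈ Finset.range k, (1 + Real.exp (((i : ℝ) + 1 - d) / 2))
      = (∏ i ∈ Finset.range k, (1 + Real.exp (d / 2 - ((i : ℝ) + 1) / 2))) *
        ∏ i ∈ Finset.range k, Real.exp (((i : ℝ) + 1 - d) / 2) := by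
        rw [← Finset.prod_mul_distrib]
        refine Finset.prod_congr rfl fun i _ => ?_
        rw [add_mul, ← Real.exp_add, one_mul, add_comm]
        congr 1
        rw [← Real.exp_zero]; congr 1; ring
    _ ≤ Real.exp (Real.exp (d / 2) * S0) * Real.exp ((k : ℝ) * (k + 1) / 4 - k * d / 2) := by
        rw [exp_sum_arith]
        refine mul_le_mul_of_nonneg_right ?_ (Real.exp_pos _).le
        refine (prod_one_add_le_exp _ _ (fun _ => (Real.exp_pos _).le)).trans ?_
        rw [Real.exp_le_exp]
        refine le_trans ?_ (mul_le_mul_of_nonneg_left (S0_sum (Finset.range k)) (Real.exp_pos _).le)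
        rw [Finset.mul_sum]
        refine Finset.sum_le_sum fun i _ => ?_
        rw [← Real.exp_add, Real.exp_le_exp]; linarith

lemma qprod_lower : ∃ c : ℝ, 0 < c ∧ ∀ m : ℕ,
    c ≤ ∏ i ∈ Finset.range m, (1 - Real.exp (-(((i : ℝ) + 1) / 2))) := by
  set a := 1 - Real.exp (-(1 / 2 : ℝ)) with ha
  have ha0 : 0 < a := by
    have : Real.exp (-(1 / 2 : ℝ)) < 1 := by rw [Real.exp_lt_one_iff]; norm_num
    linarith
  refine ⟨Real.exp (-(a⁻¹ * S0)), Real.exp_pos _, fun m => ?_⟩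
  calc Real.exp (-(a⁻¹ * S0))
      ≤ Real.exp (∑ i ∈ Finset.range m, -(a⁻¹ * Real.exp (-(((i : ℝ) + 1) / 2)))) := by
        rw [Real.exp_le_exp, Finset.sum_neg_distrib, neg_le_neg_iff, ← Finset.mul_sum]
        refine mul_le_mul_of_nonneg_left ?_ (inv_pos.2 ha0).le
        refine le_trans (Finset.sum_le_sum fun i _ => ?_) (S0_sum (Finset.range m))
        rw [Real.exp_le_exp]; linarith
    _ ≤ _ := by
        rw [Real.exp_sum]
        refine Finset.prod_le_prod (fun i _ => (Real.exp_pos _).le) fun i _ => ?_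
        set x := Real.exp (-(((i : ℝ) + 1) / 2)) with hx
        have hx0 : 0 < x := Real.exp_pos _
        have hxa : a ≤ 1 - x := by
          have : x ≤ Real.exp (-(1 / 2 : ℝ)) := by
            rw [hx, Real.exp_le_exp]; have : (0 : ℝ) ≤ i := Nat.cast_nonneg i; linarith
          linarith
        have h1x : 0 < 1 - x := by linarith
        rw [Real.exp_neg]
        apply inv_le_of_inv_le₀ h1x
        have h2 := Real.add_one_le_exp (a⁻¹ * x)
        refine le_trans ?_ h2
        have h3 : (1 - x)⁻¹ = (1 - x)⁻¹ * x + 1 := by field_simp; ring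
        rw [h3]
        have h4 : (1 - x)⁻¹ ≤ a⁻¹ := inv_anti₀ ha0 hxa
        nlinarith

lemma erase_eq {n N : ℕ} (h : n < N) :
    (Finset.range N).erase n = Finset.range n ∪ Finset.Ico (n + 1) N := by
  ext x; simp; omega

lemma den_bd : ∃ c : ℝ, 0 < c ∧ ∀ n N : ℕ, n < N →
    c * Real.exp ((n : ℝ) * (n + 1) / 4) ≤
      ∏ j ∈ (Finset.range N).erase n, |1 - Real.exp (((n : ℝ) - j) / 2)| := by
  obtain ⟨c, hc, h⟩ := qprod_lower
  refine ⟨c * c, by positivity, fun n N hn => ?_⟩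
  have hlt : ∀ i : ℕ, Real.exp (-(((i : ℝ) + 1) / 2)) < 1 := fun i => by
    rw [Real.exp_lt_one_iff]; have : (0 : ℝ) ≤ i := Nat.cast_nonneg i; linarith
  rw [erase_eq hn, Finset.prod_union (by
    rw [Finset.disjoint_left]; intro x; simp; omega)]
  have h1 : ∏ j ∈ Finset.range n, |1 - Real.exp (((n : ℝ) - j) / 2)| =
      (∏ i ∈ Finset.range n, (1 - Real.exp (-(((i : ℝ) + 1) / 2)))) *
        Real.exp ((n : ℝ) * (n + 1) / 4) := by
    have h0 := exp_sum_arith 0 n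
    simp only [sub_zero, mul_zero, zero_div] at h0
    rw [← h0, ← Finset.prod_mul_distrib, ← Finset.prod_range_reflect]
    refine Finset.prod_congr rfl fun i hi => ?_
    have hi' : i < n := Finset.mem_range.1 hi
    have e1 : ((n - 1 - i : ℕ) : ℝ) = n - 1 - i := by
      rw [Nat.cast_sub (by omega), Nat.cast_sub (by omega)]; simp
    rw [e1, show ((n : ℝ) - (n - 1 - i)) / 2 = ((i : ℝ) + 1) / 2 by ring, sub_mul, ← Real.exp_add,
      one_mul, neg_add_cancel, Real.exp_zero, abs_sub_comm, abs_of_nonneg]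
    have : 1 ≤ Real.exp (((i : ℝ) + 1) / 2) := by
      rw [Real.one_le_exp_iff]; positivity
    linarith
  have h2 : ∏ j ∈ Finset.Ico (n + 1) N, |1 - Real.exp (((n : ℝ) - j) / 2)| =
      ∏ i ∈ Finset.range (N - (n + 1)), (1 - Real.exp (-(((i : ℝ) + 1) / 2))) := by
    rw [Finset.prod_Ico_eq_prod_range]
    refine Finset.prod_congr rfl fun i _ => ?_
    rw [abs_of_nonneg]
    · push_cast; congr 2; ring
    · have := hlt i
      have e : ((n : ℝ) - ((n + 1 + i : ℕ) : ℝ)) / 2 = -(((i : ℝ) + 1) / 2) := by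
        push_cast; ring
      rw [e]; linarith
  rw [h1, h2]
  have a1 := h n
  have a2 := h (N - (n + 1))
  calc c * c * Real.exp ((n : ℝ) * (n + 1) / 4) = (c * Real.exp ((n : ℝ) * (n + 1) / 4)) * c := by
        ring
    _ ≤ _ := by
        have a3 : 0 ≤ ∏ i ∈ Finset.range n, (1 - Real.exp (-(((i : ℝ) + 1) / 2))) := hc.le.trans a1
        gcongr



lemma coeff_basis_le {d : ℝ} {μ : ℕ → ℂ} (hμ : ∀ n : ℕ, ‖μ n‖ = Real.exp (((n : ℝ) + d) / 2))
    (N n k : ℕ) :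
    ‖(Lagrange.basis (Finset.range N) μ n).coeff k‖ * Real.exp ((k : ℝ) ^ 2 / 2) ≤
      (∏ j ∈ (Finset.range N).erase n, (1 + Real.exp (((k : ℝ) - d - j) / 2))) /
      ∏ j ∈ (Finset.range N).erase n, |1 - Real.exp (((n : ℝ) - j) / 2)| := by
  have h := coeff_prod_le ((Finset.range N).erase n) (fun j => (μ n - μ j)⁻¹) μ
    (Real.exp_pos ((k : ℝ) / 2)).le (k + 1)
  have hb : Lagrange.basis (Finset.range N) μ n = ∏ j ∈ (Finset.range N).erase n,
      (Polynomial.C ((μ n - μ j)⁻¹) * (Polynomial.X - Polynomial.C (μ j))) := rfl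
  rw [← hb] at h
  have h1 : ‖(Lagrange.basis (Finset.range N) μ n).coeff k‖ * Real.exp ((k : ℝ) / 2) ^ k ≤
      ∑ i ∈ Finset.range (k + 1), ‖(Lagrange.basis (Finset.range N) μ n).coeff i‖ *
        Real.exp ((k : ℝ) / 2) ^ i :=
    Finset.single_le_sum (f := fun i => ‖(Lagrange.basis (Finset.range N) μ n).coeff i‖ *
        Real.exp ((k : ℝ) / 2) ^ i) (fun i _ => by positivity) (by simp)
  have e : Real.exp ((k : ℝ) / 2) ^ k = Real.exp ((k : ℝ) ^ 2 / 2) := by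
    rw [← Real.exp_nat_mul]; congr 1; ring
  rw [e] at h1
  refine h1.trans (h.trans ?_)
  rw [← Finset.prod_div_distrib]
  refine Finset.prod_le_prod (fun j _ => by positivity) fun j hj => ?_
  have hjn : j ≠ n := (Finset.mem_erase.1 hj).1
  have hne : Real.exp (((n : ℝ) - j) / 2) ≠ 1 := by
    intro h0
    rw [Real.exp_eq_one_iff] at h0
    apply hjn
    have : (j : ℝ) = n := by linarith
    exact_mod_cast this
  have hpos : 0 < |1 - Real.exp (((n : ℝ) - j) / 2)| := abs_pos.2 (sub_ne_zero.2 hne.symm)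
  have hρ : 0 < ‖μ j‖ := by rw [hμ]; exact Real.exp_pos _
  have hd1 : |1 - Real.exp (((n : ℝ) - j) / 2)| * ‖μ j‖ ≤ ‖μ n - μ j‖ := by
    have := abs_norm_sub_norm_le (μ n) (μ j)
    refine le_trans (le_of_eq ?_) this
    rw [abs_sub_comm ‖μ n‖, ← abs_of_pos hρ, ← abs_mul, abs_of_pos hρ]
    congr 1
    rw [hμ, hμ, sub_mul, one_mul, ← Real.exp_add]
    congr 2; ring
  rw [norm_inv]
  have e2 : Real.exp ((k : ℝ) / 2) + ‖μ j‖ = (1 + Real.exp (((k : ℝ) - d - j) / 2)) * ‖μ j‖ := by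
    rw [hμ, add_mul, one_mul, ← Real.exp_add, add_comm]
    congr 2; ring
  rw [e2]
  calc ‖μ n - μ j‖⁻¹ * ((1 + Real.exp (((k : ℝ) - d - j) / 2)) * ‖μ j‖)
      ≤ (|1 - Real.exp (((n : ℝ) - j) / 2)| * ‖μ j‖)⁻¹ *
        ((1 + Real.exp (((k : ℝ) - d - j) / 2)) * ‖μ j‖) := by
        gcongr
    _ = _ := by
        field_simp

lemma basis_bd {d u δ : ℝ} (hd : 0 ≤ d) (hδ1 : δ ≤ u - d / 2 + 1 / 4)
    (hδ2 : δ ≤ 1 / 2 - (u - d / 2 + 1 / 4))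
    {μ : ℕ → ℂ} (hμ : ∀ n : ℕ, ‖μ n‖ = Real.exp (((n : ℝ) + d) / 2)) :
    ∃ M : ℝ, 0 < M ∧ ∀ N n k : ℕ, n < N →
      ‖(Lagrange.basis (Finset.range N) μ n).coeff k‖ * wA u k ≤ M * EK δ k n * wW u d n := by
  obtain ⟨C, hC, hnum⟩ := num_bd hd
  obtain ⟨c, hc, hden⟩ := den_bd
  refine ⟨C / c * Real.exp (d ^ 2 / 4 - u * d + d / 2), by positivity, fun N n k hn => ?_⟩
  have h1 := coeff_basis_le hμ N n k
  set b := ‖(Lagrange.basis (Finset.range N) μ n).coeff k‖ with hb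
  have hq : 0 < 1 + Real.exp (((k : ℝ) - d - n) / 2) := by positivity
  have h2 : (∏ j ∈ (Finset.range N).erase n, (1 + Real.exp (((k : ℝ) - d - j) / 2))) ≤
      C * Real.exp ((k : ℝ) * (k + 1) / 4 - k * d / 2) / (1 + Real.exp (((k : ℝ) - d - n) / 2)) := by
    rw [le_div_iff₀ hq, mul_comm,
      Finset.mul_prod_erase (Finset.range N) (fun j : ℕ => 1 + Real.exp (((k : ℝ) - d - j) / 2))
        (Finset.mem_range.2 hn)]
    exact hnum k N
  have h3 := hden n N hn
  have h4 : b * Real.exp ((k : ℝ) ^ 2 / 2) ≤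
      (C * Real.exp ((k : ℝ) * (k + 1) / 4 - k * d / 2) / (1 + Real.exp (((k : ℝ) - d - n) / 2))) /
      (c * Real.exp ((n : ℝ) * (n + 1) / 4)) := by
    refine h1.trans ?_
    gcongr
  -- the decay factor
  have h5 : Real.exp ((u - d / 2 + 1 / 4) * ((k : ℝ) - n)) / (1 + Real.exp (((k : ℝ) - d - n) / 2))
      ≤ Real.exp (d / 2) * EK δ k n := by
    rw [div_le_iff₀ hq]
    unfold EK
    rw [← Real.exp_add]
    rcases le_total (k : ℝ) n with hkn | hkn
    · rw [abs_of_nonpos (by linarith)]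
      have : Real.exp ((u - d / 2 + 1 / 4) * ((k : ℝ) - n)) ≤
          Real.exp (d / 2 + -(δ * -((k : ℝ) - n))) := by
        rw [Real.exp_le_exp]; nlinarith
      have hp := Real.exp_pos (((k : ℝ) - d - n) / 2)
      nlinarith [Real.exp_pos (d / 2 + -(δ * -((k : ℝ) - n)))]
    · rw [abs_of_nonneg (by linarith)]
      have : Real.exp ((u - d / 2 + 1 / 4) * ((k : ℝ) - n)) ≤
          Real.exp (d / 2 + -(δ * ((k : ℝ) - n))) * Real.exp (((k : ℝ) - d - n) / 2) := by
        rw [← Real.exp_add, Real.exp_le_exp]; nlinarith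
      nlinarith [Real.exp_pos (d / 2 + -(δ * ((k : ℝ) - n)))]
  calc b * wA u k = (b * Real.exp ((k : ℝ) ^ 2 / 2)) * Real.exp (-(k : ℝ) ^ 2 / 4 + u * k) := by
        unfold wA; rw [mul_assoc, ← Real.exp_add]; congr 2; ring
    _ ≤ ((C * Real.exp ((k : ℝ) * (k + 1) / 4 - k * d / 2) /
          (1 + Real.exp (((k : ℝ) - d - n) / 2))) / (c * Real.exp ((n : ℝ) * (n + 1) / 4))) *
          Real.exp (-(k : ℝ) ^ 2 / 4 + u * k) := by gcongr
    _ = C / c * Real.exp (d ^ 2 / 4 - u * d) * (Real.exp ((u - d / 2 + 1 / 4) * ((k : ℝ) - n)) /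
          (1 + Real.exp (((k : ℝ) - d - n) / 2))) * wW u d n := by
        have e : Real.exp ((k : ℝ) * (k + 1) / 4 - k * d / 2) * Real.exp (-(k : ℝ) ^ 2 / 4 + u * k) =
          Real.exp (d ^ 2 / 4 - u * d) * Real.exp ((u - d / 2 + 1 / 4) * ((k : ℝ) - n)) * wW u d n *
            Real.exp ((n : ℝ) * (n + 1) / 4) := by
          unfold wW
          simp only [← Real.exp_add]; congr 1; ring
        have hE := Real.exp_pos ((n : ℝ) * (n + 1) / 4)
        have : ∀ a b c' q e' x y z w : ℝ, 0 < c' → 0 < q → 0 < e' → a * b = x * y * w * e' →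
            C * a / q / (c' * e') * b = C / c' * x * (y / q) * w := by
          intro a b c' q e' x y z w h1 h2 h3 h
          field_simp
          linear_combination h
        exact this _ _ _ _ _ _ _ 0 _ hc hq hE e
    _ ≤ C / c * Real.exp (d ^ 2 / 4 - u * d) * (Real.exp (d / 2) * EK δ k n) * wW u d n := by
        have := wW_pos u d n
        gcongr
    _ = _ := by
        rw [Real.exp_add (d ^ 2 / 4 - u * d)]; ring

lemma exists_kernel {d u δ : ℝ} (hd : 0 ≤ d) (hd2 : d ≤ 2) (hu : 0 ≤ u) (hu1 : u ≤ 1)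
    (hδ : 0 < δ) (hδ1 : δ ≤ u - d / 2 + 1 / 4)
    (hδ2 : δ ≤ 1 / 2 - (u - d / 2 + 1 / 4))
    {μ : ℕ → ℂ} (hμ : ∀ n : ℕ, ‖μ n‖ = Real.exp (((n : ℝ) + d) / 2)) :
    ∃ κ : ℕ → ℕ → ℂ, ∃ M : ℝ, 0 < M ∧
      (∀ k n, ‖κ k n‖ * wA u k ≤ M * EK δ k n * wW u d n) ∧
      (∀ k j, ∑' n, κ k n * μ n ^ j = if k = j then 1 else 0) ∧
      (∀ m n, ∑' k, κ k n * μ m ^ k = if m = n then 1 else 0) := by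
  obtain ⟨M, hM, hbd⟩ := basis_bd hd hδ1 hδ2 hμ
  have hδ3 : δ ≤ 1 := by linarith
  have hinj : Function.Injective μ := by
    intro a b hab
    have h := hμ a
    rw [hab, hμ b, Real.exp_eq_exp] at h
    have : (a : ℝ) = b := by linarith
    exact_mod_cast this
  set F : ℕ → ℕ → ℕ → ℂ := fun N k n =>
    if n < N then (Lagrange.basis (Finset.range N) μ n).coeff k else 0 with hF
  have hFb : ∀ N k n, ‖F N k n‖ * wA u k ≤ M * EK δ k n * wW u d n := by
    intro N k n
    by_cases h : n < N
    · simp only [hF, h, if_true]; exact hbd N n k h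
    · simp only [hF, h, if_false, norm_zero, zero_mul]
      have := EK_pos δ k n; have := wW_pos u d n; positivity
  set U := Filter.hyperfilter ℕ with hU
  have hlim : ∀ k n, ∃ x : ℂ, Filter.Tendsto (fun N => F N k n) U (nhds x) := by
    intro k n
    set R := M * EK δ k n * wW u d n / wA u k with hR
    have hc : IsCompact (Metric.closedBall (0 : ℂ) R) := isCompact_closedBall _ _
    obtain ⟨x, -, hx⟩ := hc.ultrafilter_le_nhds' (U.map (fun N => F N k n)) (by
      rw [Ultrafilter.mem_map]
      refine Filter.mem_of_superset Filter.univ_mem fun N _ => ?_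
      simp only [Set.mem_preimage, Metric.mem_closedBall, dist_zero_right]
      rw [hR, le_div_iff₀ (wA_pos u k)]
      exact hFb N k n)
    exact ⟨x, hx⟩
  choose κ hκ using hlim
  have hlarge : ∀ m : ℕ, ∀ᶠ N in (U : Filter ℕ), m < N := fun m =>
    (Nat.hyperfilter_le_atTop : (U : Filter ℕ) ≤ Filter.atTop) (Filter.eventually_gt_atTop m)
  have hκb : ∀ k n, ‖κ k n‖ * wA u k ≤ M * EK δ k n * wW u d n := by
    intro k n
    have := ((hκ k n).norm).mul_const (wA u k)
    exact le_of_tendsto this (Filter.Eventually.of_forall fun N => hFb N k n)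
  -- the termwise domination
  have hdom : ∀ N k n m j, ‖F N k n * μ m ^ j‖ ≤
      (M * EK δ k n * wW u d n / wA u k) * (Real.exp 11 * EK δ m j * wA u j / wW u d m) := by
    intro N k n m j
    have h1 := hFb N k n
    have h2 := rho_bd hδ.le hδ3 hu hu1 hd hd2 m j
    rw [norm_mul, norm_pow, hμ]
    rw [← le_div_iff₀ (wA_pos u k)] at h1
    rw [← le_div_iff₀ (wW_pos u d m)] at h2
    have := EK_pos δ k n; have := wW_pos u d n; have := wA_pos u k
    gcongr
  refine ⟨κ, M, hM, hκb, ?_, ?_⟩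
  · intro k j
    have hT := tendsto_tsum_of_dominated_convergence (𝓕 := (U : Filter ℕ))
      (f := fun N n => F N k n * μ n ^ j) (g := fun n => κ k n * μ n ^ j)
      (bound := fun n => (M / wA u k * (Real.exp 11 * wA u j)) * EK δ k n)
      ((EK_summable_right hδ k).mul_left _)
      (fun n => (hκ k n).mul_const _) (Filter.Eventually.of_forall fun N n => by
        refine (hdom N k n n j).trans ?_
        have e1 := EK_le_one hδ.le n j
        have := EK_pos δ k n; have := wW_pos u d n; have := wA_pos u k; have := wA_pos u j
        calc (M * EK δ k n * wW u d n / wA u k) * (Real.exp 11 * EK δ n j * wA u j / wW u d n)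
            = (M / wA u k * (Real.exp 11 * wA u j)) * EK δ k n * EK δ n j := by
              field_simp
          _ ≤ (M / wA u k * (Real.exp 11 * wA u j)) * EK δ k n * 1 := by gcongr
          _ = _ := mul_one _)
    refine tendsto_nhds_unique hT (tendsto_const_nhds.congr' ?_)
    filter_upwards [hlarge j] with N hN
    rw [tsum_eq_sum (s := Finset.range N) (fun n hn => by
      have : ¬ n < N := by simpa using hn
      simp [hF, this])]
    have hP : (Polynomial.X ^ j : Polynomial ℂ) =
        Lagrange.interpolate (Finset.range N) μ fun n => (Polynomial.X ^ j : Polynomial ℂ).eval (μ n) :=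
      Lagrange.eq_interpolate (hinj.injOn) (by
        rw [Polynomial.degree_X_pow, Finset.card_range]; exact_mod_cast hN)
    have hco := congrArg (fun P : Polynomial ℂ => P.coeff k) hP
    simp only [Lagrange.interpolate_apply, Polynomial.finsetSum_coeff, Polynomial.coeff_C_mul,
      Polynomial.eval_pow, Polynomial.eval_X, Polynomial.coeff_X_pow] at hco
    rw [hco]
    refine Finset.sum_congr rfl fun n hn => ?_
    have : n < N := Finset.mem_range.1 hn
    simp [hF, this, mul_comm]
  · intro m n
    have hT := tendsto_tsum_of_dominated_convergence (𝓕 := (U : Filter ℕ))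
      (f := fun N k => F N k n * μ m ^ k) (g := fun k => κ k n * μ m ^ k)
      (bound := fun k => (M * wW u d n * (Real.exp 11 / wW u d m)) * EK δ m k)
      ((EK_summable_right hδ m).mul_left _)
      (fun k => (hκ k n).mul_const _) (Filter.Eventually.of_forall fun N k => by
        refine (hdom N k n m k).trans ?_
        have e1 := EK_le_one hδ.le k n
        have := EK_pos δ m k; have := wW_pos u d n; have := wA_pos u k; have := wW_pos u d m
        calc (M * EK δ k n * wW u d n / wA u k) * (Real.exp 11 * EK δ m k * wA u k / wW u d m)
            = (M * wW u d n * (Real.exp 11 / wW u d m)) * EK δ m k * EK δ k n := by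
              field_simp
          _ ≤ (M * wW u d n * (Real.exp 11 / wW u d m)) * EK δ m k * 1 := by gcongr
          _ = _ := mul_one _)
    refine tendsto_nhds_unique hT (tendsto_const_nhds.congr' ?_)
    filter_upwards [hlarge n, hlarge m] with N hN hm
    set P := Lagrange.basis (Finset.range N) μ n with hP
    rw [tsum_eq_sum (s := Finset.range (P.natDegree + 1)) (fun k hk => by
      have : P.natDegree < k := by simp at hk; omega
      simp [hF, hN, ← hP, Polynomial.coeff_eq_zero_of_natDegree_lt this])]
    have : ∑ k ∈ Finset.range (P.natDegree + 1), F N k n * μ m ^ k = P.eval (μ m) := by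
      rw [Polynomial.eval_eq_sum_range]
      simp [hF, hN, hP]
    rw [this]
    by_cases hmn : m = n
    · subst hmn
      rw [if_pos rfl, hP, Lagrange.eval_basis_self hinj.injOn (Finset.mem_range.2 hN)]
    · rw [if_neg hmn, hP, Lagrange.eval_basis_of_ne (Ne.symm hmn) (Finset.mem_range.2 hm)]



/-- weighted coefficient -/
def bN (u : ℝ) (a : ℕ → ℂ) (k : ℕ) : ℝ≥0∞ := ENNReal.ofReal (‖a k‖ * wA u k)

lemma bN_bounded {p u : ℝ} (hp : 1 ≤ p) {a : ℕ → ℂ} (h : ∑' k, bN u a k ^ p ≠ ⊤) :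
    ∃ B : ℝ, 0 ≤ B ∧ ∀ k, ‖a k‖ * wA u k ≤ B := by
  have hp0 : 0 < p := by linarith
  refine ⟨((∑' k, bN u a k ^ p) ^ p⁻¹).toReal, ENNReal.toReal_nonneg, fun k => ?_⟩
  have h1 : bN u a k ≤ (∑' k, bN u a k ^ p) ^ p⁻¹ := by
    rw [ENNReal.le_rpow_inv_iff hp0]
    exact ENNReal.le_tsum k
  exact (ENNReal.ofReal_le_iff_le_toReal (ENNReal.rpow_ne_top_of_nonneg (by positivity) h)).1 h1

lemma coef_summable {p u : ℝ} (hp : 1 ≤ p) (hu : 0 ≤ u) (hu1 : u ≤ 1) {a : ℕ → ℂ}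
    (h : ∑' k, bN u a k ^ p ≠ ⊤) (R : ℝ) (hR : 0 ≤ R) : Summable (fun k => ‖a k‖ * R ^ k) := by
  obtain ⟨B, hB, hb⟩ := bN_bounded hp h
  obtain ⟨n, hn⟩ := exists_nat_ge (2 * R)
  have hRn : R ≤ Real.exp (((n : ℝ) + 0) / 2) := by
    have := Real.add_one_le_exp (((n : ℝ) + 0) / 2); linarith
  refine Summable.of_nonneg_of_le (fun k => by positivity) (fun k => ?_)
    ((EK_summable_right one_pos n).mul_left (B * Real.exp 11 / wW u 0 n))
  have h1 := rho_bd (δ := 1) zero_le_one le_rfl hu hu1 le_rfl (by norm_num : (0 : ℝ) ≤ 2) n k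
  have hw := wW_pos u 0 n
  have hA := wA_pos u k
  have hE := EK_pos 1 n k
  rw [← le_div_iff₀ hw] at h1
  calc ‖a k‖ * R ^ k ≤ ‖a k‖ * Real.exp (((n : ℝ) + 0) / 2) ^ k := by gcongr
    _ ≤ ‖a k‖ * (Real.exp 11 * EK 1 n k * wA u k / wW u 0 n) := by gcongr
    _ = (‖a k‖ * wA u k) * (Real.exp 11 * EK 1 n k / wW u 0 n) := by ring
    _ ≤ B * (Real.exp 11 * EK 1 n k / wW u 0 n) := by
        gcongr; exact hb k
    _ = _ := by ring

lemma diff_of_coef {a : ℕ → ℂ} (h : ∀ R : ℝ, 0 ≤ R → Summable (fun k => ‖a k‖ * R ^ k)) :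
    Differentiable ℂ (fun z => ∑' k, a k * z ^ k) := by
  intro z
  have h1 : DifferentiableOn ℂ (fun z => ∑' k, a k * z ^ k) (Metric.ball 0 (‖z‖ + 1)) := by
    refine differentiableOn_tsum_of_summable_norm (h (‖z‖ + 1) (by positivity))
      (fun k => by fun_prop) Metric.isOpen_ball fun k w hw => ?_
    rw [norm_mul, norm_pow]
    have : ‖w‖ < ‖z‖ + 1 := by simpa using hw
    gcongr
  exact h1.differentiableAt (Metric.isOpen_ball.mem_nhds (by simp))

lemma logPlus_nonneg (t : ℝ) : 0 ≤ logPlus t := le_max_right _ _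

lemma le_exp_logPlus {t : ℝ} (ht : 0 ≤ t) : t ≤ Real.exp (logPlus t) := by
  rcases ht.eq_or_lt with h | h
  · rw [← h]; exact (Real.exp_pos _).le
  · calc t = Real.exp (Real.log t) := (Real.exp_log h).symm
      _ ≤ _ := Real.exp_le_exp.2 (le_max_left _ _)

lemma annulus_bd {u : ℝ} (hu : 0 ≤ u) (hu1 : u ≤ 1) (m k : ℕ) (z : ℂ)
    (h1 : (m : ℝ) / 2 ≤ logPlus ‖z‖) (h2 : logPlus ‖z‖ ≤ ((m : ℝ) + 1) / 2) :
    ‖z‖ ^ k * Real.exp (-(phi 1 z)) ≤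
      Real.exp 11 * EK 1 m k * wA u k * Real.exp (-(u * m)) := by
  set s := logPlus ‖z‖ with hs
  have hz : ‖z‖ ^ k ≤ Real.exp (k * s) := by
    rw [Real.exp_nat_mul]
    exact pow_le_pow_left₀ (norm_nonneg _) (le_exp_logPlus (norm_nonneg _)) k
  have hg := gauss_le (2 * s - k) ((m : ℝ) - k) 1 u 1 zero_le_one le_rfl hu hu1 (by
    rw [show 2 * s - k - ((m : ℝ) - k) = 2 * s - m by ring, abs_of_nonneg (by linarith)]; linarith)
  unfold EK wA phi
  rw [← hs]
  rw [← Real.exp_add, Real.exp_le_exp] at hg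
  calc ‖z‖ ^ k * Real.exp (-(1 * s ^ 2)) ≤ Real.exp (k * s) * Real.exp (-(1 * s ^ 2)) := by gcongr
    _ ≤ _ := by
      simp only [← Real.exp_add]
      rw [Real.exp_le_exp]
      have := abs_nonneg (2 * s - k)
      nlinarith

lemma fock_le {p : ℝ} (hp : 1 ≤ p) : ∃ C : ℝ≥0∞, C ≠ ⊤ ∧ ∀ (a : ℕ → ℂ) (f : ℂ → ℂ),
    (∀ z, f z = ∑' k, a k * z ^ k) → fockNormP 1 p f ≤ C * ∑' k, bN (1 / p) a k ^ p := by
  have hp0 : 0 < p := by linarith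
  obtain ⟨C, hC, hS⟩ := schur_dom hp one_pos (Real.exp 11)
  set u := 1 / p with hu
  have hu0 : 0 ≤ u := by positivity
  have hu1 : u ≤ 1 := by rw [hu, div_le_one hp0]; exact hp
  refine ⟨ENNReal.ofReal (Real.exp 1 * Real.pi) * C, ENNReal.mul_ne_top ENNReal.ofReal_ne_top hC,
    fun a f hf => ?_⟩
  set x : ℕ → ℝ≥0∞ := fun m => ∑' k, ENNReal.ofReal (Real.exp 11 * EK 1 m k) * bN u a k with hx
  set Bm : ℕ → Set ℂ := fun m => {z | (m : ℝ) / 2 ≤ logPlus ‖z‖ ∧ logPlus ‖z‖ ≤ ((m : ℝ) + 1) / 2}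
    with hBm
  have hcover : (⋃ m, Bm m) = Set.univ := by
    refine Set.eq_univ_of_forall fun z => Set.mem_iUnion.2 ⟨⌊2 * logPlus ‖z‖⌋₊, ?_, ?_⟩
    · have := Nat.floor_le (a := 2 * logPlus ‖z‖) (by have := logPlus_nonneg ‖z‖; linarith)
      linarith
    · have := Nat.lt_floor_add_one (2 * logPlus ‖z‖)
      linarith
  have hpt : ∀ m, ∀ z ∈ Bm m, ENNReal.ofReal (‖f z‖ * Real.exp (-(phi 1 z))) ≤
      ENNReal.ofReal (Real.exp (-(u * m))) * x m := by
    intro m z hz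
    rw [ENNReal.ofReal_mul (norm_nonneg _), ofReal_norm, hf]
    calc ‖∑' k, a k * z ^ k‖ₑ * ENNReal.ofReal (Real.exp (-(phi 1 z)))
        ≤ (∑' k, ‖a k * z ^ k‖ₑ) * ENNReal.ofReal (Real.exp (-(phi 1 z))) := by
          gcongr; exact enorm_tsum_le_tsum_enorm
      _ = ∑' k, ‖a k * z ^ k‖ₑ * ENNReal.ofReal (Real.exp (-(phi 1 z))) :=
          ENNReal.tsum_mul_right.symm
      _ ≤ ∑' k, ENNReal.ofReal (Real.exp (-(u * m))) *
            (ENNReal.ofReal (Real.exp 11 * EK 1 m k) * bN u a k) := by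
          refine ENNReal.tsum_le_tsum fun k => ?_
          have := annulus_bd hu0 hu1 m k z hz.1 hz.2
          have hE := EK_pos 1 m k
          rw [← ofReal_norm, bN, ← ENNReal.ofReal_mul (norm_nonneg _), ← ENNReal.ofReal_mul (by positivity),
            ← ENNReal.ofReal_mul (by positivity)]
          apply ENNReal.ofReal_le_ofReal
          rw [norm_mul, norm_pow, mul_assoc]
          calc ‖a k‖ * (‖z‖ ^ k * Real.exp (-(phi 1 z))) ≤ ‖a k‖ *
                (Real.exp 11 * EK 1 m k * wA u k * Real.exp (-(u * m))) := by gcongr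
            _ = _ := by ring
      _ = _ := ENNReal.tsum_mul_left
  have hBint : ∀ m, ∫⁻ z in Bm m, ENNReal.ofReal ((‖f z‖ * Real.exp (-(phi 1 z))) ^ p) ≤
      ENNReal.ofReal (Real.exp 1 * Real.pi) * x m ^ p := by
    intro m
    have hmeas : MeasurableSet (Bm m) := by
      have : Measurable (fun z : ℂ => logPlus ‖z‖) := by
        unfold logPlus
        exact (Real.measurable_log.comp measurable_norm).max measurable_const
      exact (measurableSet_le measurable_const this).inter (measurableSet_le this measurable_const)
    calc ∫⁻ z in Bm m, ENNReal.ofReal ((‖f z‖ * Real.exp (-(phi 1 z))) ^ p)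
        ≤ ∫⁻ z in Bm m, (ENNReal.ofReal (Real.exp (-(u * m))) * x m) ^ p := by
          refine setLIntegral_mono' hmeas fun z hz => ?_
          rw [← ENNReal.ofReal_rpow_of_nonneg (by positivity) hp0.le]
          exact ENNReal.rpow_le_rpow (hpt m z hz) hp0.le
      _ = (ENNReal.ofReal (Real.exp (-(u * m))) * x m) ^ p * volume (Bm m) := by
          rw [setLIntegral_const]
      _ ≤ (ENNReal.ofReal (Real.exp (-(u * m))) * x m) ^ p *
            volume (Metric.closedBall (0 : ℂ) (Real.exp (((m : ℝ) + 1) / 2))) := by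
          gcongr
          intro z hz
          rw [mem_closedBall_zero_iff]
          exact (le_exp_logPlus (norm_nonneg _)).trans (Real.exp_le_exp.2 hz.2)
      _ = _ := by
          rw [Complex.volume_closedBall, ENNReal.mul_rpow_of_nonneg _ _ hp0.le,
            ENNReal.ofReal_rpow_of_nonneg (Real.exp_pos _).le hp0.le, ← Real.exp_mul,
            ← ENNReal.ofReal_pow (Real.exp_pos _).le, ← Real.exp_nat_mul]
          have e1 : -(u * (m : ℝ)) * p = -m := by rw [hu]; field_simp
          have e2 : ((NNReal.pi : NNReal) : ℝ≥0∞) = ENNReal.ofReal Real.pi := by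
            rw [ENNReal.ofReal, ← NNReal.coe_real_pi, Real.toNNReal_coe]
          rw [e1, e2]
          have e3 : Real.exp 1 * Real.pi = Real.exp (-(m : ℝ)) *
              (Real.exp (((2 : ℕ) : ℝ) * (((m : ℝ) + 1) / 2)) * Real.pi) := by
            rw [← mul_assoc, ← Real.exp_add]; congr 2; push_cast; ring
          rw [e3, ENNReal.ofReal_mul (Real.exp_pos _).le, ENNReal.ofReal_mul (Real.exp_pos _).le]
          ring
  calc fockNormP 1 p f = ∫⁻ z in ⋃ m, Bm m, ENNReal.ofReal ((‖f z‖ * Real.exp (-(phi 1 z))) ^ p) := by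
        rw [hcover, setLIntegral_univ]; rfl
    _ ≤ ∑' m, ∫⁻ z in Bm m, ENNReal.ofReal ((‖f z‖ * Real.exp (-(phi 1 z))) ^ p) :=
        lintegral_iUnion_le _ _
    _ ≤ ∑' m, ENNReal.ofReal (Real.exp 1 * Real.pi) * x m ^ p := ENNReal.tsum_le_tsum hBint
    _ = ENNReal.ofReal (Real.exp 1 * Real.pi) * ∑' m, x m ^ p := ENNReal.tsum_mul_left
    _ ≤ _ := by
        rw [mul_assoc]; gcongr
        exact hS (bN u a) x fun i => le_rfl



/-- Taylor coefficients -/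
def tcoef (f : ℂ → ℂ) (k : ℕ) : ℂ := ((k.factorial : ℂ))⁻¹ * iteratedDeriv k f 0

lemma tcoef_hasSum {f : ℂ → ℂ} (hf : Differentiable ℂ f) (z : ℂ) :
    HasSum (fun k => tcoef f k * z ^ k) (f z) := by
  have := Complex.hasSum_taylorSeries_of_entire hf 0 z
  refine this.congr_fun fun k => ?_
  simp only [tcoef, sub_zero, smul_eq_mul]; ring

lemma tcoef_circle {f : ℂ → ℂ} (hf : Differentiable ℂ f) (k : ℕ) {r : ℝ} (hr : 0 < r) :
    ENNReal.ofReal (2 * Real.pi * (‖tcoef f k‖ * r ^ k)) ≤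
      ∫⁻ θ in Set.Ioo (-Real.pi) Real.pi, ‖f (circleMap 0 r θ)‖ₑ := by
  have h := (hf.differentiableOn (s := Metric.closedBall 0 r)).circleIntegral_one_div_sub_center_pow_smul
    hr k
  have h1 : ‖∮ z in C(0, r), (1 / (z - 0) ^ (k + 1)) • f z‖ = 2 * Real.pi * ‖tcoef f k‖ := by
    rw [h, tcoef, smul_eq_mul, div_eq_mul_inv, mul_assoc, norm_mul]
    congr 1
    simp [abs_of_pos Real.pi_pos]
  have hcont : Continuous (fun θ : ℝ => f (circleMap 0 r θ)) :=
    hf.continuous.comp (continuous_circleMap 0 r)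
  have h2 : ‖∮ z in C(0, r), (1 / (z - 0) ^ (k + 1)) • f z‖ ≤
      ∫ θ in (0 : ℝ)..2 * Real.pi, ‖f (circleMap 0 r θ)‖ / r ^ k := by
    rw [circleIntegral]
    refine (intervalIntegral.norm_integral_le_integral_norm Real.two_pi_pos.le).trans (le_of_eq ?_)
    refine intervalIntegral.integral_congr fun θ _ => ?_
    simp only [norm_smul, deriv_circleMap, norm_mul, norm_circleMap_zero, norm_I, mul_one, sub_zero,
      norm_div, norm_pow, norm_one, abs_of_pos hr]
    field_simp
    ring
  have h3 : 2 * Real.pi * (‖tcoef f k‖ * r ^ k) ≤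
      ∫ θ in (-Real.pi)..Real.pi, ‖f (circleMap 0 r θ)‖ := by
    rw [h1, intervalIntegral.integral_div, le_div_iff₀ (by positivity)] at h2
    have hper : Function.Periodic (fun θ : ℝ => ‖f (circleMap 0 r θ)‖) (2 * Real.pi) := by
      intro θ; simp only [periodic_circleMap 0 r θ]
    have := hper.intervalIntegral_add_eq (-Real.pi) 0
    rw [show -Real.pi + 2 * Real.pi = Real.pi by ring, zero_add] at this
    rw [this]; linarith
  have h4 : ∫ θ in (-Real.pi)..Real.pi, ‖f (circleMap 0 r θ)‖ =
      ∫ θ in Set.Ioo (-Real.pi) Real.pi, ‖f (circleMap 0 r θ)‖ := by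
    rw [intervalIntegral.integral_of_le (by linarith [Real.pi_pos]), integral_Ioc_eq_integral_Ioo]
  rw [h4] at h3
  refine (ENNReal.ofReal_le_ofReal h3).trans ?_
  rw [ofReal_integral_norm_eq_lintegral_enorm]
  exact (hcont.integrableOn_Icc (a := -Real.pi) (b := Real.pi)).mono_set Set.Ioo_subset_Icc_self

lemma tcoef_circle_p {f : ℂ → ℂ} (hf : Differentiable ℂ f) (k : ℕ) {r p : ℝ} (hr : 0 < r)
    (hp : 1 ≤ p) :
    ENNReal.ofReal (‖tcoef f k‖ * r ^ k) ^ p ≤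
      ∫⁻ θ in Set.Ioo (-Real.pi) Real.pi, ‖f (circleMap 0 r θ)‖ₑ ^ p := by
  have hp0 : 0 < p := by linarith
  have h1 := tcoef_circle hf k hr
  have hcont : Continuous (fun θ : ℝ => f (circleMap 0 r θ)) :=
    hf.continuous.comp (continuous_circleMap 0 r)
  have h2 := eLpNorm'_le_eLpNorm'_mul_rpow_measure_univ (p := 1) (q := p) one_pos hp
    (f := fun θ : ℝ => f (circleMap 0 r θ))
    (μ := volume.restrict (Set.Ioo (-Real.pi) Real.pi)) hcont.aestronglyMeasurable
  simp only [eLpNorm', ENNReal.rpow_one, div_one, Measure.restrict_apply MeasurableSet.univ,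
    Set.univ_inter, Real.volume_Ioo] at h2
  have h3 := h1.trans h2
  set T := ENNReal.ofReal (2 * Real.pi) with hT
  have e : Real.pi - -Real.pi = 2 * Real.pi := by ring
  rw [e, ← hT, ENNReal.ofReal_mul (by positivity), ← hT] at h3
  set I := ∫⁻ θ in Set.Ioo (-Real.pi) Real.pi, ‖f (circleMap 0 r θ)‖ₑ ^ p with hI
  have hT1 : 1 ≤ T := by
    rw [hT, ENNReal.one_le_ofReal]; linarith [Real.pi_gt_three]
  have hT0 : T ≠ 0 := (lt_of_lt_of_le one_pos hT1).ne'
  have hTt : T ≠ ⊤ := ENNReal.ofReal_ne_top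
  have h4 : T ^ (1 - 1 / p) ≤ T := by
    conv_rhs => rw [← ENNReal.rpow_one T]
    exact ENNReal.rpow_le_rpow_of_exponent_le hT1 (by
      have : 0 ≤ 1 / p := by positivity
      linarith)
  have h5 : T * ENNReal.ofReal (‖tcoef f k‖ * r ^ k) ≤ T * I ^ (1 / p) := by
    refine h3.trans ?_
    rw [mul_comm T]
    gcongr
  rw [ENNReal.mul_le_mul_iff_right hT0 hTt] at h5
  calc _ ≤ (I ^ (1 / p)) ^ p := ENNReal.rpow_le_rpow h5 hp0.le
    _ = I := by rw [← ENNReal.rpow_mul, one_div_mul_cancel hp0.ne', ENNReal.rpow_one]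

lemma measurable_fock {f : ℂ → ℂ} (hf : Differentiable ℂ f) (p : ℝ) :
    Measurable (fun z : ℂ => ENNReal.ofReal ((‖f z‖ * Real.exp (-(phi 1 z))) ^ p)) := by
  have h1 : Measurable (fun z : ℂ => phi 1 z) := by
    unfold phi logPlus
    exact (((Real.measurable_log.comp measurable_norm).max measurable_const).pow_const 2).const_mul 1
  have h2 : Measurable f := hf.continuous.measurable
  exact (((h2.norm.mul (Real.measurable_exp.comp h1.neg)).pow_const p)).ennreal_ofReal

lemma fock_polar {f : ℂ → ℂ} (hf : Differentiable ℂ f) (p : ℝ) :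
    fockNormP 1 p f = ∫⁻ r in Set.Ioi (0 : ℝ), ∫⁻ θ in Set.Ioo (-Real.pi) Real.pi,
      ENNReal.ofReal r * ENNReal.ofReal ((‖f (circleMap 0 r θ)‖ *
        Real.exp (-(phi 1 (circleMap 0 r θ)))) ^ p) := by
  have hm := measurable_fock hf p
  rw [fockNormP, ← Complex.lintegral_comp_polarCoord_symm, polarCoord_target,
    Measure.volume_eq_prod, ← Measure.prod_restrict]
  have hsymm : ∀ q : ℝ × ℝ, Complex.polarCoord.symm q = circleMap 0 q.1 q.2 := by
    intro q
    rw [Complex.polarCoord_symm_apply, circleMap, zero_add, Complex.exp_mul_I]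
    push_cast; rfl
  simp_rw [hsymm]
  have hc : Continuous (fun q : ℝ × ℝ => circleMap 0 q.1 q.2) := by
    unfold circleMap; fun_prop
  rw [lintegral_prod]
  · rfl
  · refine Measurable.aemeasurable ?_
    exact (measurable_fst.ennreal_ofReal).mul (hm.comp hc.measurable)

lemma coef_le {p : ℝ} (hp : 1 ≤ p) : ∃ C : ℝ≥0∞, C ≠ ⊤ ∧ ∀ f : ℂ → ℂ, Differentiable ℂ f →
    ∑' k, bN (1 / p) (tcoef f) k ^ p ≤ C * fockNormP 1 p f := by
  have hp0 : 0 < p := by linarith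
  set c : ℝ := Real.exp (-(p / 4)) * (Real.exp (1 / 2) - 1) with hc
  have hc0 : 0 < c := by
    have : 1 < Real.exp (1 / 2) := by rw [Real.one_lt_exp_iff]; norm_num
    have h2 : 0 < Real.exp (1 / 2) - 1 := by linarith
    positivity
  refine ⟨(ENNReal.ofReal c)⁻¹, ENNReal.inv_ne_top.2 (by simpa using hc0), fun f hf => ?_⟩
  have hc1 : ENNReal.ofReal c ≠ 0 := by simpa using hc0
  rw [← ENNReal.div_eq_inv_mul, ENNReal.le_div_iff_mul_le (Or.inl hc1) (Or.inl ENNReal.ofReal_ne_top)]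
  rw [fock_polar hf, ← ENNReal.tsum_mul_right]
  set H : ℝ → ℝ≥0∞ := fun r => ∫⁻ θ in Set.Ioo (-Real.pi) Real.pi,
      ENNReal.ofReal r * ENNReal.ofReal ((‖f (circleMap 0 r θ)‖ *
        Real.exp (-(phi 1 (circleMap 0 r θ)))) ^ p) with hH
  set J : ℕ → Set ℝ := fun k => Set.Ico (Real.exp ((k : ℝ) / 2)) (Real.exp (((k : ℝ) + 1) / 2)) with hJ
  have hJd : Pairwise (Function.onFun Disjoint J) := by
    have hmono : Monotone (fun k : ℕ => Real.exp ((k : ℝ) / 2)) := by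
      intro a b hab
      have : (a : ℝ) ≤ b := by exact_mod_cast hab
      exact Real.exp_le_exp.2 (by linarith)
    have := hmono.pairwise_disjoint_on_Ico_succ
    refine this.mono fun a b h => ?_
    simpa [Function.onFun, hJ] using h
  have hpt : ∀ k, ∀ r ∈ J k, ENNReal.ofReal (Real.exp ((k : ℝ) / 2) * Real.exp (-(p / 4)) *
      (‖tcoef f k‖ * Real.exp ((k : ℝ) ^ 2 / 4)) ^ p) ≤ H r := by
    intro k r hr
    have hr1 : 1 ≤ r := le_trans (Real.one_le_exp (by positivity)) hr.1
    have hr0 : 0 < r := by linarith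
    have hl1 : (k : ℝ) / 2 ≤ Real.log r := (Real.le_log_iff_exp_le hr0).2 hr.1
    have hl2 : Real.log r ≤ ((k : ℝ) + 1) / 2 := (Real.log_le_iff_le_exp hr0).2 hr.2.le
    have hphi : ∀ θ, phi 1 (circleMap 0 r θ) = (Real.log r) ^ 2 := by
      intro θ
      rw [phi, norm_circleMap_zero, abs_of_pos hr0, logPlus, max_eq_left (Real.log_nonneg hr1), one_mul]
    have hHr : H r = ENNReal.ofReal r * ENNReal.ofReal (Real.exp (-(Real.log r ^ 2)) ^ p) *
        ∫⁻ θ in Set.Ioo (-Real.pi) Real.pi, ‖f (circleMap 0 r θ)‖ₑ ^ p := by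
      rw [hH, ← lintegral_const_mul' _ _ (ENNReal.mul_ne_top ENNReal.ofReal_ne_top ENNReal.ofReal_ne_top)]
      refine lintegral_congr fun θ => ?_
      rw [hphi, Real.mul_rpow (norm_nonneg _) (Real.exp_pos _).le, ENNReal.ofReal_mul (by positivity),
        ← ENNReal.ofReal_rpow_of_nonneg (norm_nonneg _) hp0.le, ofReal_norm]
      ring
    rw [hHr]
    refine le_trans ?_ (mul_le_mul_right (tcoef_circle_p hf k hr0 hp) _)
    rw [ENNReal.ofReal_rpow_of_nonneg (by positivity) hp0.le, ← ENNReal.ofReal_mul hr0.le,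
      ← ENNReal.ofReal_mul (by positivity)]
    apply ENNReal.ofReal_le_ofReal
    have hrk : r ^ k = Real.exp (k * Real.log r) := by
      rw [Real.exp_nat_mul, Real.exp_log hr0]
    rw [mul_assoc, mul_assoc]
    refine mul_le_mul hr.1 ?_ (by positivity) hr0.le
    rw [← Real.mul_rpow (Real.exp_pos _).le (by positivity)]
    rw [show -(p / 4) = -(1 / 4) * p by ring, Real.exp_mul,
      ← Real.mul_rpow (Real.exp_pos _).le (by positivity)]
    refine Real.rpow_le_rpow (by positivity) ?_ hp0.le
    rw [mul_left_comm, mul_left_comm (Real.exp (-(Real.log r ^ 2)))]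
    refine mul_le_mul_of_nonneg_left ?_ (norm_nonneg _)
    rw [hrk, ← Real.exp_add, ← Real.exp_add, Real.exp_le_exp]
    nlinarith
  calc ∑' k, bN (1 / p) (tcoef f) k ^ p * ENNReal.ofReal c ≤ ∑' k, ∫⁻ r in J k, H r := by
        refine ENNReal.tsum_le_tsum fun k => ?_
        calc bN (1 / p) (tcoef f) k ^ p * ENNReal.ofReal c
            = ENNReal.ofReal (Real.exp ((k : ℝ) / 2) * Real.exp (-(p / 4)) *
              (‖tcoef f k‖ * Real.exp ((k : ℝ) ^ 2 / 4)) ^ p) * volume (J k) := by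
              have hA := wA_pos (1 / p) k
              rw [hJ, Real.volume_Ico, bN, ENNReal.ofReal_rpow_of_nonneg (by positivity) hp0.le,
                ← ENNReal.ofReal_mul (by positivity), ← ENNReal.ofReal_mul (by positivity)]
              congr 1
              rw [Real.mul_rpow (norm_nonneg _) hA.le, Real.mul_rpow (norm_nonneg _) (Real.exp_pos _).le,
                wA, ← Real.exp_mul, ← Real.exp_mul, hc]
              have e1 : ((k : ℝ) ^ 2 / 4 + 1 / p * k) * p = (k : ℝ) ^ 2 / 4 * p + (k / 2 + k / 2) := by
                field_simp; ring
              have e2 : ((k : ℝ) + 1) / 2 = k / 2 + 1 / 2 := by ring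
              rw [e1, e2, Real.exp_add _ ((k : ℝ) / 2 + k / 2), Real.exp_add ((k : ℝ) / 2),
                Real.exp_add ((k : ℝ) / 2)]
              ring
          _ = ∫⁻ r in J k, ENNReal.ofReal (Real.exp ((k : ℝ) / 2) * Real.exp (-(p / 4)) *
              (‖tcoef f k‖ * Real.exp ((k : ℝ) ^ 2 / 4)) ^ p) := by rw [setLIntegral_const]
          _ ≤ ∫⁻ r in J k, H r := setLIntegral_mono' measurableSet_Ico (hpt k)
    _ = ∫⁻ r in ⋃ k, J k, H r := (lintegral_iUnion (fun _ => measurableSet_Ico) hJd _).symm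
    _ ≤ ∫⁻ r in Set.Ioi (0 : ℝ), H r := by
        refine lintegral_mono_set ?_
        refine Set.iUnion_subset fun k r hr => ?_
        exact lt_of_lt_of_le (Real.exp_pos _) hr.1



lemma tsum_swap {F : ℕ → ℕ → ℂ} (h : ∑' n, ∑' j, ‖F n j‖ₑ ≠ ⊤) :
    ∑' n, ∑' j, F n j = ∑' j, ∑' n, F n j := by
  have h1 : Summable (Function.uncurry F) := by
    rw [← ENNReal.tsum_prod] at h
    have h2 : Summable fun x : ℕ × ℕ => ‖Function.uncurry F x‖₊ :=
      ENNReal.tsum_coe_ne_top_iff_summable.1 h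
    exact Summable.of_norm (NNReal.summable_coe.2 h2)
  exact (Summable.tsum_comm h1).symm

lemma bdd_of_tsum {p : ℝ} (hp : 1 ≤ p) {w : ℕ → ℝ≥0∞} (h : ∑' k, w k ^ p ≠ ⊤) :
    ∃ B : ℝ≥0∞, B ≠ ⊤ ∧ ∀ k, w k ≤ B := by
  have hp0 : 0 < p := by linarith
  refine ⟨(∑' k, w k ^ p) ^ p⁻¹, ENNReal.rpow_ne_top_of_nonneg (by positivity) h, fun k => ?_⟩
  rw [ENNReal.le_rpow_inv_iff hp0]
  exact ENNReal.le_tsum k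

/-- weighted samples -/
def vN (u d : ℝ) (μ : ℕ → ℂ) (g : ℂ → ℂ) (n : ℕ) : ℝ≥0∞ := ENNReal.ofReal (‖g (μ n)‖ * wW u d n)

lemma disc_term {p d : ℝ} (hp : 1 ≤ p) (hd : 0 ≤ d)
    {μ : ℕ → ℂ} (hμ : ∀ n : ℕ, ‖μ n‖ = Real.exp (((n : ℝ) + d) / 2)) (g : ℂ → ℂ) (n : ℕ) :
    vN (1 / p) d μ g n ^ p ≤ ENNReal.ofReal ((1 + ‖μ n‖) ^ 2 * ‖g (μ n)‖ ^ p *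
      Real.exp (-(p * phi 1 (μ n)))) ∧
    ENNReal.ofReal ((1 + ‖μ n‖) ^ 2 * ‖g (μ n)‖ ^ p *
      Real.exp (-(p * phi 1 (μ n)))) ≤ 4 * vN (1 / p) d μ g n ^ p := by
  have hp0 : 0 < p := by linarith
  have hW := wW_pos (1 / p) d n
  have hnd : 0 ≤ ((n : ℝ) + d) / 2 := by positivity
  have hphi : phi 1 (μ n) = (((n : ℝ) + d) / 2) ^ 2 := by
    rw [phi, hμ, logPlus, Real.log_exp, max_eq_left hnd, one_mul]
  have hv : vN (1 / p) d μ g n ^ p = ENNReal.ofReal (‖μ n‖ ^ 2 * ‖g (μ n)‖ ^ p *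
      Real.exp (-(p * phi 1 (μ n)))) := by
    rw [vN, ENNReal.ofReal_rpow_of_nonneg (by positivity) hp0.le]
    congr 1
    rw [Real.mul_rpow (norm_nonneg _) hW.le, hphi, hμ, wW, ← Real.exp_mul, ← Real.exp_nat_mul]
    rw [mul_comm (Real.exp _) (‖g (μ n)‖ ^ p), mul_assoc, ← Real.exp_add]
    congr 2
    push_cast
    field_simp; ring
  have h1 : 1 ≤ ‖μ n‖ := by rw [hμ]; exact Real.one_le_exp hnd
  rw [hv]
  constructor
  · apply ENNReal.ofReal_le_ofReal
    gcongr
    linarith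
  · rw [show (4 : ℝ≥0∞) = ENNReal.ofReal 4 by norm_num, ← ENNReal.ofReal_mul (by norm_num)]
    apply ENNReal.ofReal_le_ofReal
    rw [← mul_assoc, ← mul_assoc]
    gcongr
    nlinarith

lemma mu_inj {d : ℝ} {μ : ℕ → ℂ} (hμ : ∀ n : ℕ, ‖μ n‖ = Real.exp (((n : ℝ) + d) / 2)) :
    Function.Injective μ := by
  intro a b hab
  have h := hμ a
  rw [hab, hμ b, Real.exp_eq_exp] at h
  have : (a : ℝ) = b := by linarith
  exact_mod_cast this

lemma disc_bd {p d : ℝ} (hp : 1 ≤ p) (hd : 0 ≤ d)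
    {μ : ℕ → ℂ} (hμ : ∀ n : ℕ, ‖μ n‖ = Real.exp (((n : ℝ) + d) / 2)) (g : ℂ → ℂ) :
    ∑' n, vN (1 / p) d μ g n ^ p ≤ discNormP 1 p (Set.range μ) g ∧
    discNormP 1 p (Set.range μ) g ≤ 4 * ∑' n, vN (1 / p) d μ g n ^ p := by
  have e : discNormP 1 p (Set.range μ) g = ∑' n, ENNReal.ofReal ((1 + ‖μ n‖) ^ 2 * ‖g (μ n)‖ ^ p *
      Real.exp (-(p * phi 1 (μ n)))) :=
    tsum_range (fun z : ℂ => ENNReal.ofReal ((1 + ‖z‖) ^ 2 * ‖g z‖ ^ p *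
      Real.exp (-(p * phi 1 z)))) (mu_inj hμ)
  rw [e, ← ENNReal.tsum_mul_left]
  exact ⟨ENNReal.tsum_le_tsum fun n => (disc_term hp hd hμ g n).1,
    ENNReal.tsum_le_tsum fun n => (disc_term hp hd hμ g n).2⟩

theorem main_ci {p d δ : ℝ} (hp : 1 ≤ p) (hd : 0 ≤ d) (hd2 : d ≤ 2) (hδ : 0 < δ)
    (hδ1 : δ ≤ 1 / p - d / 2 + 1 / 4) (hδ2 : δ ≤ 1 / 2 - (1 / p - d / 2 + 1 / 4))
    {μ : ℕ → ℂ} (hμ : ∀ n : ℕ, ‖μ n‖ = Real.exp (((n : ℝ) + d) / 2)) :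
    CompleteInterpolating 1 p (Set.range μ) := by
  have hp0 : 0 < p := by linarith
  have hu0 : 0 ≤ 1 / p := by positivity
  have hu1 : 1 / p ≤ 1 := by rw [div_le_one hp0]; exact hp
  have hδ3 : δ ≤ 1 := by linarith
  obtain ⟨κ, M, hM, hκ, hid1, hid2⟩ := exists_kernel hd hd2 hu0 hu1 hδ hδ1 hδ2 hμ
  obtain ⟨C1, hC1, hcoef⟩ := coef_le hp
  obtain ⟨C4, hC4, hfock⟩ := fock_le hp
  obtain ⟨C2, hC2, hS2⟩ := schur_dom hp hδ (Real.exp 11)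
  obtain ⟨C3, hC3, hS3⟩ := schur_dom hp hδ M
  set u := 1 / p with hu
  -- coefficients from samples
  have hK : ∀ (v : ℂ → ℂ) (a : ℕ → ℂ), (∀ k, a k = ∑' n, κ k n * v (μ n)) →
      ∑' k, bN u a k ^ p ≤ C3 * ∑' n, vN u d μ v n ^ p := by
    intro v a ha
    refine hS3 _ _ fun k => ?_
    have hA := wA_pos u k
    rw [bN, ENNReal.ofReal_mul (norm_nonneg _), ofReal_norm, ha k]
    calc ‖∑' n, κ k n * v (μ n)‖ₑ * ENNReal.ofReal (wA u k)
        ≤ (∑' n, ‖κ k n * v (μ n)‖ₑ) * ENNReal.ofReal (wA u k) := by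
          gcongr; exact enorm_tsum_le_tsum_enorm
      _ = ∑' n, ‖κ k n * v (μ n)‖ₑ * ENNReal.ofReal (wA u k) := ENNReal.tsum_mul_right.symm
      _ ≤ _ := by
          refine ENNReal.tsum_le_tsum fun n => ?_
          have hE := EK_pos δ k n
          rw [← ofReal_norm, vN, ← ENNReal.ofReal_mul (norm_nonneg _),
            ← ENNReal.ofReal_mul (by positivity)]
          apply ENNReal.ofReal_le_ofReal
          rw [norm_mul]
          calc ‖κ k n‖ * ‖v (μ n)‖ * wA u k = (‖κ k n‖ * wA u k) * ‖v (μ n)‖ := by ring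
            _ ≤ (M * EK δ k n * wW u d n) * ‖v (μ n)‖ :=
                mul_le_mul_of_nonneg_right (hκ k n) (norm_nonneg _)
            _ = _ := by ring
  have hρ : ∀ n j, ‖μ n‖ ^ j * wW u d n ≤ Real.exp 11 * EK δ n j * wA u j := by
    intro n j; rw [hμ]; exact rho_bd hδ.le hδ3 hu0 hu1 hd hd2 n j
  constructor
  · -- sampling
    have key : ∀ f : ℂ → ℂ, MemFock 1 p f →
        fockNormP 1 p f ≤ (C4 * C3) * discNormP 1 p (Set.range μ) f ∧
        discNormP 1 p (Set.range μ) f ≤ (4 * (C2 * C1)) * fockNormP 1 p f := by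
      intro f hf
      set a := tcoef f with ha
      have hfa : ∀ z, f z = ∑' k, a k * z ^ k := fun z => (tcoef_hasSum hf.1 z).tsum_eq.symm
      have hS : ∑' k, bN u a k ^ p ≠ ⊤ :=
        ne_top_of_le_ne_top (ENNReal.mul_ne_top hC1 hf.2.ne) (hcoef f hf.1)
      obtain ⟨hd1, hd3⟩ := disc_bd hp hd hμ f
      constructor
      · have hak : ∀ k, a k = ∑' n, κ k n * f (μ n) := by
          intro k
          obtain ⟨B, hB, hbB⟩ := bdd_of_tsum hp hS
          have hsw : ∑' n, ∑' j, ‖κ k n * μ n ^ j * a j‖ₑ ≠ ⊤ := by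
            refine ne_top_of_le_ne_top (ENNReal.mul_ne_top (ENNReal.ofReal_ne_top
              (r := M * Real.exp 11 / wA u k)) (EK_double hδ k (bN u a) B hB hbB)) ?_
            rw [← ENNReal.tsum_mul_left]
            refine ENNReal.tsum_le_tsum fun n => ?_
            rw [← ENNReal.tsum_mul_left]
            refine ENNReal.tsum_le_tsum fun j => ?_
            have hE1 := EK_pos δ k n
            have hE2 := EK_pos δ n j
            have hA := wA_pos u k
            have hW := wW_pos u d n
            rw [← ofReal_norm, bN, ← ENNReal.ofReal_mul (by positivity),
              ← ENNReal.ofReal_mul (by positivity), ← ENNReal.ofReal_mul (by positivity)]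
            apply ENNReal.ofReal_le_ofReal
            rw [norm_mul, norm_mul, norm_pow]
            have h1 := hκ k n
            have h2 := hρ n j
            rw [← le_div_iff₀ hA] at h1
            rw [← le_div_iff₀ hW] at h2
            calc ‖κ k n‖ * ‖μ n‖ ^ j * ‖a j‖
                ≤ (M * EK δ k n * wW u d n / wA u k) *
                  (Real.exp 11 * EK δ n j * wA u j / wW u d n) * ‖a j‖ := by gcongr
              _ = _ := by field_simp
          calc a k = ∑' j, (∑' n, κ k n * μ n ^ j) * a j := by
                simp_rw [hid1]
                rw [tsum_eq_single k]
                · simp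
                · intro j hj; simp [Ne.symm hj]
            _ = ∑' j, ∑' n, κ k n * μ n ^ j * a j := by simp_rw [tsum_mul_right]
            _ = ∑' n, ∑' j, κ k n * μ n ^ j * a j := (tsum_swap hsw).symm
            _ = _ := by
                congr 1; funext n
                rw [hfa, ← tsum_mul_left]
                congr 1; funext j; ring
        calc fockNormP 1 p f ≤ C4 * ∑' k, bN u a k ^ p := hfock a f hfa
          _ ≤ C4 * (C3 * ∑' n, vN u d μ f n ^ p) := by gcongr; exact hK f a hak
          _ ≤ C4 * (C3 * discNormP 1 p (Set.range μ) f) := by gcongr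
          _ = _ := (mul_assoc _ _ _).symm
      · have h2 : ∑' n, vN u d μ f n ^ p ≤ C2 * ∑' k, bN u a k ^ p := by
          refine hS2 _ _ fun n => ?_
          have hW := wW_pos u d n
          rw [vN, ENNReal.ofReal_mul (norm_nonneg _), ofReal_norm, hfa (μ n)]
          calc ‖∑' k, a k * μ n ^ k‖ₑ * ENNReal.ofReal (wW u d n)
              ≤ (∑' k, ‖a k * μ n ^ k‖ₑ) * ENNReal.ofReal (wW u d n) := by
                gcongr; exact enorm_tsum_le_tsum_enorm
            _ = ∑' k, ‖a k * μ n ^ k‖ₑ * ENNReal.ofReal (wW u d n) := ENNReal.tsum_mul_right.symm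
            _ ≤ _ := by
                refine ENNReal.tsum_le_tsum fun k => ?_
                have hE := EK_pos δ n k
                rw [← ofReal_norm, bN, ← ENNReal.ofReal_mul (norm_nonneg _),
                  ← ENNReal.ofReal_mul (by positivity)]
                apply ENNReal.ofReal_le_ofReal
                rw [norm_mul, norm_pow]
                calc ‖a k‖ * ‖μ n‖ ^ k * wW u d n = ‖a k‖ * (‖μ n‖ ^ k * wW u d n) := by ring
                  _ ≤ ‖a k‖ * (Real.exp 11 * EK δ n k * wA u k) :=
                      mul_le_mul_of_nonneg_left (hρ n k) (norm_nonneg _)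
                  _ = _ := by ring
        calc discNormP 1 p (Set.range μ) f ≤ 4 * ∑' n, vN u d μ f n ^ p := hd3
          _ ≤ 4 * (C2 * (C1 * fockNormP 1 p f)) := by
              gcongr
              refine h2.trans ?_
              gcongr
              exact hcoef f hf.1
          _ = _ := by ring
    set D : ℝ≥0∞ := 1 + C4 * C3 + 4 * (C2 * C1) with hD
    have hDt : D ≠ ⊤ := by
      have a1 := ENNReal.mul_ne_top hC4 hC3
      have a2 := ENNReal.mul_ne_top (by norm_num : (4 : ℝ≥0∞) ≠ ⊤) (ENNReal.mul_ne_top hC2 hC1)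
      exact ENNReal.add_ne_top.2 ⟨ENNReal.add_ne_top.2 ⟨ENNReal.one_ne_top, a1⟩, a2⟩
    have hD1 : 1 ≤ D := by rw [hD, add_assoc]; exact le_self_add
    refine ⟨D.toReal, ?_, fun f hf => ?_⟩
    · have := ENNReal.toReal_mono hDt hD1
      simpa using this
    · rw [ENNReal.ofReal_toReal hDt]
      obtain ⟨k1, k2⟩ := key f hf
      constructor
      · rw [← ENNReal.div_eq_inv_mul]
        refine ENNReal.div_le_of_le_mul' (k1.trans ?_)
        gcongr
        rw [hD]
        exact le_add_self.trans le_self_add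
      · refine k2.trans ?_
        gcongr
        rw [hD]
        exact le_add_self
  · -- interpolation
    intro v hv
    obtain ⟨hd1, -⟩ := disc_bd hp hd hμ v
    have hvt : ∑' n, vN u d μ v n ^ p ≠ ⊤ := ne_top_of_le_ne_top hv.ne hd1
    set a : ℕ → ℂ := fun k => ∑' n, κ k n * v (μ n) with ha
    have hS : ∑' k, bN u a k ^ p ≠ ⊤ :=
      ne_top_of_le_ne_top (ENNReal.mul_ne_top hC3 hvt) (hK v a fun k => rfl)
    refine ⟨fun z => ∑' k, a k * z ^ k, ⟨diff_of_coef fun R hR => coef_summable hp hu0 hu1 hS R hR, ?_⟩,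
      ?_⟩
    · exact lt_of_le_of_lt (hfock a _ fun z => rfl) (ENNReal.mul_ne_top hC4 hS).lt_top
    · rintro lam ⟨m, rfl⟩
      obtain ⟨B, hB, hbB⟩ := bdd_of_tsum hp hvt
      have hsw : ∑' k, ∑' n, ‖κ k n * v (μ n) * μ m ^ k‖ₑ ≠ ⊤ := by
        refine ne_top_of_le_ne_top (ENNReal.mul_ne_top (ENNReal.ofReal_ne_top
          (r := M * Real.exp 11 / wW u d m)) (EK_double hδ m (vN u d μ v) B hB hbB)) ?_
        rw [← ENNReal.tsum_mul_left]
        refine ENNReal.tsum_le_tsum fun k => ?_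
        rw [← ENNReal.tsum_mul_left]
        refine ENNReal.tsum_le_tsum fun n => ?_
        have hE1 := EK_pos δ m k
        have hE2 := EK_pos δ k n
        have hA := wA_pos u k
        have hW := wW_pos u d m
        have hW2 := wW_pos u d n
        rw [← ofReal_norm, vN, ← ENNReal.ofReal_mul (by positivity),
          ← ENNReal.ofReal_mul (by positivity), ← ENNReal.ofReal_mul (by positivity)]
        apply ENNReal.ofReal_le_ofReal
        rw [norm_mul, norm_mul, norm_pow]
        have h1 := hκ k n
        have h2 := hρ m k
        rw [← le_div_iff₀ hA] at h1
        rw [← le_div_iff₀ hW] at h2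
        calc ‖κ k n‖ * ‖v (μ n)‖ * ‖μ m‖ ^ k
            ≤ (M * EK δ k n * wW u d n / wA u k) * ‖v (μ n)‖ *
              (Real.exp 11 * EK δ m k * wA u k / wW u d m) := by gcongr
          _ = _ := by field_simp
      calc ∑' k, a k * μ m ^ k = ∑' k, ∑' n, κ k n * v (μ n) * μ m ^ k := by
            simp_rw [ha, ← tsum_mul_right]
        _ = ∑' n, ∑' k, κ k n * v (μ n) * μ m ^ k := tsum_swap hsw
        _ = ∑' n, (∑' k, κ k n * μ m ^ k) * v (μ n) := by
            congr 1; funext n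
            rw [← tsum_mul_right]
            congr 1; funext k; ring
        _ = v (μ m) := by
            simp_rw [hid2]
            rw [tsum_eq_single m]
            · simp
            · intro n hn; simp [Ne.symm hn]

lemma lamSet_range (θ : ℤ → ℝ) (l : ℤ) :
    LamSet θ l = Set.range (fun n : ℕ => lamPt θ (n + l)) := by
  ext w
  simp only [LamSet, Set.mem_setOf_eq, Set.mem_range]
  constructor
  · rintro ⟨n, hn, rfl⟩
    exact ⟨(n - l).toNat, by rw [Int.toNat_of_nonneg (by omega)]; simp⟩
  · rintro ⟨n, rfl⟩
    exact ⟨n + l, by omega, rfl⟩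

lemma lamSet_ci (θ : ℤ → ℝ) (l : ℤ) {p : ℝ} (hp : 1 ≤ p) (hl : -1 ≤ l) (hl2 : l ≤ 1)
    (h1 : 0 < 1 / p - (l + 1 : ℝ) / 2 + 1 / 4) (h2 : 1 / p - (l + 1 : ℝ) / 2 + 1 / 4 < 1 / 2) :
    CompleteInterpolating 1 p (LamSet θ l) := by
  rw [lamSet_range]
  have hl' : (-1 : ℝ) ≤ l := by exact_mod_cast hl
  have hl2' : (l : ℝ) ≤ 1 := by exact_mod_cast hl2
  refine main_ci (d := (l : ℝ) + 1)
    (δ := min (1 / p - (l + 1 : ℝ) / 2 + 1 / 4) (1 / 2 - (1 / p - (l + 1 : ℝ) / 2 + 1 / 4)))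
    hp (by linarith) (by linarith) (lt_min h1 (by linarith)) (min_le_left _ _) (min_le_right _ _)
    fun n => ?_
  rw [lamPt, norm_mul, Complex.norm_exp_ofReal_mul_I, mul_one, Complex.norm_real,
    Real.norm_of_nonneg (Real.exp_pos _).le]
  congr 1; push_cast; ring

theorem statement16 (θ : ℤ → ℝ) :
    (∀ p : ℝ, 4 < p → CompleteInterpolating 1 p (LamSet θ (-1))) ∧
    (∀ p : ℝ, 4 / 3 < p → p < 4 → CompleteInterpolating 1 p (LamSet θ 0)) ∧
    (∀ p : ℝ, 1 ≤ p → p < 4 / 3 → CompleteInterpolating 1 p (LamSet θ 1)) := by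
  refine ⟨fun p hp => ?_, fun p hp hp2 => ?_, fun p hp hp2 => ?_⟩
  · have hp0 : 0 < p := by linarith
    have h1 : 0 < 1 / p := by positivity
    have h2 : 1 / p < 1 / 4 := one_div_lt_one_div_of_lt (by norm_num) hp
    refine lamSet_ci θ (-1) (by linarith) (by norm_num) (by norm_num) ?_ ?_ <;> push_cast <;> linarith
  · have hp0 : 0 < p := by linarith
    have h1 : 1 / 4 < 1 / p := one_div_lt_one_div_of_lt hp0 hp2
    have h2 : 1 / p < 3 / 4 := by rw [div_lt_iff₀ hp0]; linarith
    refine lamSet_ci θ 0 (by linarith) (by norm_num) (by norm_num) ?_ ?_ <;> push_cast <;> linarith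
  · have hp0 : 0 < p := by linarith
    have h1 : 3 / 4 < 1 / p := by rw [lt_div_iff₀ hp0]; linarith
    have h2 : 1 / p ≤ 1 := by rw [div_le_one hp0]; exact hp
    refine lamSet_ci θ 1 hp (by norm_num) (by norm_num) ?_ ?_ <;> push_cast <;> linarith


end
end

section
/- Let (θ_n)_{n≥0} be arbitrary real numbers and for l ∈ {0,1} let Λ_l = {e^{(1+n)/2} e^{iθ_n} : n ≥ l}. Then the set e^{−1/4}Λ_1 = {e^{−1/4} e^{(1+n)/2} e^{iθ_n} : n ≥ 1} is a complete interpolating sequence for F^{4/3}_φ, and the set e^{−1/4}Λ_0 = {e^{−1/4} e^{(1+n)/2} e^{iθ_n} : n ≥ 0} is a complete interpolating sequence for F^4_φ. -/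
open MeasureTheory Complex
open scoped ENNReal

noncomputable section

lemma ksum : ∃ K : ℝ, 0 < K ∧ ∀ (x : ℝ) (S : Finset ℕ),
    ∑ n ∈ S, Real.exp (-|x - n| / 4) ≤ K := by
  have hs : Summable (fun j : ℤ => Real.exp (-|(j : ℝ)| / 4)) := by
    have h0 : Summable (fun n : ℕ => Real.exp (-(n : ℝ) / 4)) := by
      have := Real.summable_exp_nat_mul_iff.mpr (show (-(1/4) : ℝ) < 0 by norm_num)
      refine this.congr (fun n => ?_)
      congr 1; ring
    apply Summable.of_nat_of_neg
    · simpa using h0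
    · simpa using h0
  refine ⟨Real.exp (1/4) * ∑' j : ℤ, Real.exp (-|(j : ℝ)| / 4), ?_, ?_⟩
  · have := hs.tsum_pos (fun j => (Real.exp_pos _).le) 0 (Real.exp_pos _)
    positivity
  · intro x S
    have h1 : ∀ n ∈ S, Real.exp (-|x - n| / 4) ≤
        Real.exp (1/4) * Real.exp (-|((⌊x⌋ - (n : ℤ) : ℤ) : ℝ)| / 4) := by
      intro n _
      rw [← Real.exp_add]
      apply Real.exp_le_exp.mpr
      have h2 := Int.floor_le x
      have h3 := Int.lt_floor_add_one x
      push_cast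
      have h4 : |(⌊x⌋ : ℝ) - n| ≤ |x - n| + 1 := by
        rw [abs_le]
        constructor
        · have := neg_abs_le (x - n); linarith
        · have := le_abs_self (x - n); linarith
      linarith
    refine (Finset.sum_le_sum h1).trans ?_
    rw [← Finset.mul_sum]
    apply mul_le_mul_of_nonneg_left _ (Real.exp_pos _).le
    have hinj : Function.Injective (fun n : ℕ => ⌊x⌋ - (n : ℤ)) := by
      intro a b h
      simpa using h
    have h5 := (hs.comp_injective hinj).sum_le_tsum S (fun _ _ => (Real.exp_pos _).le)
    have h6 := tsum_comp_le_tsum_of_inj hs (fun j => (Real.exp_pos _).le) hinj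
    exact h5.trans h6

lemma f1 (y : ℝ) : 1 + Real.exp y ≤ Real.exp (max y 0 + Real.exp (-|y|)) := by
  rw [Real.exp_add]
  have h := Real.add_one_le_exp (Real.exp (-|y|))
  rcases le_total y 0 with hy | hy
  · rw [max_eq_right hy, abs_of_nonpos hy] at *
    simp at *
    linarith
  · rw [max_eq_left hy, abs_of_nonneg hy] at *
    have : Real.exp y * (Real.exp (-y) + 1) = 1 + Real.exp y := by
      rw [mul_add, ← Real.exp_add]; simp
    rw [← this]
    exact mul_le_mul_of_nonneg_left h (Real.exp_pos _).le

lemma f2a (s : ℝ) (h0 : 0 < s) (h1 : s ≤ 2/3) : Real.exp (-3 * s) ≤ 1 - s := by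
  have h := Real.one_sub_inv_le_log_of_pos (show 0 < 1 - s by linarith)
  rw [← Real.le_log_iff_exp_le (by linarith)]
  refine le_trans ?_ h
  have : (1 - s)⁻¹ ≤ 1 + 3 * s := by
    rw [inv_le_iff_one_le_mul₀ (by linarith)]
    nlinarith
  linarith

lemma f2 (y : ℝ) (hy : 1/2 ≤ |y|) :
    Real.exp (max y 0 - 3 * Real.exp (-|y|)) ≤ |Real.exp y - 1| := by
  have hs : Real.exp (-|y|) ≤ 2/3 := by
    have h1 : Real.exp (-|y|) ≤ Real.exp (-(1/2)) := Real.exp_le_exp.mpr (by linarith)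
    have h2 : Real.exp (-(1/2)) ≤ 2/3 := by
      rw [Real.exp_neg, inv_le_comm₀ (Real.exp_pos _) (by norm_num)]
      have := Real.add_one_le_exp (1/2 : ℝ)
      linarith
    linarith
  have h := f2a _ (Real.exp_pos (-|y|)) hs
  rw [sub_eq_add_neg, Real.exp_add, ← neg_mul]
  rcases le_total y 0 with hy0 | hy0
  · rw [max_eq_right hy0]
    rw [abs_of_nonpos hy0] at h ⊢
    rw [abs_of_nonpos (by have := Real.exp_le_one_iff.mpr hy0; linarith)]
    simp only [neg_neg, Real.exp_zero] at *
    linarith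
  · rw [max_eq_left hy0]
    rw [abs_of_nonneg hy0] at h ⊢
    rw [abs_of_nonneg (by have := Real.one_le_exp hy0; linarith)]
    have : Real.exp y * (1 - Real.exp (-y)) = Real.exp y - 1 := by
      rw [mul_sub, ← Real.exp_add]; simp
    rw [← this]
    exact mul_le_mul_of_nonneg_left h (Real.exp_pos _).le

lemma psi_step (u : ℝ) : max u 0 ≤ (max (u + 1/2) 0)^2/2 - (max (u - 1/2) 0)^2/2 := by
  rcases le_total u (-(1/2)) with h | h
  · rw [max_eq_right (by linarith), max_eq_right (by linarith), max_eq_right (by linarith)]; simp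
  · rw [max_eq_left (show (0:ℝ) ≤ u + 1/2 by linarith)]
    rcases le_total u (1/2) with h' | h'
    · rw [max_eq_right (show u - 1/2 ≤ 0 by linarith)]
      apply max_le
      · nlinarith [sq_nonneg (u - 1/2)]
      · nlinarith [sq_nonneg (u + 1/2)]
    · rw [max_eq_left (show (0:ℝ) ≤ u - 1/2 by linarith), max_eq_left (by linarith)]
      nlinarith

lemma psi_sum (x : ℝ) (N : ℕ) : ∑ k ∈ Finset.range N, max (x - k) 0 ≤ (x + 1/2)^2/2 := by
  have h : ∑ k ∈ Finset.range N, max (x - k) 0 ≤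
      (max (x + 1/2) 0)^2/2 - (max (x - N + 1/2) 0)^2/2 := by
    induction N with
    | zero => simp
    | succ N ih =>
      rw [Finset.sum_range_succ]
      have := psi_step (x - N)
      push_cast
      rw [show x - ((N:ℝ) + 1) + 1/2 = x - N - 1/2 by ring]
      linarith
  have h2 : (max (x + 1/2) 0)^2 ≤ (x+1/2)^2 := by
    rcases le_total 0 (x + 1/2) with h' | h'
    · rw [max_eq_left h']
    · rw [max_eq_right h']; nlinarith [sq_nonneg (x+1/2)]
  nlinarith [sq_nonneg (max (x - N + 1/2) 0)]

lemma tri_sum (n N : ℕ) (h : n < N) :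
    (n : ℝ) * (n + 1) / 2 ≤ ∑ k ∈ Finset.range N, max ((n : ℝ) - k) 0 := by
  have h1 : ∑ k ∈ Finset.range n, max ((n : ℝ) - k) 0 = (n : ℝ) * (n + 1) / 2 := by
    have : ∑ k ∈ Finset.range n, max ((n : ℝ) - k) 0 = ∑ k ∈ Finset.range n, ((n : ℝ) - k) := by
      apply Finset.sum_congr rfl
      intro k hk
      have : (k : ℝ) < n := by exact_mod_cast Finset.mem_range.mp hk
      exact max_eq_left (by linarith)
    rw [this]
    clear this h
    induction n with
    | zero => simp
    | succ n ih =>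
      rw [Finset.sum_range_succ]
      have : ∑ k ∈ Finset.range n, (((n + 1 : ℕ) : ℝ) - k) =
          ∑ k ∈ Finset.range n, ((n : ℝ) - k) + n := by
        have h9 : ∀ k ∈ Finset.range n, (((n + 1 : ℕ) : ℝ) - k) = ((n : ℝ) - k) + 1 := by
          intro k _; push_cast; ring
        rw [Finset.sum_congr rfl h9, Finset.sum_add_distrib]
        simp
      rw [this, ih]
      push_cast
      ring
  rw [← h1]
  apply Finset.sum_le_sum_of_subset_of_nonneg
  · intro a; simp only [Finset.mem_range]; omega
  · intros; exact le_max_right _ _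

/-- finite Lagrange basis functions -/
def Gg (lam : ℕ → ℂ) (n N : ℕ) (z : ℂ) : ℂ :=
  ∏ k ∈ (Finset.range N).erase n, (z - lam k) / (lam n - lam k)

lemma factor_bound (s : ℝ) (lam : ℕ → ℂ) (hlam : ∀ n : ℕ, ‖lam n‖ = Real.exp (s + n / 2))
    (n k : ℕ) (hk : k ≠ n) (z : ℂ) (x : ℝ) (hz : ‖z‖ ≤ Real.exp (s + x / 2)) :
    ‖(z - lam k) / (lam n - lam k)‖ ≤ Real.exp (max (x - k) 0 / 2 - max ((n : ℝ) - k) 0 / 2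
      + Real.exp (-|x - k| / 4) + 3 * Real.exp (-|(n : ℝ) - k| / 4)) := by
  have hnum : ‖z - lam k‖ ≤ Real.exp (s + k / 2) * (1 + Real.exp ((x - k) / 2)) := by
    refine (norm_sub_le _ _).trans ?_
    rw [hlam, mul_add, ← Real.exp_add, show s + (k:ℝ)/2 + (x - k)/2 = s + x / 2 by ring]
    linarith
  have hden : Real.exp (s + k / 2) * |Real.exp (((n : ℝ) - k) / 2) - 1| ≤ ‖lam n - lam k‖ := by
    refine le_trans ?_ (abs_norm_sub_norm_le _ _)
    rw [hlam, hlam]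
    nth_rw 1 [← abs_of_pos (Real.exp_pos (s + (k:ℝ) / 2))]
    rw [← abs_mul, mul_sub, ← Real.exp_add, show s + (k:ℝ)/2 + ((n:ℝ) - k)/2 = s + n / 2 by ring,
      mul_one]
  have hy : 1/2 ≤ |((n : ℝ) - k) / 2| := by
    have : (1 : ℝ) ≤ |(n : ℝ) - k| := by
      have h : (1 : ℤ) ≤ |(n : ℤ) - k| := Int.one_le_abs (by omega)
      exact_mod_cast h
    rw [abs_div, abs_of_pos (show (0:ℝ) < 2 by norm_num)]
    linarith
  have h1 := f1 ((x - k) / 2)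
  have h2 := f2 (((n : ℝ) - k) / 2) hy
  have hE := Real.exp_pos (s + (k:ℝ) / 2)
  rw [norm_div]
  have hd : 0 < ‖lam n - lam k‖ := lt_of_lt_of_le (mul_pos hE (lt_of_lt_of_le (Real.exp_pos _) h2)) hden
  rw [div_le_iff₀ hd]
  refine hnum.trans ?_
  have hm : ∀ y : ℝ, max (y / 2) 0 = max y 0 / 2 := by
    intro y
    rcases le_total y 0 with h | h
    · rw [max_eq_right h, max_eq_right (by linarith)]; simp
    · rw [max_eq_left h, max_eq_left (by linarith)]
  have ha : ∀ y : ℝ, Real.exp (-|y/2|) ≤ Real.exp (-|y|/4) := by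
    intro y
    apply Real.exp_le_exp.mpr
    rw [abs_div, abs_of_pos (show (0:ℝ) < 2 by norm_num)]
    have := abs_nonneg y
    linarith
  rw [hm] at h1 h2
  calc Real.exp (s + k / 2) * (1 + Real.exp ((x - k) / 2))
      ≤ Real.exp (s + k / 2) * (Real.exp (max (x - k) 0 / 2 - max ((n : ℝ) - k) 0 / 2
      + Real.exp (-|x - k| / 4) + 3 * Real.exp (-|(n : ℝ) - k| / 4)) *
        Real.exp (max ((n:ℝ) - k) 0 / 2 - 3 * Real.exp (-|((n:ℝ) - k) / 2|))) := by
        apply mul_le_mul_of_nonneg_left _ hE.le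
        refine h1.trans ?_
        rw [← Real.exp_add]
        apply Real.exp_le_exp.mpr
        have := ha (x - k)
        have := ha ((n:ℝ) - k)
        linarith
    _ = Real.exp (max (x - k) 0 / 2 - max ((n : ℝ) - k) 0 / 2
      + Real.exp (-|x - k| / 4) + 3 * Real.exp (-|(n : ℝ) - k| / 4)) * (Real.exp (s + k / 2) * 
        Real.exp (max ((n:ℝ) - k) 0 / 2 - 3 * Real.exp (-|((n:ℝ) - k) / 2|))) := by ring
    _ ≤ _ := by
        apply mul_le_mul_of_nonneg_left _ (Real.exp_pos _).le
        exact le_trans (mul_le_mul_of_nonneg_left h2 hE.le) hden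

lemma Gg_bound_x : ∃ C : ℝ, 0 < C ∧ ∀ (s : ℝ) (lam : ℕ → ℂ)
    (_ : ∀ n : ℕ, ‖lam n‖ = Real.exp (s + n / 2)) (n N : ℕ) (z : ℂ) (x : ℝ), n < N →
    ‖z‖ ≤ Real.exp (s + x / 2) →
    ‖Gg lam n N z‖ ≤ C * Real.exp ((x^2 - n^2)/4 - |x - n| / 4) := by
  obtain ⟨K, hK, hKs⟩ := ksum
  refine ⟨Real.exp (1/16 + 4 * K), Real.exp_pos _, ?_⟩
  intro s lam hlam n N z x hnN hz
  unfold Gg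
  rw [norm_prod]
  have h1 : ∏ k ∈ (Finset.range N).erase n, ‖(z - lam k) / (lam n - lam k)‖ ≤
      ∏ k ∈ (Finset.range N).erase n, Real.exp (max (x - k) 0 / 2 - max ((n : ℝ) - k) 0 / 2
      + Real.exp (-|x - k| / 4) + 3 * Real.exp (-|(n : ℝ) - k| / 4)) := by
    apply Finset.prod_le_prod
    · intros; positivity
    · intro k hk
      exact factor_bound s lam hlam n k (Finset.ne_of_mem_erase hk) z x hz
  refine h1.trans ?_
  rw [← Real.exp_sum, ← Real.exp_add]
  apply Real.exp_le_exp.mpr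
  rw [Finset.sum_add_distrib, Finset.sum_add_distrib, Finset.sum_sub_distrib, ← Finset.sum_div,
    ← Finset.sum_div, ← Finset.mul_sum]
  have e1 := Finset.add_sum_erase (Finset.range N) (fun k : ℕ => max (x - k) 0) (Finset.mem_range.mpr hnN)
  have e2 := Finset.add_sum_erase (Finset.range N) (fun k : ℕ => max ((n:ℝ) - k) 0) (Finset.mem_range.mpr hnN)
  simp only [sub_self, max_self, zero_add] at e2
  have p1 := psi_sum x N
  have p2 := tri_sum n N hnN
  have k1 := hKs x ((Finset.range N).erase n)
  have k2 := hKs n ((Finset.range N).erase n)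
  have hab : |x - n| = 2 * max (x - n) 0 - (x - n) := by
    rcases le_total (x - n) 0 with h | h
    · rw [max_eq_right h, abs_of_nonpos h]; ring
    · rw [max_eq_left h, abs_of_nonneg h]; ring
  rw [hab]

  nlinarith

/-- Pointwise bound in logarithmic coordinates. -/
lemma Gg_bound : ∃ C : ℝ, 0 < C ∧ ∀ (s : ℝ) (lam : ℕ → ℂ)
    (_ : ∀ n : ℕ, ‖lam n‖ = Real.exp (s + n / 2)) (n N : ℕ) (z : ℂ) (t : ℝ), n < N →
    ‖z‖ ≤ Real.exp t →
    ‖Gg lam n N z‖ ≤ C * (Real.exp (t^2 - 2 * s * t) *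
      Real.exp (-((s + n/2)^2 - 2 * s * (s + n/2))) * Real.exp (-|t - (s + n/2)| / 2)) := by
  obtain ⟨C, hC, h⟩ := Gg_bound_x
  refine ⟨C, hC, ?_⟩
  intro s lam hlam n N z t hn hz
  have := h s lam hlam n N z (2 * (t - s)) hn (by convert hz using 2; ring)
  refine this.trans (le_of_eq ?_)
  rw [← Real.exp_add, ← Real.exp_add]
  congr 2
  rw [show 2 * (t - s) - (n:ℝ) = 2 * (t - (s + n/2)) by ring, abs_mul,
    abs_of_pos (show (0:ℝ) < 2 by norm_num)]
  ring

/-- kernel sum in logarithmic coordinates -/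
lemma ksum_t : ∃ K : ℝ, 0 < K ∧ ∀ (s t : ℝ) (S : Finset ℕ),
    ∑ n ∈ S, Real.exp (-|t - (s + n/2)| / 2) ≤ K := by
  obtain ⟨K, hK, h⟩ := ksum
  refine ⟨K, hK, fun s t S => ?_⟩
  refine le_trans (le_of_eq ?_) (h (2 * (t - s)) S)
  apply Finset.sum_congr rfl
  intro n _
  rw [show 2 * (t - s) - (n:ℝ) = 2 * (t - (s + n/2)) by ring, abs_mul,
    abs_of_pos (show (0:ℝ) < 2 by norm_num)]
  congr 1
  ring

lemma exists_g (s : ℝ) (lam : ℕ → ℂ) (hlam : ∀ n : ℕ, ‖lam n‖ = Real.exp (s + n / 2)) :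
    ∃ g : ℕ → ℂ → ℂ, (∀ n, Differentiable ℂ (g n)) ∧
      ∀ n z, Filter.Tendsto (fun N => Gg lam n N z) Filter.atTop (nhds (g n z)) := by
  have hinj : ∀ m n : ℕ, m ≠ n → lam n - lam m ≠ 0 := by
    intro m n h h0
    have : ‖lam n‖ = ‖lam m‖ := by rw [sub_eq_zero.mp h0]
    rw [hlam, hlam] at this
    have := Real.exp_injective this
    apply h
    have h2 : (m : ℝ) = n := by linarith
    exact_mod_cast h2
  let f : ℕ → ℕ → ℂ → ℂ := fun n k z => if k = n then 0 else (z - lam n) / (lam n - lam k)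
  have hG : ∀ n N z, Gg lam n N z = ∏ k ∈ Finset.range N, (1 + f n k z) := by
    intro n N z
    unfold Gg
    have : ∏ k ∈ (Finset.range N).erase n, (1 + f n k z) = ∏ k ∈ Finset.range N, (1 + f n k z) := by
      apply Finset.prod_erase
      simp [f]
    rw [← this]
    apply Finset.prod_congr rfl
    intro k hk
    have hk' := Finset.ne_of_mem_erase hk
    have := hinj k n hk'
    simp only [f, hk', if_false]
    field_simp
    ring
  have hprod : ∀ n (R : ℝ), HasProdLocallyUniformlyOn (fun k z => 1 + f n k z)
      (fun z => ∏' k, (1 + f n k z)) (Metric.ball 0 R) := by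
    intro n R
    apply Summable.hasProdLocallyUniformlyOn_nat_one_add Metric.isOpen_ball
      (u := fun k : ℕ => 2 * (R + Real.exp (s + n/2)) * Real.exp (-s) * Real.exp (k * (-(1/2))))
    · exact (Real.summable_exp_nat_mul_iff.mpr (by norm_num)).mul_left _
    · filter_upwards [Filter.eventually_ge_atTop (n + 2)] with k hk z hz
      have hkn : k ≠ n := by omega
      simp only [f, hkn, if_false]
      have h1 : ‖z - lam n‖ ≤ R + Real.exp (s + n/2) := by
        refine (norm_sub_le _ _).trans ?_
        rw [hlam]
        have := mem_ball_zero_iff.mp hz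
        linarith
      have h2 : Real.exp (s + k/2) / 2 ≤ ‖lam n - lam k‖ := by
        rw [norm_sub_rev]
        refine le_trans ?_ (norm_sub_norm_le _ _)
        rw [hlam, hlam]
        have h3 : Real.exp (s + n/2) * 2 ≤ Real.exp (s + k/2) := by
          have h4 : s + (n:ℝ)/2 + 1 ≤ s + k/2 := by
            have : (n:ℝ) + 2 ≤ k := by exact_mod_cast hk
            linarith
          refine le_trans ?_ (Real.exp_le_exp.mpr h4)
          rw [Real.exp_add (s + (n:ℝ)/2) 1]
          have := Real.add_one_le_exp (1:ℝ)
          exact mul_le_mul_of_nonneg_left (by linarith) (Real.exp_pos _).le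
        linarith
      rw [norm_div]
      have hpos : 0 < Real.exp (s + (k:ℝ)/2) / 2 := by positivity
      rw [div_le_iff₀ (lt_of_lt_of_le hpos h2)]
      have hR : 0 ≤ R + Real.exp (s + n/2) := (norm_nonneg _).trans h1
      calc ‖z - lam n‖ ≤ R + Real.exp (s + n/2) := h1
        _ = 2 * (R + Real.exp (s + n/2)) * Real.exp (-s) * Real.exp (k * (-(1/2))) *
            (Real.exp (s + (k:ℝ)/2) / 2) := by
            have : Real.exp (-s) * Real.exp (k * (-(1/2))) * Real.exp (s + (k:ℝ)/2) = 1 := by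
              rw [← Real.exp_add, ← Real.exp_add, Real.exp_eq_one_iff]; ring
            linear_combination (-(R + Real.exp (s + n/2))) * this
        _ ≤ _ := by
            apply mul_le_mul_of_nonneg_left h2
            positivity
    · intro k
      by_cases h : k = n
      · simp only [f, h, if_true]; fun_prop
      · simp only [f, h, if_false]; fun_prop
  refine ⟨fun n z => ∏' k, (1 + f n k z), ?_, ?_⟩
  · intro n z
    have h := (hprod n (‖z‖ + 1))
    have hd : DifferentiableOn ℂ (fun z => ∏' k, (1 + f n k z)) (Metric.ball 0 (‖z‖ + 1)) := by
      refine TendstoLocallyUniformlyOn.differentiableOn h ?_ Metric.isOpen_ball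
      refine Filter.Eventually.of_forall fun S => ?_
      apply Differentiable.differentiableOn
      have : ∀ k ∈ S, Differentiable ℂ (fun z => 1 + f n k z) := by
        intro k _
        by_cases h : k = n
        · simp only [f, h, if_true]; fun_prop
        · simp only [f, h, if_false]; fun_prop
      exact Differentiable.fun_finsetProd this
    exact hd.differentiableAt (Metric.isOpen_ball.mem_nhds (by simp))
  · intro n z
    simp_rw [hG]
    exact ((hprod n (‖z‖ + 1)).hasProd (by simp)).tendsto_prod_nat

lemma schur {α : Type*} [MeasurableSpace α] (μ : Measure α) (k w : α → ℝ≥0∞)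
    (hk : AEMeasurable k μ) (hw : AEMeasurable w μ) (p : ℝ) (hp : 1 < p) :
    (∫⁻ a, k a * w a ∂μ) ^ p ≤ (∫⁻ a, k a ∂μ) ^ (p - 1) * ∫⁻ a, k a * w a ^ p ∂μ := by
  have hp0 : 0 < p := by linarith
  have hinv : p⁻¹ < 1 := inv_lt_one_of_one_lt₀ hp
  have hinv0 : 0 < p⁻¹ := by positivity
  have h := ENNReal.lintegral_mul_norm_pow_le (μ := μ) (f := k) (g := fun a => k a * w a ^ p) hk
    (hk.mul (hw.pow_const p)) (p := 1 - p⁻¹) (q := p⁻¹) (by linarith) hinv0.le (by ring)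
  have e : ∀ a, k a ^ (1 - p⁻¹) * (k a * w a ^ p) ^ p⁻¹ = k a * w a := by
    intro a
    rw [ENNReal.mul_rpow_of_nonneg _ _ hinv0.le, ← mul_assoc,
      ← ENNReal.rpow_add_of_nonneg _ _ (by linarith) hinv0.le, ← ENNReal.rpow_mul,
      mul_inv_cancel₀ hp0.ne']
    simp
  simp only [e] at h
  calc (∫⁻ a, k a * w a ∂μ) ^ p ≤ ((∫⁻ a, k a ∂μ) ^ (1 - p⁻¹) *
        (∫⁻ a, k a * w a ^ p ∂μ) ^ p⁻¹) ^ p := ENNReal.rpow_le_rpow h hp0.le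
    _ = _ := by
      rw [ENNReal.mul_rpow_of_nonneg _ _ hp0.le, ← ENNReal.rpow_mul, ← ENNReal.rpow_mul,
        inv_mul_cancel₀ hp0.ne', sub_mul, inv_mul_cancel₀ hp0.ne']
      simp

lemma schur_tsum (k w : ℕ → ℝ≥0∞) (p : ℝ) (hp : 1 < p) :
    (∑' n, k n * w n) ^ p ≤ (∑' n, k n) ^ (p - 1) * ∑' n, k n * w n ^ p := by
  have := schur Measure.count k w (measurable_of_countable _).aemeasurable
    (measurable_of_countable _).aemeasurable p hp
  simpa only [lintegral_count] using this

def Hker (τ : ℝ) (z : ℂ) : ℝ := (‖z‖^2)⁻¹ * Real.exp (-|Real.log ‖z‖ - τ| / 2)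

lemma Hker_meas (τ : ℝ) : Measurable (fun z => ENNReal.ofReal (Hker τ z)) := by
  unfold Hker
  fun_prop

lemma Hker0_fin : ∫⁻ z, ENNReal.ofReal (Hker 0 z) < ⊤ := by
  have hHint : Integrable (fun z : ℂ => Hker 0 z) := by
    have := (integrable_fun_norm_addHaar (volume : Measure ℂ)
      (f := fun y : ℝ => (y^2)⁻¹ * Real.exp (-|Real.log y - 0| / 2))).mpr
    apply this
    simp only [Complex.finrank_real_complex, smul_eq_mul]
    rw [← Set.Ioc_union_Ioi_eq_Ioi (zero_le_one' ℝ)]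
    apply IntegrableOn.union
    · have h := (intervalIntegral.intervalIntegrable_rpow' (a := 0) (b := 1)
        (show (-1 : ℝ) < -(1/2) by norm_num))
      rw [intervalIntegrable_iff_integrableOn_Ioc_of_le zero_le_one] at h
      refine h.congr_fun ?_ measurableSet_Ioc
      intro y hy
      have hl : Real.log y ≤ 0 := Real.log_nonpos hy.1.le hy.2
      simp only [sub_zero]
      rw [abs_of_nonpos hl, Real.rpow_def_of_pos hy.1]
      have h2 : y = Real.exp (Real.log y) := (Real.exp_log hy.1).symm
      have h3 : y ^ (2 - 1) * (y ^ 2)⁻¹ = y⁻¹ := by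
        have := hy.1.ne'
        field_simp
        try simp
      rw [← mul_assoc, h3]
      nth_rw 2 [h2]
      rw [← Real.exp_neg, ← Real.exp_add]
      congr 1; ring
    · have h := integrableOn_Ioi_rpow_of_lt (show (-(3/2) : ℝ) < -1 by norm_num) one_pos
      refine h.congr_fun ?_ measurableSet_Ioi
      intro y hy
      have hy : 1 < y := hy
      have hy0 : 0 < y := by linarith
      have hl : 0 ≤ Real.log y := Real.log_nonneg hy.le
      simp only [sub_zero]
      rw [abs_of_nonneg hl, Real.rpow_def_of_pos hy0]
      have h2 : y = Real.exp (Real.log y) := (Real.exp_log hy0).symm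
      have h3 : y ^ (2 - 1) * (y ^ 2)⁻¹ = y⁻¹ := by
        field_simp
        try simp
      rw [← mul_assoc, h3]
      nth_rw 2 [h2]
      rw [← Real.exp_neg, ← Real.exp_add]
      congr 1; ring
  exact hHint.lintegral_lt_top

lemma Hker_int (τ : ℝ) : ∫⁻ z, ENNReal.ofReal (Hker τ z) = ∫⁻ z, ENNReal.ofReal (Hker 0 z) := by
  have hE := Real.exp_pos τ
  have hm := Measure.map_addHaar_smul (volume : Measure ℂ) hE.ne'
  have h1 : ∫⁻ u : ℂ, ENNReal.ofReal (Hker τ (Real.exp τ • u)) =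
      ENNReal.ofReal (Real.exp (-2 * τ)) * ∫⁻ z, ENNReal.ofReal (Hker τ z) := by
    rw [← lintegral_map (Hker_meas τ) (measurable_const_smul (Real.exp τ)), hm, lintegral_smul_measure,
      smul_eq_mul]
    congr 2
    rw [Complex.finrank_real_complex, abs_of_pos (by positivity), ← Real.exp_nat_mul, ← Real.exp_neg]
    congr 1; push_cast; ring
  have h2 : ∀ u : ℂ, ENNReal.ofReal (Hker τ (Real.exp τ • u)) =
      ENNReal.ofReal (Real.exp (-2 * τ)) * ENNReal.ofReal (Hker 0 u) := by
    intro u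
    rw [← ENNReal.ofReal_mul (Real.exp_pos _).le]
    congr 1
    unfold Hker
    rcases eq_or_ne u 0 with rfl | hu
    · simp
    · have hu' : ‖u‖ ≠ 0 := norm_ne_zero_iff.mpr hu
      rw [norm_smul, Real.norm_eq_abs, abs_of_pos hE, Real.log_mul hE.ne' hu', Real.log_exp,
        mul_pow, mul_inv, ← Real.exp_nat_mul, ← Real.exp_neg]
      rw [show τ + Real.log ‖u‖ - τ = Real.log ‖u‖ - 0 by ring, mul_assoc]
      congr 2; push_cast; ring
  simp only [h2] at h1
  rw [lintegral_const_mul _ (Hker_meas 0)] at h1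
  have hne : ENNReal.ofReal (Real.exp (-2 * τ)) ≠ 0 := by
    simp [Real.exp_pos]
  exact ((ENNReal.mul_right_inj hne ENNReal.ofReal_ne_top).mp h1).symm

lemma kernel_int : ∃ C : ℝ≥0∞, C ≠ ⊤ ∧ ∀ τ : ℝ,
    ∫⁻ z : ℂ, ENNReal.ofReal (Real.exp (-2 * logPlus ‖z‖) * Real.exp (-|logPlus ‖z‖ - τ| / 2)) ≤ C := by
  refine ⟨volume (Metric.ball (0:ℂ) 1) + ∫⁻ z, ENNReal.ofReal (Hker 0 z), ?_, ?_⟩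
  · exact ENNReal.add_ne_top.mpr ⟨Metric.isBounded_ball.measure_lt_top.ne, Hker0_fin.ne⟩
  · intro τ
    rw [← Hker_int τ, ← lintegral_indicator_one Metric.isOpen_ball.measurableSet,
      ← lintegral_add_right _ (Hker_meas τ)]
    apply lintegral_mono
    intro z
    rcases lt_or_ge ‖z‖ 1 with h | h
    · have hz : z ∈ Metric.ball (0:ℂ) 1 := by simpa using h
      simp only [Set.indicator_of_mem hz, Pi.one_apply]
      refine le_trans ?_ le_self_add
      rw [← Real.exp_add, ENNReal.ofReal_le_one, Real.exp_le_one_iff]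
      have : 0 ≤ logPlus ‖z‖ := le_max_right _ _
      have := abs_nonneg (logPlus ‖z‖ - τ)
      linarith
    · refine le_trans ?_ le_add_self
      apply ENNReal.ofReal_le_ofReal
      have hl : logPlus ‖z‖ = Real.log ‖z‖ := max_eq_left (Real.log_nonneg h)
      rw [hl]
      unfold Hker
      apply le_of_eq
      congr 1
      have h0 : 0 < ‖z‖ := by linarith
      nth_rw 2 [← Real.exp_log h0]
      rw [← Real.exp_nat_mul, ← Real.exp_neg]
      congr 1; push_cast; ring

/-- node position in logarithmic coordinates -/
def tau (s : ℝ) (n : ℕ) : ℝ := s + n / 2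
/-- weight exponent -/
def wex (s t : ℝ) : ℝ := t^2 - 2 * s * t

lemma g_bound (s : ℝ) (lam : ℕ → ℂ) (hlam : ∀ n : ℕ, ‖lam n‖ = Real.exp (s + n / 2))
    (g : ℕ → ℂ → ℂ)
    (hg : ∀ n z, Filter.Tendsto (fun N => Gg lam n N z) Filter.atTop (nhds (g n z))) :
    ∃ C : ℝ, 0 < C ∧ (∀ (n N : ℕ) (z : ℂ), n < N →
      ‖Gg lam n N z‖ ≤ C * (Real.exp (wex s (logPlus ‖z‖)) *
      Real.exp (-wex s (tau s n)) * Real.exp (-|logPlus ‖z‖ - tau s n| / 2))) ∧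
      (∀ (n : ℕ) (z : ℂ),
      ‖g n z‖ ≤ C * (Real.exp (wex s (logPlus ‖z‖)) *
      Real.exp (-wex s (tau s n)) * Real.exp (-|logPlus ‖z‖ - tau s n| / 2))) := by
  obtain ⟨C, hC, h⟩ := Gg_bound
  have hz : ∀ z : ℂ, ‖z‖ ≤ Real.exp (logPlus ‖z‖) := by
    intro z
    rcases eq_or_ne z 0 with rfl | hz
    · simp [Real.exp_nonneg]
    · have h0 : 0 < ‖z‖ := norm_pos_iff.mpr hz
      calc ‖z‖ = Real.exp (Real.log ‖z‖) := (Real.exp_log h0).symm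
        _ ≤ _ := Real.exp_le_exp.mpr (le_max_left _ _)
  have h1 : ∀ (n N : ℕ) (z : ℂ), n < N →
      ‖Gg lam n N z‖ ≤ C * (Real.exp (wex s (logPlus ‖z‖)) *
      Real.exp (-wex s (tau s n)) * Real.exp (-|logPlus ‖z‖ - tau s n| / 2)) :=
    fun n N z hn => h s lam hlam n N z _ hn (hz z)
  refine ⟨C, hC, h1, ?_⟩
  intro n z
  apply le_of_tendsto (hg n z).norm
  filter_upwards [Filter.eventually_gt_atTop n] with N hN
  exact h1 n N z hN

lemma ksum_summable (s t : ℝ) : Summable (fun n : ℕ => Real.exp (-|t - tau s n| / 2)) := by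
  obtain ⟨K, hK, h⟩ := ksum_t
  exact summable_of_sum_le (fun n => (Real.exp_pos _).le) (fun S => h s t S)

lemma ksum_enn : ∃ K : ℝ≥0∞, K ≠ ⊤ ∧ ∀ s t : ℝ,
    ∑' n : ℕ, ENNReal.ofReal (Real.exp (-|t - tau s n| / 2)) ≤ K := by
  obtain ⟨K, hK, h⟩ := ksum_t
  refine ⟨ENNReal.ofReal K, ENNReal.ofReal_ne_top, fun s t => ?_⟩
  rw [← ENNReal.ofReal_tsum_of_nonneg (fun n => (Real.exp_pos _).le) (ksum_summable s t)]
  apply ENNReal.ofReal_le_ofReal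
  exact (ksum_summable s t).tsum_le_of_sum_le (fun S => h s t S)

lemma interp_norm (p : ℝ) (hp : 1 < p) (lam : ℕ → ℂ)
    (hlam : ∀ n : ℕ, ‖lam n‖ = Real.exp (1 / p + n / 2))
    (g : ℕ → ℂ → ℂ)
    (hg : ∀ n z, Filter.Tendsto (fun N => Gg lam n N z) Filter.atTop (nhds (g n z))) :
    ∃ A : ℝ≥0∞, A ≠ ⊤ ∧ ∀ v : ℕ → ℂ, fockNormP 1 p (fun z => ∑' n, v n * g n z) ≤
      A * ∑' n, ENNReal.ofReal (‖v n‖ * Real.exp (-wex (1/p) (tau (1/p) n))) ^ p := by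
  obtain ⟨C, hC, -, hgb⟩ := g_bound (1/p) lam hlam g hg
  obtain ⟨K, hK, hKs⟩ := ksum_enn
  obtain ⟨D, hD, hDs⟩ := kernel_int
  have hp0 : 0 < p := by linarith
  set s := 1 / p with hs
  refine ⟨ENNReal.ofReal C ^ p * K ^ (p - 1) * D, ?_, ?_⟩
  · apply ENNReal.mul_ne_top (ENNReal.mul_ne_top _ _) hD
    · exact ENNReal.rpow_ne_top_of_nonneg hp0.le ENNReal.ofReal_ne_top
    · exact ENNReal.rpow_ne_top_of_nonneg (by linarith) hK
  intro v
  set W : ℕ → ℝ≥0∞ := fun n => ENNReal.ofReal (‖v n‖ * Real.exp (-wex s (tau s n))) with hW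
  set k : ℕ → ℂ → ℝ≥0∞ := fun n z => ENNReal.ofReal (Real.exp (-|logPlus ‖z‖ - tau s n| / 2)) with hk
  have hpt : ∀ z : ℂ, ENNReal.ofReal ((‖∑' n, v n * g n z‖ * Real.exp (-(phi 1 z))) ^ p) ≤
      ENNReal.ofReal C ^ p * K ^ (p - 1) *
        ∑' n, W n ^ p * ENNReal.ofReal (Real.exp (-2 * logPlus ‖z‖) * Real.exp (-|logPlus ‖z‖ - tau s n| / 2)) := by
    intro z
    set t := logPlus ‖z‖ with ht
    have h1 : ‖∑' n, v n * g n z‖ₑ ≤ ENNReal.ofReal (C * Real.exp (wex s t)) * ∑' n, k n z * W n := by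
      refine enorm_tsum_le_tsum_enorm.trans ?_
      rw [← ENNReal.tsum_mul_left]
      apply ENNReal.tsum_le_tsum
      intro n
      simp only [hk, hW]
      rw [← ofReal_norm, ← ENNReal.ofReal_mul (by positivity), ← ENNReal.ofReal_mul (by positivity)]
      apply ENNReal.ofReal_le_ofReal
      rw [norm_mul]
      refine (mul_le_mul_of_nonneg_left (hgb n z) (norm_nonneg _)).trans (le_of_eq ?_)
      ring
    rw [← ENNReal.ofReal_rpow_of_nonneg (by positivity) hp0.le, ENNReal.ofReal_mul (norm_nonneg _),
      ofReal_norm]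
    calc (‖∑' n, v n * g n z‖ₑ * ENNReal.ofReal (Real.exp (-(phi 1 z)))) ^ p
        ≤ ((ENNReal.ofReal (C * Real.exp (wex s t)) * ∑' n, k n z * W n) *
          ENNReal.ofReal (Real.exp (-(phi 1 z)))) ^ p := by gcongr
      _ = (ENNReal.ofReal C * ENNReal.ofReal (Real.exp (-2 * s * t)) * ∑' n, k n z * W n) ^ p := by
          congr 1
          rw [mul_right_comm, ← ENNReal.ofReal_mul (by positivity), mul_assoc, ← Real.exp_add,
            ← ENNReal.ofReal_mul hC.le]
          congr 4
          simp only [wex, phi, ht]; ring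
      _ = ENNReal.ofReal C ^ p * ENNReal.ofReal (Real.exp (-2 * t)) * (∑' n, k n z * W n) ^ p := by
          rw [ENNReal.mul_rpow_of_nonneg _ _ hp0.le, ENNReal.mul_rpow_of_nonneg _ _ hp0.le,
            ENNReal.ofReal_rpow_of_nonneg (Real.exp_pos _).le hp0.le, ← Real.exp_mul]
          congr 4
          rw [hs]; field_simp
      _ ≤ ENNReal.ofReal C ^ p * ENNReal.ofReal (Real.exp (-2 * t)) *
          (K ^ (p-1) * ∑' n, k n z * W n ^ p) := by
          gcongr
          refine (schur_tsum (fun n => k n z) W p hp).trans ?_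
          gcongr
          exact hKs s t
      _ = ENNReal.ofReal C ^ p * K ^ (p - 1) *
          (ENNReal.ofReal (Real.exp (-2 * t)) * ∑' n, k n z * W n ^ p) := by ring
      _ = _ := by
          rw [← ENNReal.tsum_mul_left]
          congr 2
          funext n
          rw [ENNReal.ofReal_mul (Real.exp_pos _).le]
          ring
  have hlp : Measurable (fun z : ℂ => logPlus ‖z‖) := by
    unfold logPlus
    fun_prop
  have hkm : ∀ n, Measurable (fun z : ℂ => ENNReal.ofReal (Real.exp (-2 * logPlus ‖z‖) *
      Real.exp (-|logPlus ‖z‖ - tau s n| / 2))) := by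
    intro n
    fun_prop
  unfold fockNormP
  calc _ ≤ ∫⁻ z : ℂ, ENNReal.ofReal C ^ p * K ^ (p - 1) *
        ∑' n, W n ^ p * ENNReal.ofReal (Real.exp (-2 * logPlus ‖z‖) * Real.exp (-|logPlus ‖z‖ - tau s n| / 2)) :=
        lintegral_mono hpt
    _ = ENNReal.ofReal C ^ p * K ^ (p - 1) * ∑' n, W n ^ p * ∫⁻ z : ℂ, 
          ENNReal.ofReal (Real.exp (-2 * logPlus ‖z‖) * Real.exp (-|logPlus ‖z‖ - tau s n| / 2)) := by
        rw [lintegral_const_mul, lintegral_tsum]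
        · congr 2
          funext n
          rw [lintegral_const_mul _ (hkm n)]
        · intro n
          exact ((hkm n).const_mul _).aemeasurable
        · exact Measurable.tsum (fun n => (hkm n).const_mul _)
    _ ≤ ENNReal.ofReal C ^ p * K ^ (p - 1) * ∑' n, W n ^ p * D := by
        gcongr with n
        exact hDs _
    _ = _ := by
        rw [ENNReal.tsum_mul_right]; ring

lemma interp_diff (s : ℝ) (lam : ℕ → ℂ)
    (hlam : ∀ n : ℕ, ‖lam n‖ = Real.exp (s + n / 2))
    (g : ℕ → ℂ → ℂ) (hgd : ∀ n, Differentiable ℂ (g n))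
    (hg : ∀ n z, Filter.Tendsto (fun N => Gg lam n N z) Filter.atTop (nhds (g n z)))
    (v : ℕ → ℂ) (B : ℝ) (hB : ∀ n, ‖v n‖ * Real.exp (-wex s (tau s n)) ≤ B) :
    Differentiable ℂ (fun z => ∑' n, v n * g n z) := by
  obtain ⟨C, hC, -, hgb⟩ := g_bound s lam hlam g hg
  intro z₀
  set T := logPlus (‖z₀‖ + 1) with hT
  have hT0 : 0 ≤ T := le_max_right _ _
  have hB0 : 0 ≤ B := le_trans (by positivity) (hB 0)
  have hd : DifferentiableOn ℂ (fun z => ∑' n, v n * g n z) (Metric.ball 0 (‖z₀‖ + 1)) := by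
    apply differentiableOn_tsum_of_summable_norm
      (u := fun n => B * C * Real.exp (T^2 + 2 * |s| * T) * Real.exp (T / 2) *
        Real.exp (-|0 - tau s n| / 2))
    · exact (ksum_summable s 0).mul_left _
    · intro n
      exact ((hgd n).const_mul _).differentiableOn
    · exact Metric.isOpen_ball
    · intro n z hz
      have hz' : ‖z‖ < ‖z₀‖ + 1 := by simpa using hz
      have ht0 : 0 ≤ logPlus ‖z‖ := le_max_right _ _
      have htT : logPlus ‖z‖ ≤ T := by
        rcases eq_or_ne z 0 with rfl | hz0
        · simp [logPlus, hT]
        · exact max_le_max (Real.log_le_log (norm_pos_iff.mpr hz0) hz'.le) le_rfl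
      set t := logPlus ‖z‖ with ht
      have e1 : Real.exp (wex s t) ≤ Real.exp (T^2 + 2 * |s| * T) := by
        apply Real.exp_le_exp.mpr
        unfold wex
        have h1 : -(s * t) ≤ |s| * T := by
          calc -(s * t) = (-s) * t := by ring
            _ ≤ |s| * t := mul_le_mul_of_nonneg_right (neg_le_abs s) ht0
            _ ≤ _ := mul_le_mul_of_nonneg_left htT (abs_nonneg _)
        nlinarith
      have e2 : Real.exp (-|t - tau s n| / 2) ≤ Real.exp (T / 2) * Real.exp (-|0 - tau s n| / 2) := by
        rw [← Real.exp_add]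
        apply Real.exp_le_exp.mpr
        have : |0 - tau s n| ≤ |t - tau s n| + |t| := by
          have a1 := neg_abs_le (t - tau s n)
          have a2 := le_abs_self (t - tau s n)
          have a3 := neg_abs_le t
          have a4 := le_abs_self t
          rw [abs_le]
          constructor <;> linarith
        rw [abs_of_nonneg ht0] at this
        linarith
      rw [norm_mul]
      calc ‖v n‖ * ‖g n z‖ ≤ ‖v n‖ * (C * (Real.exp (wex s t) *
            Real.exp (-wex s (tau s n)) * Real.exp (-|t - tau s n| / 2))) :=
            mul_le_mul_of_nonneg_left (hgb n z) (norm_nonneg _)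
        _ = (‖v n‖ * Real.exp (-wex s (tau s n))) * C * Real.exp (wex s t) *
            Real.exp (-|t - tau s n| / 2) := by ring
        _ ≤ B * C * Real.exp (T^2 + 2 * |s| * T) * (Real.exp (T / 2) * Real.exp (-|0 - tau s n| / 2)) := by
            gcongr
            exact hB n
        _ = _ := by ring
  exact hd.differentiableAt (Metric.isOpen_ball.mem_nhds (by simp))

lemma lam_inj (s : ℝ) (lam : ℕ → ℂ) (hlam : ∀ n : ℕ, ‖lam n‖ = Real.exp (s + n / 2)) :
    Function.Injective lam := by
  intro m n h
  have : ‖lam n‖ = ‖lam m‖ := by rw [h]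
  rw [hlam, hlam] at this
  have := Real.exp_injective this
  have h2 : (m : ℝ) = n := by linarith
  exact_mod_cast h2

lemma g_node (s : ℝ) (lam : ℕ → ℂ)
    (hlam : ∀ n : ℕ, ‖lam n‖ = Real.exp (s + n / 2))
    (g : ℕ → ℂ → ℂ)
    (hg : ∀ n z, Filter.Tendsto (fun N => Gg lam n N z) Filter.atTop (nhds (g n z)))
    (n m : ℕ) : g n (lam m) = if n = m then 1 else 0 := by
  have hinj := lam_inj s lam hlam
  apply tendsto_nhds_unique (hg n (lam m))
  apply tendsto_const_nhds.congr'
  filter_upwards [Filter.eventually_gt_atTop m] with N hN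
  unfold Gg
  split_ifs with h
  · subst h
    symm
    apply Finset.prod_eq_one
    intro k hk
    apply div_self
    intro h0
    exact Finset.ne_of_mem_erase hk (hinj (sub_eq_zero.mp h0)).symm
  · symm
    apply Finset.prod_eq_zero (i := m)
    · simp [hN, Ne.symm h]
    · simp

lemma interp_node (s : ℝ) (lam : ℕ → ℂ)
    (hlam : ∀ n : ℕ, ‖lam n‖ = Real.exp (s + n / 2))
    (g : ℕ → ℂ → ℂ)
    (hg : ∀ n z, Filter.Tendsto (fun N => Gg lam n N z) Filter.atTop (nhds (g n z)))
    (v : ℕ → ℂ) (m : ℕ) : ∑' n, v n * g n (lam m) = v m := by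
  rw [tsum_eq_single m]
  · simp [g_node s lam hlam g hg]
  · intro n hn
    simp [g_node s lam hlam g hg, hn]

lemma coef_exists (f : ℂ → ℂ) (hf : Differentiable ℂ f) : ∃ a : ℕ → ℂ,
    (∀ z, HasSum (fun k => a k * z ^ k) (f z)) ∧
    (∀ (R : ℝ), 0 < R → ∀ k : ℕ, ENNReal.ofReal (2 * Real.pi * (‖a k‖ * R ^ k)) ≤
      ∫⁻ θ in Set.Ioo (-Real.pi) Real.pi, ‖f (Complex.polarCoord.symm (R, θ))‖ₑ) := by
  refine ⟨fun k => (cauchyPowerSeries f 0 1).coeff k, ?_, ?_⟩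
  · intro z
    have h := hf.hasFPowerSeriesOnBall 0 (R := 1) one_pos
    have := h.hasSum (y := z) (by simp)
    simp only [zero_add, FormalMultilinearSeries.apply_eq_pow_smul_coeff, smul_eq_mul] at this
    simpa [mul_comm] using this
  · intro R hR k
    have h1 := hf.hasFPowerSeriesOnBall 0 (R := 1) one_pos
    have h2 := hf.hasFPowerSeriesOnBall 0 (R := ⟨R, hR.le⟩) hR
    have he := h1.hasFPowerSeriesAt.eq_formalMultilinearSeries h2.hasFPowerSeriesAt
    have h3 := norm_cauchyPowerSeries_le f 0 R k
    have hcont : Continuous (fun θ : ℝ => ‖f (circleMap 0 R θ)‖) :=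
      (hf.continuous.comp (continuous_circleMap 0 R)).norm
    have hper : ∫ θ : ℝ in (0:ℝ)..2 * Real.pi, ‖f (circleMap 0 R θ)‖ =
        ∫ θ in Set.Ioo (-Real.pi) Real.pi, ‖f (circleMap 0 R θ)‖ := by
      have hp : Function.Periodic (fun θ : ℝ => ‖f (circleMap 0 R θ)‖) (2 * Real.pi) := by
        intro θ
        simp only [periodic_circleMap 0 R θ]
      have := hp.intervalIntegral_add_eq 0 (-Real.pi)
      rw [zero_add] at this
      rw [this, show -Real.pi + 2 * Real.pi = Real.pi by ring,
        intervalIntegral.integral_of_le (by linarith [Real.pi_pos]), integral_Ioc_eq_integral_Ioo]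
    have h4 : ∫⁻ θ in Set.Ioo (-Real.pi) Real.pi, ‖f (Complex.polarCoord.symm (R, θ))‖ₑ =
        ENNReal.ofReal (∫ θ in Set.Ioo (-Real.pi) Real.pi, ‖f (circleMap 0 R θ)‖) := by
      rw [ofReal_integral_eq_lintegral_ofReal]
      · apply lintegral_congr
        intro θ
        rw [ofReal_norm]
        congr 2
        simp [circleMap, Complex.polarCoord_symm_apply, Complex.exp_mul_I]
      · exact (hcont.integrableOn_Icc (a := -Real.pi) (b := Real.pi)).mono_set Set.Ioo_subset_Icc_self
      · exact Filter.Eventually.of_forall fun θ => norm_nonneg _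
    rw [h4]
    apply ENNReal.ofReal_le_ofReal
    rw [← hper]
    have h5 : ‖(cauchyPowerSeries f 0 1).coeff k‖ = ‖cauchyPowerSeries f 0 R k‖ := by
      rw [← FormalMultilinearSeries.norm_apply_eq_norm_coef]
      have : cauchyPowerSeries f 0 1 = cauchyPowerSeries f 0 R := he
      rw [this]
    rw [h5]
    rw [abs_of_pos hR] at h3
    have hRk : 0 < R ^ k := pow_pos hR k
    calc 2 * Real.pi * (‖cauchyPowerSeries f 0 R k‖ * R ^ k)
        ≤ 2 * Real.pi * ((((2 * Real.pi)⁻¹ * ∫ θ : ℝ in (0:ℝ)..2 * Real.pi, ‖f (circleMap 0 R θ)‖) *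
          R⁻¹ ^ k) * R ^ k) := by gcongr
      _ = _ := by
        have := Real.pi_pos
        rw [inv_pow]
        field_simp

lemma coef_bound (p : ℝ) (hp : 1 < p) : ∃ A : ℝ≥0∞, A ≠ ⊤ ∧ ∀ (f : ℂ → ℂ) (a : ℕ → ℂ),
    Differentiable ℂ f →
    (∀ (R : ℝ), 0 < R → ∀ k : ℕ, ENNReal.ofReal (2 * Real.pi * (‖a k‖ * R ^ k)) ≤
      ∫⁻ θ in Set.Ioo (-Real.pi) Real.pi, ‖f (Complex.polarCoord.symm (R, θ))‖ₑ) →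
    ∑' k, ENNReal.ofReal (‖a k‖ * Real.exp (tau (1/p) k ^ 2)) ^ p ≤ A * fockNormP 1 p f := by
  have hp0 : 0 < p := by linarith
  have hpi := Real.pi_pos
  set s := 1 / p with hs
  have hs0 : 0 < s := by positivity
  -- constant
  set P : ℝ≥0∞ := ENNReal.ofReal (2 * Real.pi) with hP
  set c : ℝ≥0∞ := ENNReal.ofReal (Real.exp (-p/4) * (1 - Real.exp (-(1/2)))) with hc
  have hcpos : 0 < Real.exp (-p/4) * (1 - Real.exp (-(1/2))) := by
    apply mul_pos (Real.exp_pos _)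
    have : Real.exp (-(1/2)) < 1 := by
      have := Real.exp_lt_exp.mpr (show (-(1/2):ℝ) < 0 by norm_num)
      simp only [Real.exp_zero] at this
      exact this
    linarith
  have hc0 : c ≠ 0 := by simpa [hc] using hcpos
  have hct : c ≠ ⊤ := ENNReal.ofReal_ne_top
  have hP0 : P ≠ 0 := by simp [hP, hpi]
  have hPt : P ≠ ⊤ := ENNReal.ofReal_ne_top
  have hPp0 : P ^ p ≠ 0 := by
    rw [Ne, ENNReal.rpow_eq_zero_iff_of_pos hp0]; exact hP0
  have hPpt : P ^ p ≠ ⊤ := ENNReal.rpow_ne_top_of_nonneg hp0.le hPt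
  refine ⟨(P ^ p * c)⁻¹ * P ^ (p - 1), ?_, ?_⟩
  · apply ENNReal.mul_ne_top
    · exact ENNReal.inv_ne_top.mpr (mul_ne_zero hPp0 hc0)
    · exact ENNReal.rpow_ne_top_of_nonneg (by linarith) hPt
  intro f a hf ha
  set al : ℕ → ℝ≥0∞ := fun k => ENNReal.ofReal (‖a k‖ * Real.exp (tau s k ^ 2)) ^ p with hal
  let I : ℕ → Set ℝ := fun k => Set.Ico (Real.exp (tau s k)) (Real.exp (tau s (k+1)))
  have htau : ∀ k, tau s (k+1) = tau s k + 1/2 := by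
    intro k; unfold tau; push_cast; ring
  have htau0 : ∀ k, 0 ≤ tau s k := by
    intro k; unfold tau; positivity
  -- continuity facts
  have hcontp : Continuous (fun q : ℝ × ℝ => Complex.polarCoord.symm q) := by
    have : (fun q : ℝ × ℝ => Complex.polarCoord.symm q) =
        fun q : ℝ × ℝ => (q.1 : ℂ) * (Real.cos q.2 + Real.sin q.2 * Complex.I) := by
      funext q; simp [Complex.polarCoord_symm_apply]
    rw [this]
    fun_prop
  let J : ℝ → ℝ≥0∞ := fun r => ∫⁻ θ in Set.Ioo (-Real.pi) Real.pi, ENNReal.ofReal r *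
    ENNReal.ofReal ((‖f (Complex.polarCoord.symm (r, θ))‖ *
      Real.exp (-(phi 1 (Complex.polarCoord.symm (r, θ))))) ^ p)
  have hphim : Measurable (phi 1) := by
    unfold phi logPlus
    fun_prop
  have hfock : fockNormP 1 p f = ∫⁻ r in Set.Ioi (0:ℝ), J r := by
    unfold fockNormP
    rw [← Complex.lintegral_comp_polarCoord_symm]
    rw [polarCoord_target, Measure.volume_eq_prod, setLIntegral_prod]
    · rfl
    · apply Measurable.aemeasurable
      have hm := hcontp.measurable
      have hfm := hf.continuous.measurable
      simp only [smul_eq_mul]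
      exact (measurable_fst.ennreal_ofReal).mul (Measurable.ennreal_ofReal
        (((hfm.comp hm).norm.mul ((hphim.comp hm).neg.exp)).pow_const p))
  have hJ : ∀ k, ∀ r ∈ I k, P ^ p * (al k * ENNReal.ofReal (Real.exp (-p/4) * Real.exp (-tau s (k+1))))
      ≤ P ^ (p-1) * J r := by
    intro k r hr
    have hr0 : 0 < r := lt_of_lt_of_le (Real.exp_pos _) hr.1
    set t := Real.log r with ht
    have hrt : r = Real.exp t := (Real.exp_log hr0).symm
    have ht1 : tau s k ≤ t := (Real.le_log_iff_exp_le hr0).mpr hr.1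
    have ht2 : t < tau s (k+1) := (Real.log_lt_iff_lt_exp hr0).mpr hr.2
    have ht0 : 0 ≤ t := (htau0 k).trans ht1
    have hnorm : ∀ θ, ‖Complex.polarCoord.symm (r, θ)‖ = r := by
      intro θ
      rw [Complex.norm_polarCoord_symm, abs_of_pos hr0]
    have hphi : ∀ θ, phi 1 (Complex.polarCoord.symm (r, θ)) = t^2 := by
      intro θ
      unfold phi logPlus
      rw [hnorm, ← ht, max_eq_left ht0, one_mul]
    have hJr : J r = ENNReal.ofReal (r * Real.exp (-p * t^2)) *
        ∫⁻ θ in Set.Ioo (-Real.pi) Real.pi, ‖f (Complex.polarCoord.symm (r, θ))‖ₑ ^ p := by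
      simp only [J]
      rw [← lintegral_const_mul']
      · apply lintegral_congr
        intro θ
        rw [hphi, Real.mul_rpow (norm_nonneg _) (Real.exp_pos _).le, ← Real.exp_mul,
          ENNReal.ofReal_mul (by positivity), ENNReal.ofReal_mul hr0.le,
          ← ENNReal.ofReal_rpow_of_nonneg (norm_nonneg _) hp0.le, ofReal_norm,
          show -t^2 * p = -p * t^2 by ring]
        ring
      · exact ENNReal.ofReal_ne_top
    have hmeas : Measurable (fun θ : ℝ => ‖f (Complex.polarCoord.symm (r, θ))‖ₑ) := by
      have h1 : Continuous (fun θ : ℝ => f (Complex.polarCoord.symm (r, θ))) :=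
        hf.continuous.comp (hcontp.comp (by fun_prop))
      exact h1.measurable.enorm
    have hjen := schur (volume.restrict (Set.Ioo (-Real.pi) Real.pi)) (fun _ => 1)
      (fun θ : ℝ => ‖f (Complex.polarCoord.symm (r, θ))‖ₑ) aemeasurable_const hmeas.aemeasurable p hp
    simp only [one_mul, lintegral_const, Measure.restrict_apply MeasurableSet.univ, Set.univ_inter,
      Real.volume_Ioo] at hjen
    rw [show Real.pi - -Real.pi = 2 * Real.pi by ring] at hjen
    have h1 := (ENNReal.rpow_le_rpow (ha r hr0 k) hp0.le).trans hjen
    rw [hJr]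
    calc P ^ p * (al k * ENNReal.ofReal (Real.exp (-p/4) * Real.exp (-tau s (k+1))))
        ≤ ENNReal.ofReal (r * Real.exp (-p * t^2)) * ENNReal.ofReal (2 * Real.pi * (‖a k‖ * r ^ k)) ^ p := by
          rw [ENNReal.ofReal_mul (by positivity : 0 ≤ 2 * Real.pi), ENNReal.mul_rpow_of_nonneg _ _ hp0.le,
            ← hP, mul_left_comm (ENNReal.ofReal (r * Real.exp (-p * t^2)))]
          refine mul_le_mul' le_rfl ?_
          simp only [hal]
          rw [ENNReal.ofReal_rpow_of_nonneg (by positivity) hp0.le,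
            ENNReal.ofReal_rpow_of_nonneg (by positivity) hp0.le,
            ← ENNReal.ofReal_mul (by positivity), ← ENNReal.ofReal_mul (by positivity)]
          apply ENNReal.ofReal_le_ofReal
          rw [Real.mul_rpow (norm_nonneg _) (by positivity), Real.mul_rpow (norm_nonneg _) (by positivity)]
          rw [mul_assoc, mul_left_comm (r * Real.exp (-p * t^2))]
          apply mul_le_mul_of_nonneg_left _ (by positivity)
          rw [hrt, ← Real.exp_nat_mul, ← Real.exp_mul, ← Real.exp_mul, ← Real.exp_add, ← Real.exp_add,
            ← Real.exp_add, ← Real.exp_add]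
          apply Real.exp_le_exp.mpr
          have hk : (k:ℝ) = 2 * tau s k - 2 * s := by unfold tau; ring
          have hps : p * s = 1 := by rw [hs]; field_simp
          rw [hk]
          have hsq : (t - tau s k)^2 ≤ 1/4 := by
            have := htau k
            nlinarith
          have hexp : (2 * tau s k - 2 * s) * t * p = 2 * p * tau s k * t - 2 * t := by
            linear_combination (-2 * t) * hps
          rw [hexp]
          nlinarith [mul_le_mul_of_nonneg_left hsq hp0.le]
      _ ≤ ENNReal.ofReal (r * Real.exp (-p * t^2)) * (P ^ (p-1) *
            ∫⁻ θ in Set.Ioo (-Real.pi) Real.pi, ‖f (Complex.polarCoord.symm (r, θ))‖ₑ ^ p) := by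
          gcongr
      _ = _ := by ring
  have hI : ∀ k, P ^ p * c * al k ≤ P ^ (p-1) * ∫⁻ r in I k, J r := by
    intro k
    have h1 : ∫⁻ r in I k, P ^ p * (al k * ENNReal.ofReal (Real.exp (-p/4) * Real.exp (-tau s (k+1))))
        ≤ ∫⁻ r in I k, P ^ (p-1) * J r := by
      apply setLIntegral_mono' measurableSet_Ico
      exact hJ k
    rw [lintegral_const_mul' (P ^ (p-1)) J (ENNReal.rpow_ne_top_of_nonneg (by linarith) hPt)] at h1
    refine le_trans (le_of_eq ?_) h1
    rw [setLIntegral_const, Real.volume_Ico, mul_assoc, mul_assoc, mul_assoc,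
      ← ENNReal.ofReal_mul (by positivity), mul_comm c]
    congr 3
    rw [hc]
    congr 1
    rw [mul_assoc]
    congr 1
    rw [mul_sub, ← Real.exp_add, ← Real.exp_add, htau, neg_add_cancel, Real.exp_zero]
    congr 2
    ring
  have hsum : ∑' k, ∫⁻ r in I k, J r ≤ fockNormP 1 p f := by
    rw [hfock, ← lintegral_iUnion (fun k => measurableSet_Ico)]
    · apply lintegral_mono_set
      intro r hr
      obtain ⟨k, hk⟩ := Set.mem_iUnion.mp hr
      exact lt_of_lt_of_le (Real.exp_pos _) hk.1
    · have hmono : Monotone (fun k => Real.exp (tau s k)) := by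
        intro i j hij
        apply Real.exp_le_exp.mpr
        unfold tau
        have : (i:ℝ) ≤ j := by exact_mod_cast hij
        linarith
      exact hmono.pairwise_disjoint_on_Ico_succ
  have hfin : P ^ p * c * ∑' k, al k ≤ P ^ (p-1) * fockNormP 1 p f := by
    rw [← ENNReal.tsum_mul_left]
    refine (ENNReal.tsum_le_tsum hI).trans ?_
    rw [ENNReal.tsum_mul_left]
    gcongr
  have hne0 : P ^ p * c ≠ 0 := mul_ne_zero hPp0 hc0
  have hnet : P ^ p * c ≠ ⊤ := ENNReal.mul_ne_top hPpt hct
  calc ∑' k, al k = (P ^ p * c)⁻¹ * (P ^ p * c * ∑' k, al k) := by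
        rw [← mul_assoc, ENNReal.inv_mul_cancel hne0 hnet, one_mul]
    _ ≤ (P ^ p * c)⁻¹ * (P ^ (p-1) * fockNormP 1 p f) := by gcongr
    _ = _ := by ring

lemma term_bound (s : ℝ) (lam : ℕ → ℂ) (hlam : ∀ n : ℕ, ‖lam n‖ = Real.exp (s + n / 2))
    (a : ℕ → ℂ) (n k : ℕ) :
    ‖a k * lam n ^ k‖ * Real.exp (-wex s (tau s n)) ≤
      Real.exp (1/16) * ((‖a k‖ * Real.exp (tau s k ^ 2)) * Real.exp (-|tau s n - tau s k| / 2)) := by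
  have h1 : ‖a k * lam n ^ k‖ = ‖a k‖ * Real.exp (k * tau s n) := by
    rw [norm_mul, norm_pow, hlam, Real.exp_nat_mul]; rfl
  rw [h1, mul_assoc, ← Real.exp_add, mul_assoc, ← Real.exp_add, mul_left_comm, ← Real.exp_add]
  apply mul_le_mul_of_nonneg_left _ (norm_nonneg _)
  apply Real.exp_le_exp.mpr
  have hk : (k:ℝ) = 2 * tau s k - 2 * s := by unfold tau; ring
  have h2 : (tau s n - tau s k)^2 = |tau s n - tau s k|^2 := (sq_abs _).symm
  rw [hk]
  unfold wex
  nlinarith [sq_nonneg (|tau s n - tau s k| - 1/4)]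

lemma disc_bound (p : ℝ) (hp : 1 < p) (lam : ℕ → ℂ)
    (hlam : ∀ n : ℕ, ‖lam n‖ = Real.exp (1 / p + n / 2)) :
    ∃ A : ℝ≥0∞, A ≠ ⊤ ∧ ∀ (f : ℂ → ℂ) (a : ℕ → ℂ),
      (∀ z, HasSum (fun k => a k * z ^ k) (f z)) →
      ∑' n, ENNReal.ofReal (‖f (lam n)‖ * Real.exp (-wex (1/p) (tau (1/p) n))) ^ p ≤
      A * ∑' k, ENNReal.ofReal (‖a k‖ * Real.exp (tau (1/p) k ^ 2)) ^ p := by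
  obtain ⟨K, hK, hKs⟩ := ksum_enn
  have hp0 : 0 < p := by linarith
  set s := 1 / p with hs
  set E : ℝ≥0∞ := ENNReal.ofReal (Real.exp (1/16)) with hE
  refine ⟨E ^ p * K ^ (p - 1) * K, ?_, ?_⟩
  · apply ENNReal.mul_ne_top (ENNReal.mul_ne_top _ _) hK
    · exact ENNReal.rpow_ne_top_of_nonneg hp0.le ENNReal.ofReal_ne_top
    · exact ENNReal.rpow_ne_top_of_nonneg (by linarith) hK
  intro f a ha
  set al : ℕ → ℝ≥0∞ := fun k => ENNReal.ofReal (‖a k‖ * Real.exp (tau s k ^ 2)) with hal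
  set kk : ℕ → ℕ → ℝ≥0∞ := fun n k => ENNReal.ofReal (Real.exp (-|tau s n - tau s k| / 2)) with hkk
  have h1 : ∀ n, ENNReal.ofReal (‖f (lam n)‖ * Real.exp (-wex s (tau s n))) ≤
      E * ∑' k, kk n k * al k := by
    intro n
    have hf : ENNReal.ofReal ‖f (lam n)‖ ≤ ∑' k, ENNReal.ofReal ‖a k * lam n ^ k‖ := by
      have h := ha (lam n)
      rw [← h.tsum_eq]
      simp only [ofReal_norm]
      exact enorm_tsum_le_tsum_enorm
    rw [ENNReal.ofReal_mul (norm_nonneg _)]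
    refine (mul_le_mul' hf le_rfl).trans ?_
    rw [← ENNReal.tsum_mul_right, ← ENNReal.tsum_mul_left]
    apply ENNReal.tsum_le_tsum
    intro k
    rw [← ENNReal.ofReal_mul (norm_nonneg _)]
    refine (ENNReal.ofReal_le_ofReal (term_bound s lam hlam a n k)).trans ?_
    rw [ENNReal.ofReal_mul (by positivity), ENNReal.ofReal_mul (by positivity), mul_comm (kk n k)]
  calc ∑' n, ENNReal.ofReal (‖f (lam n)‖ * Real.exp (-wex s (tau s n))) ^ p
      ≤ ∑' n, E ^ p * (K ^ (p-1) * ∑' k, kk n k * al k ^ p) := by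
        apply ENNReal.tsum_le_tsum
        intro n
        refine (ENNReal.rpow_le_rpow (h1 n) hp0.le).trans ?_
        rw [ENNReal.mul_rpow_of_nonneg _ _ hp0.le]
        refine mul_le_mul' le_rfl ?_
        refine (schur_tsum (kk n) al p hp).trans ?_
        refine mul_le_mul' (ENNReal.rpow_le_rpow (hKs s (tau s n)) (by linarith)) le_rfl
    _ = E ^ p * K ^ (p-1) * ∑' k, (∑' n, kk n k) * al k ^ p := by
        rw [ENNReal.tsum_mul_left, ENNReal.tsum_mul_left, ENNReal.tsum_comm, mul_assoc]
        simp only [ENNReal.tsum_mul_right]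
    _ ≤ E ^ p * K ^ (p-1) * ∑' k, K * al k ^ p := by
        refine mul_le_mul' le_rfl (ENNReal.tsum_le_tsum fun k => mul_le_mul' ?_ le_rfl)
        simp only [hkk, abs_sub_comm _ (tau s k)]
        exact hKs s (tau s k)
    _ = _ := by
        rw [ENNReal.tsum_mul_left]; ring

lemma lagrange_Gg (lam : ℕ → ℂ) (hinj : Function.Injective lam) (a : ℕ → ℂ) (N : ℕ) (z : ℂ) :
    ∑ k ∈ Finset.range N, a k * z ^ k =
      ∑ n ∈ Finset.range N, (∑ k ∈ Finset.range N, a k * lam n ^ k) * Gg lam n N z := by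
  set Q : Polynomial ℂ := ∑ k ∈ Finset.range N, Polynomial.C (a k) * Polynomial.X ^ k with hQ
  have hev : ∀ w, Q.eval w = ∑ k ∈ Finset.range N, a k * w ^ k := by
    intro w
    simp [hQ, Polynomial.eval_finsetSum]
  have hdeg : Q.degree < (Finset.range N).card := by
    rw [Finset.card_range]
    refine (Polynomial.degree_sum_le _ _).trans_lt ?_
    rw [Finset.sup_lt_iff (by exact_mod_cast WithBot.bot_lt_coe N)]
    intro k hk
    refine (Polynomial.degree_C_mul_X_pow_le k (a k)).trans_lt ?_
    exact_mod_cast Finset.mem_range.mp hk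
  have h := Lagrange.eq_interpolate (s := Finset.range N) (v := lam) hinj.injOn hdeg
  rw [← hev, h, Lagrange.interpolate_apply, Polynomial.eval_finsetSum]
  apply Finset.sum_congr rfl
  intro n hn
  rw [Polynomial.eval_mul, Polynomial.eval_C, hev]
  congr 1
  unfold Lagrange.basis Gg
  rw [Polynomial.eval_prod]
  apply Finset.prod_congr rfl
  intro k _
  simp [Lagrange.basisDivisor]
  field_simp

lemma reconstruct (s : ℝ) (lam : ℕ → ℂ) (hlam : ∀ n : ℕ, ‖lam n‖ = Real.exp (s + n / 2))
    (g : ℕ → ℂ → ℂ)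
    (hg : ∀ n z, Filter.Tendsto (fun N => Gg lam n N z) Filter.atTop (nhds (g n z)))
    (f : ℂ → ℂ) (a : ℕ → ℂ) (ha : ∀ z, HasSum (fun k => a k * z ^ k) (f z))
    (M : ℝ) (hM : ∀ k, ‖a k‖ * Real.exp (tau s k ^ 2) ≤ M) (z : ℂ) :
    f z = ∑' n, f (lam n) * g n z := by
  obtain ⟨C, hC, hGb, -⟩ := g_bound s lam hlam g hg
  obtain ⟨K, hK, hKs⟩ := ksum_t
  have hM0 : 0 ≤ M := le_trans (by positivity) (hM 0)
  set t := logPlus ‖z‖ with ht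
  set F : ℕ → ℕ → ℂ := fun N n => if n < N then
    (∑ k ∈ Finset.range N, a k * lam n ^ k) * Gg lam n N z else 0 with hF
  have h1 : ∀ N, ∑' n, F N n = ∑ k ∈ Finset.range N, a k * z ^ k := by
    intro N
    rw [lagrange_Gg lam (lam_inj s lam hlam), tsum_eq_sum (s := Finset.range N)]
    · apply Finset.sum_congr rfl
      intro n hn
      simp [hF, Finset.mem_range.mp hn]
    · intro n hn
      have : ¬ n < N := by simpa using hn
      simp [hF, this]
  have hlim1 : Filter.Tendsto (fun N => ∑' n, F N n) Filter.atTop (nhds (f z)) := by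
    simp only [h1]
    exact (ha z).tendsto_sum_nat
  have hpart : ∀ n N, ‖∑ k ∈ Finset.range N, a k * lam n ^ k‖ * Real.exp (-wex s (tau s n)) ≤
      Real.exp (1/16) * (M * K) := by
    intro n N
    calc _ ≤ (∑ k ∈ Finset.range N, ‖a k * lam n ^ k‖) * Real.exp (-wex s (tau s n)) := by
          gcongr; exact norm_sum_le _ _
      _ = ∑ k ∈ Finset.range N, ‖a k * lam n ^ k‖ * Real.exp (-wex s (tau s n)) := by
          rw [Finset.sum_mul]
      _ ≤ ∑ k ∈ Finset.range N, Real.exp (1/16) * (M * Real.exp (-|tau s n - tau s k| / 2)) := by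
          apply Finset.sum_le_sum
          intro k _
          refine (term_bound s lam hlam a n k).trans ?_
          gcongr
          exact hM k
      _ = Real.exp (1/16) * (M * ∑ k ∈ Finset.range N, Real.exp (-|tau s n - tau s k| / 2)) := by
          rw [← Finset.mul_sum, ← Finset.mul_sum]
      _ ≤ _ := by
          gcongr
          exact hKs s (tau s n) _
  have hlim2 : Filter.Tendsto (fun N => ∑' n, F N n) Filter.atTop
      (nhds (∑' n, f (lam n) * g n z)) := by
    apply tendsto_tsum_of_dominated_convergence
      (bound := fun n => Real.exp (1/16) * (M * K) * C * Real.exp (wex s t) *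
        Real.exp (-|t - tau s n| / 2))
    · exact (ksum_summable s t).mul_left _
    · intro n
      have : Filter.Tendsto (fun N => (∑ k ∈ Finset.range N, a k * lam n ^ k) * Gg lam n N z)
          Filter.atTop (nhds (f (lam n) * g n z)) := (ha (lam n)).tendsto_sum_nat.mul (hg n z)
      apply this.congr'
      filter_upwards [Filter.eventually_gt_atTop n] with N hN
      simp [hF, hN]
    · refine Filter.Eventually.of_forall fun N n => ?_
      by_cases hn : n < N
      · simp only [hF, hn, if_true]
        rw [norm_mul]
        calc _ ≤ ‖∑ k ∈ Finset.range N, a k * lam n ^ k‖ * (C * (Real.exp (wex s t) *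
              Real.exp (-wex s (tau s n)) * Real.exp (-|t - tau s n| / 2))) := by
              gcongr
              exact hGb n N z hn
          _ = (‖∑ k ∈ Finset.range N, a k * lam n ^ k‖ * Real.exp (-wex s (tau s n))) *
              (C * Real.exp (wex s t) * Real.exp (-|t - tau s n| / 2)) := by ring
          _ ≤ (Real.exp (1/16) * (M * K)) *
              (C * Real.exp (wex s t) * Real.exp (-|t - tau s n| / 2)) := by
              exact mul_le_mul_of_nonneg_right (hpart n N) (by positivity)
          _ = _ := by ring
      · simp only [hF, hn, if_false, norm_zero]
        positivity
  exact tendsto_nhds_unique hlim1 hlim2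

lemma node_term (p : ℝ) (hp : 1 < p) (w : ℂ) (n : ℕ) (hw : ‖w‖ = Real.exp (1 / p + n / 2)) (v : ℂ) :
    ENNReal.ofReal (‖v‖ * Real.exp (-wex (1/p) (tau (1/p) n))) ^ p ≤
      ENNReal.ofReal ((1 + ‖w‖) ^ 2 * ‖v‖ ^ p * Real.exp (-(p * phi 1 w))) ∧
    ENNReal.ofReal ((1 + ‖w‖) ^ 2 * ‖v‖ ^ p * Real.exp (-(p * phi 1 w))) ≤
      4 * ENNReal.ofReal (‖v‖ * Real.exp (-wex (1/p) (tau (1/p) n))) ^ p := by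
  have hp0 : 0 < p := by linarith
  set s := 1 / p with hs
  have hs0 : 0 < s := by positivity
  have hps : p * s = 1 := by rw [hs]; field_simp
  have ht0 : 0 ≤ tau s n := by unfold tau; positivity
  have hw' : ‖w‖ = Real.exp (tau s n) := hw
  have hr1 : 1 ≤ ‖w‖ := by rw [hw']; exact Real.one_le_exp ht0
  have hphi : phi 1 w = tau s n ^ 2 := by
    unfold phi logPlus
    rw [hw', Real.log_exp, max_eq_left ht0, one_mul]
  have hW : (‖v‖ * Real.exp (-wex s (tau s n))) ^ p =
      ‖w‖ ^ 2 * ‖v‖ ^ p * Real.exp (-(p * phi 1 w)) := by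
    rw [Real.mul_rpow (norm_nonneg _) (Real.exp_pos _).le, ← Real.exp_mul, hphi, hw',
      ← Real.exp_nat_mul, mul_right_comm, ← Real.exp_add, mul_comm]
    congr 2
    unfold wex
    push_cast
    linear_combination (2 * tau s n) * hps
  rw [ENNReal.ofReal_rpow_of_nonneg (by positivity) hp0.le, hW]
  constructor
  · apply ENNReal.ofReal_le_ofReal
    gcongr
    linarith
  · rw [show (4:ℝ≥0∞) = ENNReal.ofReal 4 by norm_num, ← ENNReal.ofReal_mul (by norm_num)]
    apply ENNReal.ofReal_le_ofReal
    rw [← mul_assoc, ← mul_assoc]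
    gcongr
    nlinarith

lemma main_cis (p : ℝ) (hp : 1 < p) (lam : ℕ → ℂ)
    (hlam : ∀ n : ℕ, ‖lam n‖ = Real.exp (1 / p + n / 2)) :
    CompleteInterpolating 1 p (Set.range lam) := by
  have hp0 : 0 < p := by linarith
  have hinj := lam_inj (1/p) lam hlam
  obtain ⟨g, hgd, hg⟩ := exists_g (1/p) lam hlam
  obtain ⟨A1, hA1, hnorm⟩ := interp_norm p hp lam hlam g hg
  obtain ⟨A2, hA2, hcoef⟩ := coef_bound p hp
  obtain ⟨A3, hA3, hdisc⟩ := disc_bound p hp lam hlam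
  have hrange : ∀ v : ℂ → ℂ, ∑' l : Set.range lam, ENNReal.ofReal
      ((1 + ‖(l : ℂ)‖) ^ 2 * ‖v (l : ℂ)‖ ^ p * Real.exp (-(p * phi 1 (l : ℂ)))) =
      ∑' n, ENNReal.ofReal
      ((1 + ‖lam n‖) ^ 2 * ‖v (lam n)‖ ^ p * Real.exp (-(p * phi 1 (lam n)))) := by
    intro v
    exact tsum_range (f := fun w : ℂ => ENNReal.ofReal
      ((1 + ‖w‖) ^ 2 * ‖v w‖ ^ p * Real.exp (-(p * phi 1 w)))) hinj
  have hlow : ∀ v : ℂ → ℂ,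
      ∑' n, ENNReal.ofReal (‖v (lam n)‖ * Real.exp (-wex (1/p) (tau (1/p) n))) ^ p ≤
      ∑' l : Set.range lam, ENNReal.ofReal
      ((1 + ‖(l : ℂ)‖) ^ 2 * ‖v (l : ℂ)‖ ^ p * Real.exp (-(p * phi 1 (l : ℂ)))) := by
    intro v
    rw [hrange]
    exact ENNReal.tsum_le_tsum fun n => (node_term p hp (lam n) n (hlam n) _).1
  have hupp : ∀ v : ℂ → ℂ,
      ∑' l : Set.range lam, ENNReal.ofReal
      ((1 + ‖(l : ℂ)‖) ^ 2 * ‖v (l : ℂ)‖ ^ p * Real.exp (-(p * phi 1 (l : ℂ)))) ≤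
      4 * ∑' n, ENNReal.ofReal (‖v (lam n)‖ * Real.exp (-wex (1/p) (tau (1/p) n))) ^ p := by
    intro v
    rw [hrange, ← ENNReal.tsum_mul_left]
    exact ENNReal.tsum_le_tsum fun n => (node_term p hp (lam n) n (hlam n) _).2
  have hbdd : ∀ u : ℕ → ℝ, ∑' n, ENNReal.ofReal (u n) ^ p ≠ ⊤ → ∃ B : ℝ, ∀ n, u n ≤ B := by
    intro u hu
    set S := ∑' n, ENNReal.ofReal (u n) ^ p with hS
    have hSt : S ^ (1/p) ≠ ⊤ := ENNReal.rpow_ne_top_of_nonneg (by positivity) hu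
    refine ⟨(S ^ (1/p)).toReal, fun n => ?_⟩
    have h1 : ENNReal.ofReal (u n) ^ p ≤ S :=
      ENNReal.le_tsum (f := fun n => ENNReal.ofReal (u n) ^ p) n
    have h2 := ENNReal.rpow_le_rpow h1 (show 0 ≤ 1/p by positivity)
    rw [← ENNReal.rpow_mul, mul_one_div_cancel hp0.ne', ENNReal.rpow_one] at h2
    exact (ENNReal.ofReal_le_iff_le_toReal hSt).mp h2
  constructor
  · set A : ℝ≥0∞ := 1 + A1 + 4 * (A3 * A2) with hA
    have hAt : A ≠ ⊤ := by
      simp only [hA]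
      exact ENNReal.add_ne_top.mpr ⟨ENNReal.add_ne_top.mpr ⟨ENNReal.one_ne_top, hA1⟩,
        ENNReal.mul_ne_top (by norm_num) (ENNReal.mul_ne_top hA3 hA2)⟩
    have hA1' : 1 ≤ A := by
      rw [hA, add_assoc]; exact le_self_add
    have hA0 : A ≠ 0 := (lt_of_lt_of_le one_pos hA1').ne'
    refine ⟨A.toReal, ?_, ?_⟩
    · have := ENNReal.toReal_mono hAt hA1'
      simpa using this
    intro f hf
    rw [ENNReal.ofReal_toReal hAt]
    obtain ⟨a, ha, hai⟩ := coef_exists f hf.1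
    have hc := hcoef f a hf.1 hai
    have hct : ∑' k, ENNReal.ofReal (‖a k‖ * Real.exp (tau (1/p) k ^ 2)) ^ p ≠ ⊤ :=
      (hc.trans_lt (ENNReal.mul_lt_top hA2.lt_top hf.2)).ne
    obtain ⟨M, hM⟩ := hbdd _ hct
    have hrec : f = fun z => ∑' n, f (lam n) * g n z := by
      funext z
      exact reconstruct (1/p) lam hlam g hg f a ha M hM z
    constructor
    · have h1 := hnorm (fun n => f (lam n))
      rw [← hrec] at h1
      rw [mul_comm, ← div_eq_mul_inv]
      apply ENNReal.div_le_of_le_mul'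
      refine h1.trans (mul_le_mul' ?_ (hlow f))
      rw [hA, add_right_comm, add_comm]
      exact le_self_add
    · refine (hupp f).trans ?_
      calc _ ≤ 4 * (A3 * (A2 * fockNormP 1 p f)) :=
            mul_le_mul' le_rfl ((hdisc f a ha).trans (mul_le_mul' le_rfl hc))
        _ = 4 * (A3 * A2) * fockNormP 1 p f := by ring
        _ ≤ _ := by
            refine mul_le_mul' ?_ le_rfl
            rw [hA, add_comm]
            exact le_self_add
  · intro v hv
    have hS := (hlow v).trans_lt hv
    obtain ⟨B, hB⟩ := hbdd _ hS.ne
    refine ⟨fun z => ∑' n, v (lam n) * g n z, ⟨?_, ?_⟩, ?_⟩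
    · exact interp_diff (1/p) lam hlam g hgd hg (fun n => v (lam n)) B hB
    · exact (hnorm (fun n => v (lam n))).trans_lt (ENNReal.mul_lt_top hA1.lt_top hS)
    · rintro _ ⟨m, rfl⟩
      exact interp_node (1/p) lam hlam g hg (fun n => v (lam n)) m

/-- `e^{-1/4}Λ_1` is a complete interpolating sequence for `F^{4/3}_φ`,
and `e^{-1/4}Λ_0` is a complete interpolating sequence for `F^4_φ`. -/
theorem statement17 (θ : ℕ → ℝ) :
    CompleteInterpolating 1 (4 / 3)
      {w : ℂ | ∃ n : ℕ, 1 ≤ n ∧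
        w = (Real.exp (-(1 / 4) + (1 + (n : ℝ)) / 2) : ℂ) *
          Complex.exp ((θ n : ℂ) * Complex.I)} ∧
    CompleteInterpolating 1 4
      {w : ℂ | ∃ n : ℕ,
        w = (Real.exp (-(1 / 4) + (1 + (n : ℝ)) / 2) : ℂ) *
          Complex.exp ((θ n : ℂ) * Complex.I)} := by
  set L : ℕ → ℂ := fun n => (Real.exp (-(1 / 4) + (1 + (n : ℝ)) / 2) : ℂ) *
          Complex.exp ((θ n : ℂ) * Complex.I) with hL
  have hn : ∀ n, ‖L n‖ = Real.exp (-(1 / 4) + (1 + (n : ℝ)) / 2) := by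
    intro n
    simp only [hL]
    rw [norm_mul, Complex.norm_exp_ofReal_mul_I, mul_one, Complex.norm_real,
      Real.norm_of_nonneg (Real.exp_pos _).le]
  constructor
  · have h := main_cis (4/3) (by norm_num) (fun n => L (n+1)) (by
      intro n
      rw [hn]
      congr 1
      push_cast
      ring)
    convert h using 1
    ext w
    constructor
    · rintro ⟨n, h1, rfl⟩
      obtain ⟨m, rfl⟩ := Nat.exists_eq_add_of_le' h1
      exact ⟨m, rfl⟩
    · rintro ⟨m, rfl⟩
      exact ⟨m + 1, by omega, rfl⟩
  · have h := main_cis 4 (by norm_num) L (by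
      intro n
      rw [hn]
      congr 1
      ring)
    convert h using 1
    ext w
    constructor
    · rintro ⟨n, rfl⟩
      exact ⟨n, rfl⟩
    · rintro ⟨m, rfl⟩
      exact ⟨m, rfl⟩

end
end

section
/- Let l ∈ {−1, 0, 1}, let (θ_n)_{n≥l} be arbitrary real numbers, let Λ_l = {λ_n = e^{(1+n)/2} e^{iθ_n} : n ≥ l}, and let 0 < ν < 1. Then there exist constants c, C > 0 such that for every z ∈ ℂ∖Λ_l: c ≤ (1 + |z|)^{−ν} Σ_{λ∈Λ_l} |λ|^{ν} · dist(z, Λ_l)/|z − λ| ≤ C. -/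
open MeasureTheory Complex
open scoped ENNReal

noncomputable section

/-- The weight `φ(z) = (log⁺ |z|)²` (the case `α = 1`). -/
def phi1 (z : ℂ) : ℝ := (logPlus ‖z‖) ^ 2

lemma norm_lamPt_aux (θ : ℤ → ℝ) (n : ℤ) : ‖lamPt θ n‖ = Real.exp ((1 + (n : ℝ)) / 2) := by
  unfold lamPt
  rw [norm_mul, Complex.norm_exp_ofReal_mul_I, mul_one, Complex.norm_real, Real.norm_eq_abs,
    abs_of_pos (Real.exp_pos _)]

/-- the distance to the set is attained -/
lemma exists_nearest_aux (l : ℤ) (θ : ℤ → ℝ) (z : ℂ) :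
    ∃ m : ℕ, Metric.infDist z (LamSet θ l) = ‖z - lamPt θ (l + m)‖ := by
  have ht : Filter.Tendsto (fun k : ℕ => ‖z - lamPt θ (l + k)‖) Filter.cofinite Filter.atTop := by
    rw [Nat.cofinite_eq_atTop]
    have h1 : Filter.Tendsto (fun k : ℕ => (k : ℝ) * (1 / 2) + (1 + (l : ℝ) / 2 - ‖z‖))
        Filter.atTop Filter.atTop :=
      Filter.tendsto_atTop_add_const_right _ _
        (tendsto_natCast_atTop_atTop.atTop_mul_const (by norm_num))
    refine Filter.tendsto_atTop_mono (fun k => ?_) h1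
    have h2 := norm_sub_norm_le (lamPt θ (l + k)) z
    rw [norm_lamPt_aux, norm_sub_rev] at h2
    have h3 := Real.add_one_le_exp ((1 + ((l + k : ℤ) : ℝ)) / 2)
    push_cast at h2 h3
    linarith
  obtain ⟨m, hm⟩ := ht.exists_forall_le
  refine ⟨m, le_antisymm ?_ ?_⟩
  · rw [← dist_eq_norm]
    exact Metric.infDist_le_dist_of_mem ⟨l + m, by omega, rfl⟩
  · have hne : (LamSet θ l).Nonempty := ⟨lamPt θ l, l, le_refl _, rfl⟩
    rw [Metric.le_infDist hne]
    rintro y ⟨n, hn, rfl⟩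
    obtain ⟨k, rfl⟩ : ∃ k : ℕ, n = l + k := ⟨(n - l).toNat, by omega⟩
    rw [dist_eq_norm]
    exact hm k

lemma summable_aux (δ : ℝ) (hδ : 0 < δ) :
    Summable (fun m : ℤ => Real.exp (-(δ * |(m : ℝ)|))) := by
  have h : Summable (fun n : ℕ => Real.exp (-(δ * |(((n : ℤ)) : ℝ)|))) := by
    have := Real.summable_exp_nat_mul_iff.mpr (neg_lt_zero.mpr hδ)
    refine this.congr (fun n => ?_)
    congr 1
    simp
    ring
  refine Summable.of_nat_of_neg h ?_
  refine h.congr (fun n => ?_)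
  simp

lemma sum_shift_aux (δ : ℝ) (hδ : 0 < δ) (a : ℝ) :
    ∑' k : ℕ, ENNReal.ofReal (Real.exp (-(δ * |(k : ℝ) - a|))) ≤
      ENNReal.ofReal (Real.exp δ * ∑' m : ℤ, Real.exp (-(δ * |(m : ℝ)|))) := by
  have hS := summable_aux δ hδ
  have hstep : ∀ k : ℕ, ENNReal.ofReal (Real.exp (-(δ * |(k : ℝ) - a|))) ≤
      ENNReal.ofReal (Real.exp δ) *
        ENNReal.ofReal (Real.exp (-(δ * |(((k : ℤ) - ⌊a⌋ : ℤ) : ℝ)|))) := by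
    intro k
    rw [← ENNReal.ofReal_mul (Real.exp_pos _).le, ← Real.exp_add]
    apply ENNReal.ofReal_le_ofReal
    apply Real.exp_le_exp.mpr
    have h1 := Int.floor_le a
    have h2 := Int.lt_floor_add_one a
    have h3 : |(((k : ℤ) - ⌊a⌋ : ℤ) : ℝ)| ≤ |(k : ℝ) - a| + 1 := by
      push_cast
      have := abs_sub_abs_le_abs_sub ((k : ℝ) - ⌊a⌋) (k - a)
      have h4 : |((k : ℝ) - ⌊a⌋) - (k - a)| ≤ 1 := by
        rw [abs_le]; constructor <;> linarith
      linarith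
    nlinarith
  calc _ ≤ ∑' k : ℕ, ENNReal.ofReal (Real.exp δ) *
        ENNReal.ofReal (Real.exp (-(δ * |(((k : ℤ) - ⌊a⌋ : ℤ) : ℝ)|))) :=
        ENNReal.tsum_le_tsum hstep
    _ = ENNReal.ofReal (Real.exp δ) * ∑' k : ℕ,
        ENNReal.ofReal (Real.exp (-(δ * |(((k : ℤ) - ⌊a⌋ : ℤ) : ℝ)|))) := ENNReal.tsum_mul_left
    _ ≤ ENNReal.ofReal (Real.exp δ) * ∑' m : ℤ,
        ENNReal.ofReal (Real.exp (-(δ * |(m : ℝ)|))) := by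
        gcongr
        exact ENNReal.tsum_comp_le_tsum_of_injective
          (f := fun k : ℕ => (k : ℤ) - ⌊a⌋)
          (fun x y h => by simpa using h)
          (fun m : ℤ => ENNReal.ofReal (Real.exp (-(δ * |(m : ℝ)|))))
    _ = _ := by
        rw [ENNReal.ofReal_mul (Real.exp_pos _).le,
          ENNReal.ofReal_tsum_of_nonneg (fun _ => (Real.exp_pos _).le) hS]

/-- upper bound of a quotient -/
lemma quot_aux (l : ℤ) (hl : l = -1 ∨ l = 0 ∨ l = 1) (θ : ℤ → ℝ) (z : ℂ)
    (hz : z ∉ LamSet θ l) (k : ℕ) :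
    Metric.infDist z (LamSet θ l) / ‖z - lamPt θ (l + k)‖ ≤ 1 ∧
    Metric.infDist z (LamSet θ l) / ‖z - lamPt θ (l + k)‖ ≤
      8 * ((1 + ‖z‖) / ‖lamPt θ (l + k)‖) := by
  have hne : 0 < ‖z - lamPt θ (l + k)‖ := by
    rw [norm_pos_iff, sub_ne_zero]
    rintro rfl
    exact hz ⟨l + k, by omega, rfl⟩
  have hr : 0 < ‖lamPt θ (l + k)‖ := by rw [norm_lamPt_aux]; exact Real.exp_pos _
  have h1 : Metric.infDist z (LamSet θ l) ≤ ‖z - lamPt θ (l + k)‖ := by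
    rw [← dist_eq_norm]
    exact Metric.infDist_le_dist_of_mem ⟨l + k, by omega, rfl⟩
  have hq : Metric.infDist z (LamSet θ l) / ‖z - lamPt θ (l + k)‖ ≤ 1 :=
    (div_le_one hne).mpr h1
  refine ⟨hq, ?_⟩
  have hz0 := norm_nonneg z
  by_cases hc : ‖lamPt θ (l + k)‖ ≤ 2 * (1 + ‖z‖)
  · refine hq.trans ?_
    rw [← mul_div_assoc, le_div_iff₀ hr]
    linarith
  · push Not at hc
    have h2 : Metric.infDist z (LamSet θ l) ≤ ‖z‖ + 3 := by
      have : Metric.infDist z (LamSet θ l) ≤ ‖z - lamPt θ l‖ := by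
        rw [← dist_eq_norm]
        exact Metric.infDist_le_dist_of_mem ⟨l, le_refl _, rfl⟩
      have h3 := norm_sub_le z (lamPt θ l)
      have h4 : ‖lamPt θ l‖ ≤ 3 := by
        rw [norm_lamPt_aux]
        have : Real.exp ((1 + (l : ℝ)) / 2) ≤ Real.exp 1 := by
          apply Real.exp_le_exp.mpr
          rcases hl with h | h | h <;> rw [h] <;> norm_num
        linarith [Real.exp_one_lt_d9]
      linarith
    have h5 := norm_sub_norm_le (lamPt θ (l + k)) z
    rw [norm_sub_rev] at h5
    rw [← mul_div_assoc, div_le_div_iff₀ hne hr]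
    have h6 : ‖lamPt θ (l + k)‖ ≤ 2 * ‖z - lamPt θ (l + k)‖ := by linarith
    have h7 : Metric.infDist z (LamSet θ l) ≤ 4 * (1 + ‖z‖) := by linarith
    have := mul_le_mul h7 h6 hr.le (by positivity)
    linarith

lemma term_upper_aux (l : ℤ) (hl : l = -1 ∨ l = 0 ∨ l = 1) (θ : ℤ → ℝ)
    (ν δ : ℝ) (hδ1 : 2 * δ ≤ ν) (hδ2 : 2 * δ ≤ 1 - ν) (z : ℂ)
    (hz : z ∉ LamSet θ l) (k : ℕ) :
    (1 + ‖z‖) ^ (-ν) * (‖lamPt θ (l + k)‖ ^ ν *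
      (Metric.infDist z (LamSet θ l) / ‖z - lamPt θ (l + k)‖)) ≤
    8 * Real.exp (-(δ * |(k : ℝ) - (2 * Real.log (1 + ‖z‖) - 1 - l)|)) := by
  obtain ⟨h1, h2⟩ := quot_aux l hl θ z hz k
  set Q := Metric.infDist z (LamSet θ l) / ‖z - lamPt θ (l + k)‖ with hQ
  have hD : 0 < 1 + ‖z‖ := by positivity
  set t := Real.log (1 + ‖z‖) with ht
  have hDt : 1 + ‖z‖ = Real.exp t := (Real.exp_log hD).symm
  rw [norm_lamPt_aux] at h2 ⊢
  rw [hDt] at h2 ⊢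
  set s := (1 + ((l + k : ℤ) : ℝ)) / 2 with hs
  rw [← Real.exp_mul, ← Real.exp_mul, ← mul_assoc, ← Real.exp_add]
  rw [← Real.exp_sub] at h2
  have habs : (k : ℝ) - (2 * t - 1 - l) = 2 * (s - t) := by
    rw [hs]; push_cast; ring
  rw [habs, abs_mul, abs_two]
  rcases le_total s t with h | h
  · rw [abs_of_nonpos (by linarith)]
    calc _ ≤ Real.exp (t * -ν + s * ν) * 1 := by gcongr
      _ ≤ 8 * Real.exp (t * -ν + s * ν) := by linarith [Real.exp_pos (t * -ν + s * ν)]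
      _ ≤ _ := by
        gcongr
        nlinarith
  · rw [abs_of_nonneg (by linarith)]
    calc _ ≤ Real.exp (t * -ν + s * ν) * (8 * Real.exp (t - s)) := by gcongr
      _ = 8 * Real.exp (t * -ν + s * ν + (t - s)) := by
        rw [Real.exp_add _ (t - s)]; ring
      _ ≤ _ := by
        gcongr
        nlinarith

lemma term_lower_aux (l : ℤ) (hl : l = -1 ∨ l = 0 ∨ l = 1) (θ : ℤ → ℝ)
    (ν : ℝ) (hν : 0 < ν) (hν' : ν < 1) (z : ℂ) (hz : z ∉ LamSet θ l) :
    ∃ k : ℕ, 1 / 100 ≤ (1 + ‖z‖) ^ (-ν) * (‖lamPt θ (l + k)‖ ^ ν *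
      (Metric.infDist z (LamSet θ l) / ‖z - lamPt θ (l + k)‖)) := by
  have hl0 : (-1 : ℝ) ≤ l := by rcases hl with h | h | h <;> rw [h] <;> norm_num
  have hl1 : (l : ℝ) ≤ 1 := by rcases hl with h | h | h <;> rw [h] <;> norm_num
  have hz0 := norm_nonneg z
  have hD : 0 < 1 + ‖z‖ := by positivity
  have hne : ∀ k : ℕ, 0 < ‖z - lamPt θ (l + k)‖ := by
    intro k
    rw [norm_pos_iff, sub_ne_zero]
    rintro rfl
    exact hz ⟨l + k, by omega, rfl⟩
  have hcancel : (1 + ‖z‖) ^ (-ν) * (1 + ‖z‖) ^ ν = 1 := by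
    rw [← Real.rpow_add hD]; simp
  have hpow : 0 < (1 + ‖z‖) ^ (-ν) := Real.rpow_pos_of_pos hD _
  obtain ⟨m, hm⟩ := exists_nearest_aux l θ z
  by_cases hc : Metric.infDist z (LamSet θ l) ≤ (1 + ‖z‖) / 8
  · refine ⟨m, ?_⟩
    have hr1 : 1 ≤ ‖lamPt θ (l + m)‖ := by
      rw [norm_lamPt_aux]
      apply Real.one_le_exp
      push_cast
      have : (0 : ℝ) ≤ m := by positivity
      linarith
    have hr2 := norm_sub_norm_le z (lamPt θ (l + m))
    have hr : (1 + ‖z‖) * (1 / 4) ≤ ‖lamPt θ (l + m)‖ := by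
      rw [hm] at hc
      linarith
    have hp : (1 + ‖z‖) ^ ν * (1 / 4) ≤ ‖lamPt θ (l + m)‖ ^ ν := by
      calc (1 + ‖z‖) ^ ν * (1 / 4) ≤ (1 + ‖z‖) ^ ν * (1 / 4 : ℝ) ^ ν := by
            gcongr
            exact Real.self_le_rpow_of_le_one (by norm_num) (by norm_num) hν'.le
        _ = ((1 + ‖z‖) * (1 / 4)) ^ ν := by
            rw [Real.mul_rpow hD.le (by norm_num)]
        _ ≤ _ := Real.rpow_le_rpow (by positivity) hr hν.le
    rw [hm, div_self (hne m).ne', mul_one]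
    have := mul_le_mul_of_nonneg_left hp hpow.le
    rw [← mul_assoc, hcancel] at this
    linarith
  · push Not at hc
    set t := Real.log (1 + ‖z‖) with ht
    have hDt : Real.exp t = 1 + ‖z‖ := Real.exp_log hD
    have ht0 : 0 ≤ t := Real.log_nonneg (by linarith)
    refine ⟨⌈2 * t⌉₊, ?_⟩
    set k := ⌈2 * t⌉₊ with hk
    have hk1 : 2 * t ≤ k := Nat.le_ceil _
    have hk2 : (k : ℝ) < 2 * t + 1 := Nat.ceil_lt_add_one (by linarith)
    have hr1 : 1 + ‖z‖ ≤ ‖lamPt θ (l + k)‖ := by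
      rw [norm_lamPt_aux, ← hDt]
      apply Real.exp_le_exp.mpr
      push_cast
      linarith
    have hr2 : ‖lamPt θ (l + k)‖ ≤ 9 * (1 + ‖z‖) := by
      rw [norm_lamPt_aux, ← hDt]
      have h1 : Real.exp ((1 + ((l + k : ℤ) : ℝ)) / 2) ≤ Real.exp (1 + 1 + t) := by
        apply Real.exp_le_exp.mpr
        push_cast
        linarith
      rw [Real.exp_add, Real.exp_add] at h1
      refine h1.trans ?_
      gcongr
      nlinarith [Real.exp_one_lt_d9, Real.exp_pos 1]
    have hn : ‖z - lamPt θ (l + k)‖ ≤ 10 * (1 + ‖z‖) := by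
      linarith [norm_sub_le z (lamPt θ (l + k))]
    have hq : 1 / 100 ≤ Metric.infDist z (LamSet θ l) / ‖z - lamPt θ (l + k)‖ := by
      rw [le_div_iff₀ (hne k)]
      linarith
    have hp : (1 + ‖z‖) ^ ν ≤ ‖lamPt θ (l + k)‖ ^ ν := Real.rpow_le_rpow hD.le hr1 hν.le
    calc (1 / 100 : ℝ) = (1 + ‖z‖) ^ (-ν) * ((1 + ‖z‖) ^ ν * (1 / 100)) := by
          rw [← mul_assoc, hcancel, one_mul]
      _ ≤ _ := by gcongr

/-- for `0 < ν < 1`,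
`(1+|z|)^{-ν} Σ_{λ∈Λ_l} |λ|^ν dist(z,Λ_l)/|z-λ| ≍ 1` for `z ∈ ℂ ∖ Λ_l`. -/
theorem statement19 (l : ℤ) (hl : l = -1 ∨ l = 0 ∨ l = 1) (θ : ℤ → ℝ)
    (ν : ℝ) (hν : 0 < ν) (hν' : ν < 1) :
    ∃ c C : ℝ, 0 < c ∧ 0 < C ∧ ∀ z : ℂ, z ∉ LamSet θ l →
      ENNReal.ofReal c ≤
        ENNReal.ofReal ((1 + ‖z‖) ^ (-ν)) *
          (∑' k : ℕ, ENNReal.ofReal (‖lamPt θ (l + k)‖ ^ ν *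
            (Metric.infDist z (LamSet θ l) / ‖z - lamPt θ (l + k)‖))) ∧
      ENNReal.ofReal ((1 + ‖z‖) ^ (-ν)) *
          (∑' k : ℕ, ENNReal.ofReal (‖lamPt θ (l + k)‖ ^ ν *
            (Metric.infDist z (LamSet θ l) / ‖z - lamPt θ (l + k)‖))) ≤
        ENNReal.ofReal C := by
  set δ := min ν (1 - ν) / 2 with hδ
  have hδ0 : 0 < δ := by
    have : 0 < min ν (1 - ν) := lt_min hν (by linarith)
    positivity
  have hδ1 : 2 * δ ≤ ν := by linarith [min_le_left ν (1 - ν)]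
  have hδ2 : 2 * δ ≤ 1 - ν := by linarith [min_le_right ν (1 - ν)]
  have hS := summable_aux δ hδ0
  refine ⟨1 / 100, 8 * (Real.exp δ * ∑' m : ℤ, Real.exp (-(δ * |(m : ℝ)|))), by norm_num, ?_, ?_⟩
  · have := hS.tsum_pos (fun _ => (Real.exp_pos _).le) 0 (Real.exp_pos _)
    positivity
  · intro z hz
    have hpow : 0 ≤ (1 + ‖z‖) ^ (-ν) := by positivity
    rw [← ENNReal.tsum_mul_left]
    constructor
    · obtain ⟨k, hk⟩ := term_lower_aux l hl θ ν hν hν' z hz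
      refine le_trans ?_ (ENNReal.le_tsum k)
      rw [← ENNReal.ofReal_mul hpow]
      exact ENNReal.ofReal_le_ofReal hk
    · rw [ENNReal.ofReal_mul (by norm_num)]
      refine le_trans (ENNReal.tsum_le_tsum (fun k => ?_)) (le_trans (ENNReal.tsum_mul_left
        (a := ENNReal.ofReal 8)).le
        (mul_le_mul_right (sum_shift_aux δ hδ0 (2 * Real.log (1 + ‖z‖) - 1 - l)) _))
      rw [← ENNReal.ofReal_mul hpow, ← ENNReal.ofReal_mul (by norm_num)]
      exact ENNReal.ofReal_le_ofReal (term_upper_aux l hl θ ν δ hδ1 hδ2 z hz k)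

end
end
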